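/- arXiv:2005.01640 — 7 statements merged into one kernel-verified Lean document; each statement's English description precedes it below -/
import Mathlib

section
/- Consider a sequence (G^N)_{N∈ℕ} of games under Assumption 4.1, and the game G^∞ with countably infinitely many DMs in which DM i's long-term cost under a joint mixed strategy γ = (γ^j)_{j∈ℕ} is J̄^{i,∞}(γ) := limsup_{N→∞} E^{(γ^1,…,γ^N)}[J̄^{i,N}]. Let γ^{*,N} = (γ^{1,N},…,γ^{N,N}) be an SEBEU in mixed strategies in G^N for each N, and suppose there exists a joint mixed strategy γ^{*,∞} = (γ^{1,∞},γ^{2,∞},…) such that, for every i ∈ ℕ, the Prokhorov distance between the probability measure μ^{i,γ^{*,N}} induced on DM i's history space I_T^i × Y^{[0,T)} by γ^{*,N} in G^N and the measure μ^{i,(γ^{1,∞},…,γ^{N,∞})} induced by (γ^{1,∞},…,γ^{N,∞}) in G^N tends to 0 as N → ∞. Then γ^{*,∞} is a Nash equilibrium in G^∞: J̄^{i,∞}(γ^{i,∞}, γ^{−i,∞}) ≤ J̄^{i,∞}(γ̃^i, γ^{−i,∞}) for every i ∈ ℕ and every mixed strategy γ̃^i ∈ Γ^i. -/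
/-
STATEMENT 4.  Limits of SEBEU are Nash equilibria of the game `G^∞` with countably
infinitely many DMs (under Assumption 4.1, large games with aggregate-statistic-driven
environment; model as in the paper, time running over `ℕ`, which subsumes every horizon
`T ∈ ℕ ∪ {∞}`).

In `G^∞`, DM `i`'s long-term cost under a joint mixed strategy `γ = (γʲ)_{j∈ℕ}` is
`J̄^{i,∞}(γ) := limsup_{N→∞} E^{(γ¹,…,γᴺ)}[J̄^{i,N}]`.  Let `γstar N` be an SEBEU in mixed
strategies in `G^N` for each `N`, and suppose there is a joint mixed strategy `γinf` such
that for every `i` the Lévy–Prokhorov (Prokhorov) distance between the probability measure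
induced on DM `i`'s history space `I_Tᶦ × Y^{[0,T)}` by `γstar N` in `G^N` and the one
induced by `(γinf 0, …, γinf (N-1))` in `G^N` tends to `0` as `N → ∞`.  Then `γinf` is a
Nash equilibrium in `G^∞`:
`J̄^{i,∞}(γinf) ≤ J̄^{i,∞}(γ̃ᶦ, γinf^{-i})` for every `i ∈ ℕ` and every mixed strategy
`γ̃ᶦ`.  (The history spaces, countable products of metric spaces, are equipped with a
product metric; the Lévy–Prokhorov metric metrizes weak convergence on them.)
-/

open MeasureTheory

namespace SEBEULarge

/-- Borel σ-algebra on a space of continuous maps. -/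
noncomputable instance instMeasurableSpaceContinuousMap (A B : Type)
    [TopologicalSpace A] [TopologicalSpace B] : MeasurableSpace C(A, B) := borel _

/-- Information of a DM at time `t`. -/
abbrev Hist (X U Y : Type) (t : ℕ) : Type :=
  (Fin (t + 1) → X) × (Fin t → U) × (Fin t → Y)

variable (X U W X0 W0 Ξ Y D : Type)
variable [TopologicalSpace X] [TopologicalSpace U] [TopologicalSpace Y]

/-- The common pure strategy space of every DM (Assumption 4.1). -/
abbrev Strat (Sset : ∀ t : ℕ, Set C(Hist X U Y t, U)) : Type := ∀ t : ℕ, ↥(Sset t)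

/-- Joint history in the game `G^N` at time `t`. -/
abbrev SysHist (N : ℕ) (t : ℕ) : Type :=
  (Fin N → (Fin (t + 1) → X) × (Fin t → U)) × (Fin t → Y) × X0

/-- Environment primitive random variables `ω⁰ = (x₀⁰, (w_t⁰), (ξ_t))`. -/
abbrev Prim0 : Type := X0 × (ℕ → W0) × (ℕ → Ξ)

/-- DM-local primitive random variables `ωᶦ = (x₀ᶦ, (w_tᶦ))`. -/
abbrev PrimLoc : Type := X × (ℕ → W)

variable {X U W X0 W0 Ξ Y D}
variable {Sset : ∀ t : ℕ, Set C(Hist X U Y t, U)}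

/-- Closed-loop joint history in `G^N` under the pure strategy profile `s`:
`u_tᶦ = s_tᶦ(I_tᶦ, Y_{t-1})`, `d_t = d_t^N(x_t, u_t)`, `y_t = g_t(x_t⁰, d_t, ξ_t)`,
`x_{t+1}⁰ = f_t⁰(x_t⁰, d_t, w_t⁰)`, `x_{t+1}ᶦ = f_tᶦ(x_tᶦ, u_tᶦ, y_t, w_tᶦ)`. -/
noncomputable def sysHist
    (f : ℕ → ℕ → X → U → Y → W → X)
    (dstat : (N : ℕ) → ℕ → (Fin N → X) → (Fin N → U) → D)
    (g : ℕ → X0 → D → Ξ → Y) (f0 : ℕ → X0 → D → W0 → X0)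
    {N : ℕ} (s : Fin N → Strat X U Y Sset)
    (ω : Prim0 X0 W0 Ξ × (Fin N → PrimLoc X W)) :
    (t : ℕ) → SysHist X U X0 Y N t
  | 0 => (fun i => (fun _ => (ω.2 i).1, Fin.elim0), Fin.elim0, ω.1.1)
  | t + 1 =>
      let h := sysHist f dstat g f0 s ω t
      let xcur : Fin N → X := fun i => (h.1 i).1 (Fin.last t)
      let u : Fin N → U := fun i => (s i t).val ⟨(h.1 i).1, (h.1 i).2, h.2.1⟩
      let d : D := dstat N t xcur u
      let y : Y := g t h.2.2 d (ω.1.2.2 t)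
      (fun i => (Fin.snoc (h.1 i).1 (f i t (xcur i) (u i) y ((ω.2 i).2 t)),
                 Fin.snoc (h.1 i).2 (u i)),
       Fin.snoc h.2.1 y,
       f0 t h.2.2 d (ω.1.2.1 t))

/-- Realized environment path in `G^N` under the profile `s`. -/
noncomputable def yPath
    (f : ℕ → ℕ → X → U → Y → W → X)
    (dstat : (N : ℕ) → ℕ → (Fin N → X) → (Fin N → U) → D)
    (g : ℕ → X0 → D → Ξ → Y) (f0 : ℕ → X0 → D → W0 → X0)
    {N : ℕ} (s : Fin N → Strat X U Y Sset)
    (ω : Prim0 X0 W0 Ξ × (Fin N → PrimLoc X W)) : ℕ → Y :=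
  fun t => (sysHist f dstat g f0 s ω (t + 1)).2.1 (Fin.last t)

/-- DM `i`'s state–control history under strategy `si` against a fixed deterministic
environment sequence `Z` (independent of `N`). -/
noncomputable def subjHist (f : ℕ → ℕ → X → U → Y → W → X) (i : ℕ)
    (si : Strat X U Y Sset) (Z : ℕ → Y) (ωi : PrimLoc X W) :
    (t : ℕ) → (Fin (t + 1) → X) × (Fin t → U)
  | 0 => (fun _ => ωi.1, Fin.elim0)
  | t + 1 =>
      let h := subjHist f i si Z ωi t
      let u : U := (si t).val ⟨h.1, h.2, fun k : Fin t => Z k⟩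
      (Fin.snoc h.1 (f i t (h.1 (Fin.last t)) u (Z t) (ωi.2 t)), Fin.snoc h.2 u)

section Meas

variable [MeasurableSpace X] [MeasurableSpace U] [MeasurableSpace X0]
    [MeasurableSpace W0] [MeasurableSpace W] [MeasurableSpace Y] [MeasurableSpace Ξ]
variable (μ0 : Measure (Prim0 X0 W0 Ξ)) (μloc : ℕ → Measure (PrimLoc X W))
variable [IsProbabilityMeasure μ0] [∀ i, IsProbabilityMeasure (μloc i)]

/-- Joint law of all primitive random variables in `G^N`: the mutually independent product
of `μ0` and the local laws `μloc i`, `i < N` (Assumption 4.1, Condition 3). -/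
noncomputable def jointLaw (N : ℕ) : Measure (Prim0 X0 W0 Ξ × (Fin N → PrimLoc X W)) :=
  μ0.prod (Measure.pi fun i : Fin N => μloc i)

/-- Subjective cost `Jᶦ(sᶦ, Z)` of DM `i` (the same function in every game containing
DM `i`). -/
noncomputable def subjCost
    (f : ℕ → ℕ → X → U → Y → W → X) (c : ℕ → ℕ → X → U → Y → ℝ) (β : ℕ → ℝ)
    (i : ℕ) (si : Strat X U Y Sset) (Z : ℕ → Y) : ℝ :=
  ∫ ωi, (∑' t : ℕ, β i ^ t *
      c i t ((subjHist f i si Z ωi t).1 (Fin.last t))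
            ((subjHist f i si Z ωi (t + 1)).2 (Fin.last t)) (Z t)) ∂(μloc i)

/-- Expected subjective cost `E^{(γ̃ᶦ, ζ)}[Jᶦ]` of DM `i` under the mixed strategy `γ̃ᶦ`
and an independent exogenous environment distribution `ζ`. -/
noncomputable def expSubjCost
    (f : ℕ → ℕ → X → U → Y → W → X) (c : ℕ → ℕ → X → U → Y → ℝ) (β : ℕ → ℝ)
    (i : ℕ) (γi : ProbabilityMeasure (Strat X U Y Sset)) (ζ : Measure (ℕ → Y)) : ℝ :=
  ∫ si, ∫ Z, subjCost μloc f c β i si Z ∂ζ ∂(γi : Measure (Strat X U Y Sset))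

/-- Environment distribution `ζ_γ` induced endogenously in `G^N` by the joint mixed
strategy `γ`. -/
noncomputable def envLawMixed
    (f : ℕ → ℕ → X → U → Y → W → X)
    (dstat : (N : ℕ) → ℕ → (Fin N → X) → (Fin N → U) → D)
    (g : ℕ → X0 → D → Ξ → Y) (f0 : ℕ → X0 → D → W0 → X0)
    (N : ℕ) (γ : Fin N → ProbabilityMeasure (Strat X U Y Sset)) : Measure (ℕ → Y) :=
  (Measure.pi fun j => (γ j : Measure (Strat X U Y Sset))).bind
    (fun s => Measure.map (yPath f dstat g f0 s) (jointLaw μ0 μloc N))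

/-- Actual (objective) long-term cost `J̄^{i,N}(s)` of DM `i` in `G^N` under the pure
strategy profile `s`. -/
noncomputable def objCost
    (f : ℕ → ℕ → X → U → Y → W → X)
    (dstat : (N : ℕ) → ℕ → (Fin N → X) → (Fin N → U) → D)
    (g : ℕ → X0 → D → Ξ → Y) (f0 : ℕ → X0 → D → W0 → X0)
    (c : ℕ → ℕ → X → U → Y → ℝ) (β : ℕ → ℝ)
    {N : ℕ} (i : Fin N) (s : Fin N → Strat X U Y Sset) : ℝ :=
  ∫ ω, (∑' t : ℕ, β i.val ^ t *
      c i.val t (((sysHist f dstat g f0 s ω t).1 i).1 (Fin.last t))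
                (((sysHist f dstat g f0 s ω (t + 1)).1 i).2 (Fin.last t))
                ((sysHist f dstat g f0 s ω (t + 1)).2.1 (Fin.last t))) ∂(jointLaw μ0 μloc N)

/-- Expected objective cost `E^{γ}[J̄^{i,N}]` of DM `i` in `G^N` under the joint mixed
strategy `γ`. -/
noncomputable def expObjCost
    (f : ℕ → ℕ → X → U → Y → W → X)
    (dstat : (N : ℕ) → ℕ → (Fin N → X) → (Fin N → U) → D)
    (g : ℕ → X0 → D → Ξ → Y) (f0 : ℕ → X0 → D → W0 → X0)
    (c : ℕ → ℕ → X → U → Y → ℝ) (β : ℕ → ℝ)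
    {N : ℕ} (i : Fin N) (γ : Fin N → ProbabilityMeasure (Strat X U Y Sset)) : ℝ :=
  ∫ s, objCost μ0 μloc f dstat g f0 c β i s
    ∂(Measure.pi fun j => (γ j : Measure (Strat X U Y Sset)))

end Meas

end SEBEULarge



namespace SEBEULarge

/-- A (highly non-canonical, but topologically correct) metric on a countable product of
metric spaces: the Lévy–Prokhorov distances below are taken with respect to it. -/
noncomputable instance instMetricSpacePiNat (F : ℕ → Type) [∀ i, MetricSpace (F i)] :
    MetricSpace (∀ i, F i) :=
  PiCountable.metricSpace

variable {X U W X0 W0 Ξ Y D : Type}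
variable [TopologicalSpace X] [TopologicalSpace U] [TopologicalSpace Y]
variable {Sset : ∀ t : ℕ, Set C(Hist X U Y t, U)}

/-- DM `i`'s observation history `(I_Tᶦ, Y_{T-1})` in `G^N`: its own state and control
paths together with the environment path, realized under the profile `s` and the
primitive randomness `ω`. -/
noncomputable def histPath
    (f : ℕ → ℕ → X → U → Y → W → X)
    (dstat : (N : ℕ) → ℕ → (Fin N → X) → (Fin N → U) → D)
    (g : ℕ → X0 → D → Ξ → Y) (f0 : ℕ → X0 → D → W0 → X0)
    {N : ℕ} (i : Fin N) (s : Fin N → Strat X U Y Sset)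
    (ω : Prim0 X0 W0 Ξ × (Fin N → PrimLoc X W)) :
    ((ℕ → X) × (ℕ → U)) × (ℕ → Y) :=
  ((fun t => ((sysHist f dstat g f0 s ω t).1 i).1 (Fin.last t),
    fun t => ((sysHist f dstat g f0 s ω (t + 1)).1 i).2 (Fin.last t)),
   fun t => (sysHist f dstat g f0 s ω (t + 1)).2.1 (Fin.last t))

section Meas

variable [MeasurableSpace X] [MeasurableSpace U] [MeasurableSpace X0]
    [MeasurableSpace W0] [MeasurableSpace W] [MeasurableSpace Y] [MeasurableSpace Ξ]
variable (μ0 : Measure (Prim0 X0 W0 Ξ)) (μloc : ℕ → Measure (PrimLoc X W))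
variable [IsProbabilityMeasure μ0] [∀ i, IsProbabilityMeasure (μloc i)]

/-- The probability measure `μ^{i,γ}` induced on DM `i`'s history space
`I_Tᶦ × Y^{[0,T)}` by the joint mixed strategy `γ` in `G^N`. -/
noncomputable def histLaw
    (f : ℕ → ℕ → X → U → Y → W → X)
    (dstat : (N : ℕ) → ℕ → (Fin N → X) → (Fin N → U) → D)
    (g : ℕ → X0 → D → Ξ → Y) (f0 : ℕ → X0 → D → W0 → X0)
    {N : ℕ} (i : Fin N) (γ : Fin N → ProbabilityMeasure (Strat X U Y Sset)) :
    Measure (((ℕ → X) × (ℕ → U)) × (ℕ → Y)) :=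
  (Measure.pi fun j => (γ j : Measure (Strat X U Y Sset))).bind
    (fun s => Measure.map (histPath f dstat g f0 i s) (jointLaw μ0 μloc N))

/-- DM `i`'s long-term cost `J̄^{i,∞}(γ) = limsup_{N→∞} E^{(γ¹,…,γᴺ)}[J̄^{i,N}]` in the
game `G^∞` with countably infinitely many DMs. -/
noncomputable def objCostInf
    (f : ℕ → ℕ → X → U → Y → W → X)
    (dstat : (N : ℕ) → ℕ → (Fin N → X) → (Fin N → U) → D)
    (g : ℕ → X0 → D → Ξ → Y) (f0 : ℕ → X0 → D → W0 → X0)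
    (c : ℕ → ℕ → X → U → Y → ℝ) (β : ℕ → ℝ)
    (i : ℕ) (γ : ℕ → ProbabilityMeasure (Strat X U Y Sset)) : ℝ :=
  Filter.limsup
    (fun N : ℕ =>
      if h : i < N then
        expObjCost μ0 μloc f dstat g f0 c β (⟨i, h⟩ : Fin N) (fun j => γ j.val)
      else 0)
    Filter.atTop

end Meas

end SEBEULarge

namespace SEBEULarge

section General

open Filter Topology

theorem integrable_of_continuous_compact {A : Type*} [TopologicalSpace A] [CompactSpace A]
    [MeasurableSpace A] [OpensMeasurableSpace A] (μ : Measure A) [IsFiniteMeasure μ]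
    {F : A → ℝ} (hF : Continuous F) : Integrable F μ := by
  obtain ⟨M, hM⟩ := (isCompact_range hF).isBounded.exists_norm_le
  exact Integrable.of_bound hF.measurable.aestronglyMeasurable M
    (ae_of_all _ fun a => hM _ ⟨a, rfl⟩)

theorem continuous_integral_of_compact {A B : Type*} [TopologicalSpace A]
    [FirstCountableTopology A] [CompactSpace A] [TopologicalSpace B] [CompactSpace B]
    [MeasurableSpace B] [OpensMeasurableSpace B] (μ : Measure B) [IsFiniteMeasure μ]
    {F : A → B → ℝ} (hF : Continuous fun p : A × B => F p.1 p.2) :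
    Continuous fun a => ∫ b, F a b ∂μ := by
  obtain ⟨M, hM⟩ := (isCompact_range hF).isBounded.exists_norm_le
  refine continuous_of_dominated (bound := fun _ => M) (fun a => ?_) (fun a => ?_)
    (integrable_const _) (ae_of_all _ fun b => ?_)
  · exact (hF.comp (Continuous.prodMk_right a)).measurable.aestronglyMeasurable
  · exact ae_of_all _ fun b => hM _ ⟨(a, b), rfl⟩
  · exact hF.comp (Continuous.prodMk_left b)

/-- Mixing the laws of `h s` over a random parameter `s` gives the law of `h` on the product. -/
theorem bind_map_eq_map_prod {A B E : Type*} [MeasurableSpace A] [MeasurableSpace B]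
    [MeasurableSpace E] (μ : Measure A) (ν : Measure B) [SFinite ν]
    {h : A → B → E} (hh : Measurable fun p : A × B => h p.1 p.2) :
    μ.bind (fun a => Measure.map (h a) ν) = Measure.map (fun p : A × B => h p.1 p.2) (μ.prod ν) := by
  have hsec : ∀ a, Measurable (h a) := fun a => hh.comp measurable_prodMk_left
  have hk : Measurable fun a => Measure.map (h a) ν := by
    refine Measure.measurable_of_measurable_coe _ fun s hs => ?_
    simp_rw [Measure.map_apply (hsec _) hs]
    exact measurable_measure_prodMk_left (hh hs)
  ext s hs
  rw [Measure.bind_apply hs hk.aemeasurable, Measure.map_apply hh hs,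
    Measure.prod_apply (hh hs)]
  exact lintegral_congr fun a => Measure.map_apply (hsec a) hs

/-- Resampling one coordinate of a product measure replaces the corresponding factor. -/
theorem map_update_prod_pi {ι A : Type*} [Fintype ι] [DecidableEq ι] [MeasurableSpace A]
    (μ μ' : ι → Measure A) [∀ j, IsProbabilityMeasure (μ j)]
    [∀ j, IsProbabilityMeasure (μ' j)] (i : ι) (hμ : ∀ j, j ≠ i → μ' j = μ j) :
    Measure.map (fun p : A × (ι → A) => Function.update p.2 i p.1)
      ((μ' i).prod (Measure.pi μ)) = Measure.pi μ' := by
  have hm : Measurable fun p : A × (ι → A) => Function.update p.2 i p.1 := by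
    refine measurable_pi_lambda _ fun j => ?_
    by_cases hj : j = i
    · subst hj; simpa using measurable_fst
    · simp only [Function.update_of_ne hj]
      exact (measurable_pi_apply j).comp measurable_snd
  refine (Measure.pi_eq fun s hs => ?_).symm
  rw [Measure.map_apply hm (MeasurableSet.univ_pi hs)]
  have hpre : (fun p : A × (ι → A) => Function.update p.2 i p.1) ⁻¹' Set.pi Set.univ s =
      s i ×ˢ Set.pi Set.univ (Function.update s i Set.univ) := by
    ext p
    simp only [Set.mem_preimage, Set.mem_pi, Set.mem_univ, true_imp_iff, Set.mem_prod]
    constructor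
    · refine fun hp => ⟨by simpa using hp i, fun j => ?_⟩
      by_cases hj : j = i
      · subst hj; simp
      · simpa [Function.update_of_ne hj] using hp j
    · rintro ⟨h1, h2⟩ j
      by_cases hj : j = i
      · subst hj; simpa using h1
      · simpa [Function.update_of_ne hj] using h2 j
  rw [hpre, Measure.prod_prod, Measure.pi_pi,
    ← Finset.mul_prod_erase Finset.univ (fun j => μ' j (s j)) (Finset.mem_univ i),
    ← Finset.mul_prod_erase Finset.univ (fun j => μ j _) (Finset.mem_univ i)]
  simp only [Function.update_self, measure_univ, one_mul]
  congr 1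
  refine Finset.prod_congr rfl fun j hj => ?_
  have hj' := Finset.ne_of_mem_erase hj
  rw [Function.update_of_ne hj', hμ j hj']

/-- On a compact metric space, measures that are close in the Lévy–Prokhorov metric give close
integrals to a fixed continuous function. -/
theorem exists_forall_levyProkhorovDist_lt {A : Type*} [MetricSpace A] [CompactSpace A]
    [MeasurableSpace A] [BorelSpace A] {F : A → ℝ} (hF : Continuous F) {ε : ℝ} (hε : 0 < ε) :
    ∃ δ > 0, ∀ (μ ν : Measure A) [IsProbabilityMeasure μ] [IsProbabilityMeasure ν],
      levyProkhorovDist μ ν < δ → |∫ a, F a ∂μ - ∫ a, F a ∂ν| < ε := by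
  have hc : CompactSpace (LevyProkhorov (ProbabilityMeasure A)) :=
    LevyProkhorov.probabilityMeasureHomeomorph.compactSpace
  have hcont : Continuous fun μ : LevyProkhorov (ProbabilityMeasure A) =>
      ∫ a, F a ∂(μ.toMeasure : Measure A) :=
    (ProbabilityMeasure.continuous_integral_boundedContinuousFunction
      (BoundedContinuousFunction.mkOfCompact ⟨F, hF⟩)).comp
      LevyProkhorov.continuous_toMeasure_probabilityMeasure
  have huc := CompactSpace.uniformContinuous_of_continuous hcont
  obtain ⟨δ, hδ, h⟩ := Metric.uniformContinuous_iff.1 huc ε hε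
  refine ⟨δ, hδ, fun μ ν _ _ hμν => ?_⟩
  have := h (a := ⟨⟨μ, inferInstance⟩⟩) (b := ⟨⟨ν, inferInstance⟩⟩) hμν
  rwa [Real.dist_eq] at this

end General

end SEBEULarge
namespace SEBEULarge

section Dynamics

variable {X U W X0 W0 Ξ Y D : Type}
  [MetricSpace X] [CompactSpace X] [MetricSpace U] [CompactSpace U]
  [MetricSpace W] [MetricSpace X0] [MetricSpace W0]
  [MetricSpace Ξ] [MetricSpace Y] [CompactSpace Y] [MetricSpace D]
  {f : ℕ → ℕ → X → U → Y → W → X}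
  {dstat : (N : ℕ) → ℕ → (Fin N → X) → (Fin N → U) → D}
  {g : ℕ → X0 → D → Ξ → Y} {f0 : ℕ → X0 → D → W0 → X0}
  {c : ℕ → ℕ → X → U → Y → ℝ} {β : ℕ → ℝ}
  {Sset : ∀ t : ℕ, Set C(Hist X U Y t, U)}

theorem continuous_strat_eval (t : ℕ) :
    Continuous fun p : Strat X U Y Sset × Hist X U Y t => (p.1 t).val p.2 := by
  have h1 : Continuous fun p : Strat X U Y Sset × Hist X U Y t => (p.1 t).val :=
    continuous_subtype_val.comp ((continuous_apply t).comp continuous_fst)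
  exact h1.eval continuous_snd

theorem continuous_sysHist
    (hf : ∀ i t, Continuous fun p : X × U × Y × W => f i t p.1 p.2.1 p.2.2.1 p.2.2.2)
    (hg : ∀ t, Continuous fun p : X0 × D × Ξ => g t p.1 p.2.1 p.2.2)
    (hf0 : ∀ t, Continuous fun p : X0 × D × W0 => f0 t p.1 p.2.1 p.2.2)
    (hd : ∀ N t, Continuous fun p : (Fin N → X) × (Fin N → U) => dstat N t p.1 p.2)
    (N t : ℕ) :
    Continuous fun p : (Fin N → Strat X U Y Sset) × (Prim0 X0 W0 Ξ × (Fin N → PrimLoc X W)) =>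
      sysHist f dstat g f0 p.1 p.2 t := by
  induction t with
  | zero =>
    simp only [sysHist]
    refine .prodMk (continuous_pi fun i => .prodMk (continuous_pi fun _ => ?_) continuous_const)
      (.prodMk continuous_const ?_)
    · fun_prop
    · fun_prop
  | succ t ih =>
    have hh : ∀ i, Continuous fun p : (Fin N → Strat X U Y Sset) ×
        (Prim0 X0 W0 Ξ × (Fin N → PrimLoc X W)) => (sysHist f dstat g f0 p.1 p.2 t).1 i :=
      fun i => (continuous_apply i).comp (continuous_fst.comp ih)
    have hx : ∀ i, Continuous fun p : (Fin N → Strat X U Y Sset) ×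
        (Prim0 X0 W0 Ξ × (Fin N → PrimLoc X W)) =>
          ((sysHist f dstat g f0 p.1 p.2 t).1 i).1 (Fin.last t) :=
      fun i => (continuous_apply _).comp (continuous_fst.comp (hh i))
    have hu : ∀ i, Continuous fun p : (Fin N → Strat X U Y Sset) ×
        (Prim0 X0 W0 Ξ × (Fin N → PrimLoc X W)) =>
          (p.1 i t).val ⟨((sysHist f dstat g f0 p.1 p.2 t).1 i).1,
            ((sysHist f dstat g f0 p.1 p.2 t).1 i).2, (sysHist f dstat g f0 p.1 p.2 t).2.1⟩ :=
      fun i => (continuous_strat_eval t).comp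
        (((continuous_apply i).comp continuous_fst).prodMk
          ((continuous_fst.comp (hh i)).prodMk
            ((continuous_snd.comp (hh i)).prodMk (continuous_fst.comp (continuous_snd.comp ih)))))
    have hdc := (hd N t).comp ((continuous_pi hx).prodMk (continuous_pi hu))
    have h0 := continuous_snd.comp (continuous_snd.comp ih)
    have hξ : Continuous fun p : (Fin N → Strat X U Y Sset) ×
        (Prim0 X0 W0 Ξ × (Fin N → PrimLoc X W)) => p.2.1.2.2 t := by fun_prop
    have hw0 : Continuous fun p : (Fin N → Strat X U Y Sset) ×
        (Prim0 X0 W0 Ξ × (Fin N → PrimLoc X W)) => p.2.1.2.1 t := by fun_prop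
    have hw : ∀ i, Continuous fun p : (Fin N → Strat X U Y Sset) ×
        (Prim0 X0 W0 Ξ × (Fin N → PrimLoc X W)) => (p.2.2 i).2 t := fun i => by fun_prop
    have hy := (hg t).comp (h0.prodMk (hdc.prodMk hξ))
    simp only [sysHist]
    refine .prodMk (continuous_pi fun i => .prodMk ?_ ?_) (.prodMk ?_ ?_)
    · exact (continuous_fst.comp (hh i)).finSnoc
        ((hf i t).comp ((hx i).prodMk ((hu i).prodMk (hy.prodMk (hw i)))))
    · exact (continuous_snd.comp (hh i)).finSnoc (hu i)
    · exact (continuous_fst.comp (continuous_snd.comp ih)).finSnoc hy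
    · exact (hf0 t).comp (h0.prodMk (hdc.prodMk hw0))

theorem continuous_histPath
    (hf : ∀ i t, Continuous fun p : X × U × Y × W => f i t p.1 p.2.1 p.2.2.1 p.2.2.2)
    (hg : ∀ t, Continuous fun p : X0 × D × Ξ => g t p.1 p.2.1 p.2.2)
    (hf0 : ∀ t, Continuous fun p : X0 × D × W0 => f0 t p.1 p.2.1 p.2.2)
    (hd : ∀ N t, Continuous fun p : (Fin N → X) × (Fin N → U) => dstat N t p.1 p.2)
    {N : ℕ} (i : Fin N) :
    Continuous fun p : (Fin N → Strat X U Y Sset) × (Prim0 X0 W0 Ξ × (Fin N → PrimLoc X W)) =>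
      histPath f dstat g f0 i p.1 p.2 := by
  have h := continuous_sysHist (Sset := Sset) hf hg hf0 hd N
  refine .prodMk (.prodMk (continuous_pi fun t => ?_) (continuous_pi fun t => ?_))
    (continuous_pi fun t => ?_)
  · exact (continuous_apply _).comp
      (continuous_fst.comp ((continuous_apply i).comp (continuous_fst.comp (h t))))
  · exact (continuous_apply _).comp
      (continuous_snd.comp ((continuous_apply i).comp (continuous_fst.comp (h (t + 1)))))
  · exact (continuous_apply _).comp (continuous_fst.comp (continuous_snd.comp (h (t + 1))))

theorem continuous_subjHist
    (hf : ∀ i t, Continuous fun p : X × U × Y × W => f i t p.1 p.2.1 p.2.2.1 p.2.2.2)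
    (i t : ℕ) :
    Continuous fun p : Strat X U Y Sset × (ℕ → Y) × PrimLoc X W =>
      subjHist f i p.1 p.2.1 p.2.2 t := by
  induction t with
  | zero =>
    simp only [subjHist]
    exact .prodMk (continuous_pi fun _ => by fun_prop) continuous_const
  | succ t ih =>
    have hu : Continuous fun p : Strat X U Y Sset × (ℕ → Y) × PrimLoc X W =>
        (p.1 t).val ⟨(subjHist f i p.1 p.2.1 p.2.2 t).1, (subjHist f i p.1 p.2.1 p.2.2 t).2,
          fun k : Fin t => p.2.1 k⟩ :=
      (continuous_strat_eval t).comp (continuous_fst.prodMk ((continuous_fst.comp ih).prodMk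
        ((continuous_snd.comp ih).prodMk (continuous_pi fun k => by fun_prop))))
    have hZ : Continuous fun p : Strat X U Y Sset × (ℕ → Y) × PrimLoc X W => p.2.1 t := by
      fun_prop
    have hw : Continuous fun p : Strat X U Y Sset × (ℕ → Y) × PrimLoc X W => p.2.2.2 t := by
      fun_prop
    simp only [subjHist]
    exact .prodMk ((continuous_fst.comp ih).finSnoc
      ((hf i t).comp (((continuous_apply _).comp (continuous_fst.comp ih)).prodMk
        (hu.prodMk (hZ.prodMk hw))))) ((continuous_snd.comp ih).finSnoc hu)

/-- Discounted cost of DM `i` along a path of its states, its controls and the environment. -/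
noncomputable def pathCost (c : ℕ → ℕ → X → U → Y → ℝ) (β : ℕ → ℝ) (i : ℕ)
    (h : ((ℕ → X) × (ℕ → U)) × (ℕ → Y)) : ℝ :=
  ∑' t : ℕ, β i ^ t * c i t (h.1.1 t) (h.1.2 t) (h.2 t)

theorem continuous_pathCost
    (hc : ∀ i t, Continuous fun p : X × U × Y => c i t p.1 p.2.1 p.2.2)
    {cbar βbar : ℝ} (hcb : ∀ i t x u y, |c i t x u y| ≤ cbar)
    (hβ0 : ∀ i, 0 ≤ β i) (hβb : ∀ i, β i ≤ βbar) (hβbar : βbar < 1) (i : ℕ) :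
    Continuous (pathCost c β i) := by
  refine continuous_tsum (u := fun t => βbar ^ t * cbar) (fun t => ?_) ?_ fun t h => ?_
  · have : Continuous fun h : ((ℕ → X) × (ℕ → U)) × (ℕ → Y) => (h.1.1 t, h.1.2 t, h.2 t) := by
      fun_prop
    exact continuous_const.mul ((hc i t).comp this)
  · exact (summable_geometric_of_lt_one ((hβ0 i).trans (hβb i)) hβbar).mul_right _
  · rw [Real.norm_eq_abs, abs_mul, abs_of_nonneg (pow_nonneg (hβ0 i) t)]
    exact mul_le_mul (pow_le_pow_left₀ (hβ0 i) (hβb i) t) (hcb _ _ _ _ _) (abs_nonneg _)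
      (pow_nonneg ((hβ0 i).trans (hβb i)) t)

/-- State and control paths of DM `i` against a fixed environment path, with that path. -/
noncomputable def subjPath (f : ℕ → ℕ → X → U → Y → W → X) (i : ℕ)
    (si : Strat X U Y Sset) (Z : ℕ → Y) (ωi : PrimLoc X W) :
    ((ℕ → X) × (ℕ → U)) × (ℕ → Y) :=
  ((fun t => (subjHist f i si Z ωi t).1 (Fin.last t),
    fun t => (subjHist f i si Z ωi (t + 1)).2 (Fin.last t)), Z)

theorem continuous_subjPath
    (hf : ∀ i t, Continuous fun p : X × U × Y × W => f i t p.1 p.2.1 p.2.2.1 p.2.2.2)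
    (i : ℕ) :
    Continuous fun p : Strat X U Y Sset × (ℕ → Y) × PrimLoc X W =>
      subjPath f i p.1 p.2.1 p.2.2 := by
  have h := continuous_subjHist (Sset := Sset) hf i
  refine .prodMk (.prodMk (continuous_pi fun t => ?_) (continuous_pi fun t => ?_)) (by fun_prop)
  · exact (continuous_apply _).comp (continuous_fst.comp (h t))
  · exact (continuous_apply _).comp (continuous_snd.comp (h (t + 1)))

theorem sysHist_env {N : ℕ} (s : Fin N → Strat X U Y Sset)
    (ω : Prim0 X0 W0 Ξ × (Fin N → PrimLoc X W)) (t : ℕ) (k : Fin t) :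
    (sysHist f dstat g f0 s ω t).2.1 k = yPath f dstat g f0 s ω k := by
  induction t with
  | zero => exact k.elim0
  | succ t ih =>
    refine Fin.lastCases ?_ (fun k => ?_) k
    · rfl
    · rw [Fin.val_castSucc, ← ih k]
      simp only [sysHist, Fin.snoc_castSucc]

/-- Given the realized environment path, a DM's own history in the game solves the same
recursion as against an exogenous environment. -/
theorem sysHist_loc {N : ℕ} (s : Fin N → Strat X U Y Sset)
    (ω : Prim0 X0 W0 Ξ × (Fin N → PrimLoc X W)) (i : Fin N) (t : ℕ) :
    (sysHist f dstat g f0 s ω t).1 i =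
      subjHist f i (s i) (yPath f dstat g f0 s ω) (ω.2 i) t := by
  induction t with
  | zero => rfl
  | succ t ih =>
    have hy : (sysHist f dstat g f0 s ω t).2.1 = fun k : Fin t => yPath f dstat g f0 s ω k :=
      funext (sysHist_env s ω t)
    have hyt : yPath f dstat g f0 s ω t =
        g t (sysHist f dstat g f0 s ω t).2.2
          (dstat N t (fun i => ((sysHist f dstat g f0 s ω t).1 i).1 (Fin.last t))
            (fun i => (s i t).val ⟨((sysHist f dstat g f0 s ω t).1 i).1,
              ((sysHist f dstat g f0 s ω t).1 i).2, (sysHist f dstat g f0 s ω t).2.1⟩))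
          (ω.1.2.2 t) := by
      simp only [yPath, sysHist, Fin.snoc_last]
    simp only [subjHist, ← ih, ← hy]
    rw [hyt]
    simp only [sysHist]

theorem histPath_eq_subjPath {N : ℕ} (s : Fin N → Strat X U Y Sset)
    (ω : Prim0 X0 W0 Ξ × (Fin N → PrimLoc X W)) (i : Fin N) :
    histPath f dstat g f0 i s ω =
      subjPath f i (s i) (yPath f dstat g f0 s ω) (ω.2 i) := by
  simp only [histPath, subjPath, sysHist_loc]
  rfl

end Dynamics

end SEBEULarge
namespace SEBEULarge

section Stability

open Filter Topology

variable {X U W X0 W0 Ξ Y D : Type}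
  [MetricSpace X] [MetricSpace U] [MetricSpace W] [MetricSpace X0] [MetricSpace W0]
  [MetricSpace Ξ] [MetricSpace Y] [MetricSpace D] [CompactSpace D]

theorem dist_le_iSup_singlePlayerInfluence
    {dstat : (N : ℕ) → ℕ → (Fin N → X) → (Fin N → U) → D} (N t : ℕ) (i : Fin N)
    (x x' : Fin N → X) (u u' : Fin N → U) (h : ∀ j : Fin N, j ≠ i → x j = x' j ∧ u j = u' j) :
    dist (dstat N t x u) (dstat N t x' u') ≤
      ⨆ (i : Fin N) (x : Fin N → X) (u : Fin N → U)
            (x' : Fin N → X) (u' : Fin N → U)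
            (_ : ∀ j : Fin N, j ≠ i → x j = x' j ∧ u j = u' j),
          dist (dstat N t x u) (dstat N t x' u') := by
  have hB : ∀ a b : D, dist a b ≤ Metric.diam (Set.univ : Set D) := fun a b =>
    Metric.dist_le_diam_of_mem isCompact_univ.isBounded (Set.mem_univ a) (Set.mem_univ b)
  have hB0 : 0 ≤ Metric.diam (Set.univ : Set D) := Metric.diam_nonneg
  have bdd : ∀ {ι : Type} {F : ι → ℝ}, (∀ k, F k ≤ Metric.diam (Set.univ : Set D)) →
      BddAbove (Set.range F) := fun hF => ⟨_, Set.forall_mem_range.2 hF⟩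
  refine le_ciSup_of_le (bdd fun i => ?_) i ?_
  · exact Real.iSup_le (fun _ => Real.iSup_le (fun _ => Real.iSup_le (fun _ =>
      Real.iSup_le (fun _ => Real.iSup_le (fun _ => hB _ _) hB0) hB0) hB0) hB0) hB0
  refine le_ciSup_of_le (bdd fun i => ?_) x ?_
  · exact Real.iSup_le (fun _ => Real.iSup_le (fun _ =>
      Real.iSup_le (fun _ => Real.iSup_le (fun _ => hB _ _) hB0) hB0) hB0) hB0
  refine le_ciSup_of_le (bdd fun i => ?_) u ?_
  · exact Real.iSup_le (fun _ =>
      Real.iSup_le (fun _ => Real.iSup_le (fun _ => hB _ _) hB0) hB0) hB0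
  refine le_ciSup_of_le (bdd fun i => ?_) x' ?_
  · exact Real.iSup_le (fun _ => Real.iSup_le (fun _ => hB _ _) hB0) hB0
  refine le_ciSup_of_le (bdd fun i => ?_) u' ?_
  · exact Real.iSup_le (fun _ => hB _ _) hB0
  exact le_ciSup_of_le ⟨_, Set.forall_mem_range.2 fun _ => hB _ _⟩ h le_rfl

/-- If all players but one have nearby states and controls, then in large games the aggregate
statistics are close. -/
theorem eventually_dist_aggregate_lt
    {dstat : (N : ℕ) → ℕ → (Fin N → X) → (Fin N → U) → D} (t : ℕ)
    (hd1 : ∀ ε : ℝ, 0 < ε → ∃ δ : ℝ, 0 < δ ∧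
      ∀ (N : ℕ) (x u x' u'),
        (∀ i : Fin N, dist ((x i, u i) : X × U) (x' i, u' i) < δ) →
        dist (dstat N t x u) (dstat N t x' u') < ε)
    (hd2 : Tendsto
        (fun N : ℕ => ⨆ (i : Fin N) (x : Fin N → X) (u : Fin N → U)
            (x' : Fin N → X) (u' : Fin N → U)
            (_ : ∀ j : Fin N, j ≠ i → x j = x' j ∧ u j = u' j),
          dist (dstat N t x u) (dstat N t x' u'))
        atTop (𝓝 0)) {ε : ℝ} (hε : 0 < ε) :
    ∃ δ > 0, ∀ᶠ N in atTop, ∀ (i : Fin N) (x u x' u'),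
      (∀ j : Fin N, j ≠ i → dist (x j) (x' j) < δ ∧ dist (u j) (u' j) < δ) →
      dist (dstat N t x u) (dstat N t x' u') < ε := by
  obtain ⟨δ, hδ, h1⟩ := hd1 (ε / 2) (half_pos hε)
  refine ⟨δ, hδ, ?_⟩
  filter_upwards [hd2.eventually (gt_mem_nhds (half_pos hε))] with N hN i x u x' u' hxu
  have hA : dist (dstat N t x u) (dstat N t (Function.update x' i (x i))
      (Function.update u' i (u i))) < ε / 2 := by
    refine h1 N _ _ _ _ fun j => ?_
    by_cases hj : j = i
    · subst hj; simpa using hδ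
    · simp only [Function.update_of_ne hj, Prod.dist_eq]
      exact max_lt (hxu j hj).1 (hxu j hj).2
  have hB := (dist_le_iSup_singlePlayerInfluence (dstat := dstat) N t i
    (Function.update x' i (x i)) x' (Function.update u' i (u i)) u'
    fun j hj => by simp [Function.update_of_ne hj]).trans_lt hN
  linarith [dist_triangle (dstat N t x u) (dstat N t (Function.update x' i (x i))
      (Function.update u' i (u i))) (dstat N t x' u')]

theorem dist_snoc_lt {A : Type*} [PseudoMetricSpace A] {n : ℕ} {p q : Fin n → A} {a b : A}
    {ε : ℝ} (hε : 0 < ε) (hpq : dist p q < ε) (hab : dist a b < ε) :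
    dist (Fin.snoc p a : Fin (n + 1) → A) (Fin.snoc q b : Fin (n + 1) → A) < ε := by
  rw [dist_pi_lt_iff hε] at hpq ⊢
  refine Fin.lastCases ?_ fun k => ?_
  · simpa using hab
  · simpa using hpq k

variable [CompactSpace X] [CompactSpace U] [CompactSpace Y] [CompactSpace X0] [CompactSpace W0]
  [CompactSpace Ξ]
  {f : ℕ → ℕ → X → U → Y → W → X}
  {dstat : (N : ℕ) → ℕ → (Fin N → X) → (Fin N → U) → D}
  {g : ℕ → X0 → D → Ξ → Y} {f0 : ℕ → X0 → D → W0 → X0}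
  {Sset : ∀ t : ℕ, Set C(Hist X U Y t, U)}

/-- In large games, the strategy and the local randomness of a single player have a uniformly
small effect on the histories of all other players and of the environment. -/
theorem eventually_sysHist_close
    (hg : ∀ t, Continuous fun p : X0 × D × Ξ => g t p.1 p.2.1 p.2.2)
    (hf0 : ∀ t, Continuous fun p : X0 × D × W0 => f0 t p.1 p.2.1 p.2.2)
    (hfEq : ∀ t, UniformEquicontinuous fun (i : ℕ) (p : X × U × Y × W) =>
      f i t p.1 p.2.1 p.2.2.1 p.2.2.2)
    (hScpt : ∀ t, IsCompact (Sset t))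
    (hd1 : ∀ (t : ℕ) (ε : ℝ), 0 < ε → ∃ δ : ℝ, 0 < δ ∧
      ∀ (N : ℕ) (x u x' u'),
        (∀ i : Fin N, dist ((x i, u i) : X × U) (x' i, u' i) < δ) →
        dist (dstat N t x u) (dstat N t x' u') < ε)
    (hd2 : ∀ t : ℕ, Tendsto
        (fun N : ℕ => ⨆ (i : Fin N) (x : Fin N → X) (u : Fin N → U)
            (x' : Fin N → X) (u' : Fin N → U)
            (_ : ∀ j : Fin N, j ≠ i → x j = x' j ∧ u j = u' j),
          dist (dstat N t x u) (dstat N t x' u'))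
        atTop (𝓝 0)) (t : ℕ) {ε : ℝ} (hε : 0 < ε) :
    ∀ᶠ N in atTop, ∀ (i : Fin N) (s s' : Fin N → Strat X U Y Sset)
      (ω ω' : Prim0 X0 W0 Ξ × (Fin N → PrimLoc X W)),
      (∀ j, j ≠ i → s j = s' j) → ω.1 = ω'.1 → (∀ j, j ≠ i → ω.2 j = ω'.2 j) →
      (∀ j, j ≠ i → dist ((sysHist f dstat g f0 s ω t).1 j)
        ((sysHist f dstat g f0 s' ω' t).1 j) < ε) ∧
      dist (sysHist f dstat g f0 s ω t).2 (sysHist f dstat g f0 s' ω' t).2 < ε := by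
  induction t generalizing ε with
  | zero =>
    refine Eventually.of_forall fun N i s s' ω ω' hs h0 hl => ⟨fun j hj => ?_, ?_⟩
    · simp only [sysHist, hl j hj, dist_self]
      exact hε
    · simp only [sysHist, h0, dist_self]
      exact hε
  | succ t ih =>
    have : CompactSpace (Sset t) := isCompact_iff_compactSpace.1 (hScpt t)
    obtain ⟨δf, hδf, Hf⟩ := Metric.uniformEquicontinuous_iff.1 (hfEq t) ε hε
    obtain ⟨δg, hδg, Hg⟩ := Metric.uniformContinuous_iff.1
      (CompactSpace.uniformContinuous_of_continuous (hg t)) (min ε δf) (lt_min hε hδf)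
    obtain ⟨δ0, hδ0, H0⟩ := Metric.uniformContinuous_iff.1
      (CompactSpace.uniformContinuous_of_continuous (hf0 t)) ε hε
    obtain ⟨δd, hδd, Hd⟩ := eventually_dist_aggregate_lt t (hd1 t) (hd2 t) (lt_min hδg hδ0)
    have hev : Continuous fun p : Sset t × Hist X U Y t => p.1.val p.2 :=
      (continuous_subtype_val.comp continuous_fst).eval continuous_snd
    obtain ⟨δs, hδs, Hs⟩ := Metric.uniformContinuous_iff.1
      (CompactSpace.uniformContinuous_of_continuous hev) (min δd (min ε δf))
        (lt_min hδd (lt_min hε hδf))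
    have hη : 0 < min (min ε δf) (min (min δg δ0) (min δd δs)) := by positivity
    filter_upwards [ih hη, Hd] with N hN hdN i s s' ω ω' hs h0 hl
    obtain ⟨hloc, henv⟩ := hN i s s' ω ω' hs h0 hl
    simp only [lt_min_iff] at hloc henv
    have hx : ∀ j, j ≠ i → ∀ r, dist ((sysHist f dstat g f0 s ω t).1 j)
        ((sysHist f dstat g f0 s' ω' t).1 j) < r →
        dist (((sysHist f dstat g f0 s ω t).1 j).1 (Fin.last t))
          (((sysHist f dstat g f0 s' ω' t).1 j).1 (Fin.last t)) < r := fun j hj r h =>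
      ((dist_le_pi_dist _ _ _).trans (le_max_left _ _)).trans_lt h
    have hu : ∀ j, j ≠ i → dist
        ((s j t).val ⟨((sysHist f dstat g f0 s ω t).1 j).1,
          ((sysHist f dstat g f0 s ω t).1 j).2, (sysHist f dstat g f0 s ω t).2.1⟩)
        ((s' j t).val ⟨((sysHist f dstat g f0 s' ω' t).1 j).1,
          ((sysHist f dstat g f0 s' ω' t).1 j).2, (sysHist f dstat g f0 s' ω' t).2.1⟩)
        < min δd (min ε δf) := fun j hj => by
      rw [← hs j hj]
      refine Hs (a := (s j t, _)) (b := (s j t, _)) ?_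
      have h1 := (hloc j hj).2.2.2
      have h2 := henv.2.2.2
      rw [Prod.dist_eq, max_lt_iff] at h1 h2
      simp only [Prod.dist_eq, dist_self, max_lt_iff]
      exact ⟨hδs, h1.1, h1.2, h2.1⟩
    have hdd := hdN i _ _ _ _ fun j hj =>
      ⟨hx j hj _ (hloc j hj).2.2.1, (hu j hj).trans_le (min_le_left _ _)⟩
    rw [lt_min_iff] at hdd
    have hx0 : ∀ r, dist (sysHist f dstat g f0 s ω t).2 (sysHist f dstat g f0 s' ω' t).2 < r →
        dist (sysHist f dstat g f0 s ω t).2.2 (sysHist f dstat g f0 s' ω' t).2.2 < r :=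
      fun r h => (le_max_right _ _).trans_lt h
    have hy := Hg (a := ((sysHist f dstat g f0 s ω t).2.2, _, ω.1.2.2 t))
      (b := ((sysHist f dstat g f0 s' ω' t).2.2, _, ω'.1.2.2 t)) (by
        simp only [Prod.dist_eq, max_lt_iff, h0, dist_self]
        exact ⟨hx0 _ henv.2.1.1, hdd.1, hδg⟩)
    have h0' := H0 (a := ((sysHist f dstat g f0 s ω t).2.2, _, ω.1.2.1 t))
      (b := ((sysHist f dstat g f0 s' ω' t).2.2, _, ω'.1.2.1 t)) (by
        simp only [Prod.dist_eq, max_lt_iff, h0, dist_self]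
        exact ⟨hx0 _ henv.2.1.2, hdd.2, hδ0⟩)
    rw [lt_min_iff] at hy
    refine ⟨fun j hj => ?_, ?_⟩
    · have huj := hu j hj
      simp only [lt_min_iff] at huj
      have hff := Hf (((sysHist f dstat g f0 s ω t).1 j).1 (Fin.last t), _, _, (ω.2 j).2 t)
        (((sysHist f dstat g f0 s' ω' t).1 j).1 (Fin.last t), _, _, (ω'.2 j).2 t) (by
          simp only [Prod.dist_eq, max_lt_iff, hl j hj, dist_self]
          exact ⟨hx j hj _ (hloc j hj).1.2, huj.2.2, hy.2, hδf⟩) j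
      have h1 := (hloc j hj).1.1
      rw [Prod.dist_eq, max_lt_iff] at h1
      simp only [sysHist]
      rw [Prod.dist_eq, max_lt_iff]
      exact ⟨dist_snoc_lt hε h1.1 hff, dist_snoc_lt hε h1.2 huj.2.1⟩
    · have h2 := henv.1.1
      rw [Prod.dist_eq, max_lt_iff] at h2
      simp only [sysHist]
      rw [Prod.dist_eq, max_lt_iff]
      exact ⟨dist_snoc_lt hε h2.1 hy.1, h0'⟩

theorem eventually_dist_yPath_lt
    (hg : ∀ t, Continuous fun p : X0 × D × Ξ => g t p.1 p.2.1 p.2.2)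
    (hf0 : ∀ t, Continuous fun p : X0 × D × W0 => f0 t p.1 p.2.1 p.2.2)
    (hfEq : ∀ t, UniformEquicontinuous fun (i : ℕ) (p : X × U × Y × W) =>
      f i t p.1 p.2.1 p.2.2.1 p.2.2.2)
    (hScpt : ∀ t, IsCompact (Sset t))
    (hd1 : ∀ (t : ℕ) (ε : ℝ), 0 < ε → ∃ δ : ℝ, 0 < δ ∧
      ∀ (N : ℕ) (x u x' u'),
        (∀ i : Fin N, dist ((x i, u i) : X × U) (x' i, u' i) < δ) →
        dist (dstat N t x u) (dstat N t x' u') < ε)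
    (hd2 : ∀ t : ℕ, Tendsto
        (fun N : ℕ => ⨆ (i : Fin N) (x : Fin N → X) (u : Fin N → U)
            (x' : Fin N → X) (u' : Fin N → U)
            (_ : ∀ j : Fin N, j ≠ i → x j = x' j ∧ u j = u' j),
          dist (dstat N t x u) (dstat N t x' u'))
        atTop (𝓝 0)) {ε : ℝ} (hε : 0 < ε) :
    ∀ᶠ N in atTop, ∀ (i : Fin N) (s s' : Fin N → Strat X U Y Sset)
      (ω ω' : Prim0 X0 W0 Ξ × (Fin N → PrimLoc X W)),
      (∀ j, j ≠ i → s j = s' j) → ω.1 = ω'.1 → (∀ j, j ≠ i → ω.2 j = ω'.2 j) →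
      dist (yPath f dstat g f0 s ω) (yPath f dstat g f0 s' ω') < ε := by
  let I := Σ N : ℕ, {q : (Fin N × (Fin N → Strat X U Y Sset) × (Fin N → Strat X U Y Sset)) ×
    (Prim0 X0 W0 Ξ × (Fin N → PrimLoc X W)) × (Prim0 X0 W0 Ξ × (Fin N → PrimLoc X W)) //
      (∀ j, j ≠ q.1.1 → q.1.2.1 j = q.1.2.2 j) ∧ q.2.1.1 = q.2.2.1 ∧
        (∀ j, j ≠ q.1.1 → q.2.1.2 j = q.2.2.2 j)}
  have key : Tendsto (fun a : I => (yPath f dstat g f0 a.2.1.1.2.1 a.2.1.2.1,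
      yPath f dstat g f0 a.2.1.1.2.2 a.2.1.2.2)) (comap Sigma.fst atTop) (uniformity (ℕ → Y)) := by
    have hpi : uniformity (ℕ → Y) = _ := Pi.uniformity (fun _ : ℕ => Y)
    rw [hpi, tendsto_iInf]
    intro t
    rw [tendsto_comap_iff, Metric.uniformity_basis_dist.tendsto_right_iff]
    intro δ hδ
    rw [eventually_comap]
    filter_upwards [eventually_sysHist_close (Sset := Sset) hg hf0 hfEq hScpt hd1 hd2 (t + 1) hδ]
    rintro N hN ⟨_, ⟨⟨⟨i, s, s'⟩, ω, ω'⟩, h1, h2, h3⟩⟩ rfl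
    exact ((dist_le_pi_dist _ _ (Fin.last t)).trans (le_max_left _ _)).trans_lt
      (hN i s s' ω ω' h1 h2 h3).2
  have h := Metric.uniformity_basis_dist.tendsto_right_iff.1 key ε hε
  rw [eventually_comap] at h
  filter_upwards [h] with N hN i s s' ω ω' h1 h2 h3
  exact hN ⟨N, ⟨⟨⟨i, s, s'⟩, ω, ω'⟩, h1, h2, h3⟩⟩ rfl

end Stability

end SEBEULarge
namespace SEBEULarge

section Laws

open Filter Topology

instance instBorelSpaceContinuousMap (A B : Type) [TopologicalSpace A] [TopologicalSpace B] :
    BorelSpace C(A, B) := ⟨rfl⟩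

variable {X U W X0 W0 Ξ Y D : Type}
  [MetricSpace X] [CompactSpace X] [MetricSpace U] [CompactSpace U]
  [MetricSpace W] [CompactSpace W] [MetricSpace X0] [CompactSpace X0]
  [MetricSpace W0] [CompactSpace W0] [MetricSpace Ξ] [CompactSpace Ξ]
  [MetricSpace Y] [CompactSpace Y] [MetricSpace D]
  [MeasurableSpace X] [BorelSpace X] [MeasurableSpace U] [BorelSpace U]
  [MeasurableSpace W] [BorelSpace W] [MeasurableSpace X0] [BorelSpace X0]
  [MeasurableSpace W0] [BorelSpace W0] [MeasurableSpace Ξ] [BorelSpace Ξ]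
  [MeasurableSpace Y] [BorelSpace Y]
  {f : ℕ → ℕ → X → U → Y → W → X}
  {dstat : (N : ℕ) → ℕ → (Fin N → X) → (Fin N → U) → D}
  {g : ℕ → X0 → D → Ξ → Y} {f0 : ℕ → X0 → D → W0 → X0}
  {c : ℕ → ℕ → X → U → Y → ℝ} {β : ℕ → ℝ}
  {Sset : ∀ t : ℕ, Set C(Hist X U Y t, U)} [∀ t, CompactSpace (Sset t)]
  (μ0 : Measure (Prim0 X0 W0 Ξ)) (μloc : ℕ → Measure (PrimLoc X W))
  [IsProbabilityMeasure μ0] [∀ i, IsProbabilityMeasure (μloc i)]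

instance : SecondCountableTopology (Strat X U Y Sset) := inferInstance
instance : BorelSpace (Strat X U Y Sset) := inferInstance
instance (N : ℕ) : SecondCountableTopology (Fin N → Strat X U Y Sset) := inferInstance
instance (N : ℕ) : BorelSpace (Fin N → Strat X U Y Sset) := inferInstance
instance (N : ℕ) : SecondCountableTopology (Fin N → PrimLoc X W) := inferInstance
instance (N : ℕ) : BorelSpace (Fin N → PrimLoc X W) := inferInstance
instance : BorelSpace (Prim0 X0 W0 Ξ) := inferInstance
instance : SecondCountableTopology (Prim0 X0 W0 Ξ) := inferInstance
instance (N : ℕ) : BorelSpace (Prim0 X0 W0 Ξ × (Fin N → PrimLoc X W)) := Prod.borelSpace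

instance (N : ℕ) : IsProbabilityMeasure (jointLaw μ0 μloc N) := by
  unfold jointLaw; infer_instance

theorem histLaw_eq_map {N : ℕ} (i : Fin N) (γ : Fin N → ProbabilityMeasure (Strat X U Y Sset))
    (h : Continuous fun p : (Fin N → Strat X U Y Sset) ×
      (Prim0 X0 W0 Ξ × (Fin N → PrimLoc X W)) => histPath f dstat g f0 i p.1 p.2) :
    histLaw μ0 μloc f dstat g f0 i γ =
      Measure.map (fun p => histPath f dstat g f0 i p.1 p.2)
        ((Measure.pi fun j => (γ j : Measure (Strat X U Y Sset))).prod (jointLaw μ0 μloc N)) :=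
  bind_map_eq_map_prod _ _ h.measurable

theorem isProbabilityMeasure_histLaw {N : ℕ} (i : Fin N)
    (γ : Fin N → ProbabilityMeasure (Strat X U Y Sset))
    (h : Continuous fun p : (Fin N → Strat X U Y Sset) ×
      (Prim0 X0 W0 Ξ × (Fin N → PrimLoc X W)) => histPath f dstat g f0 i p.1 p.2) :
    IsProbabilityMeasure (histLaw μ0 μloc f dstat g f0 i γ) := by
  rw [histLaw_eq_map μ0 μloc i γ h]
  exact Measure.isProbabilityMeasure_map h.measurable.aemeasurable

theorem envLawMixed_eq_map {N : ℕ} (γ : Fin N → ProbabilityMeasure (Strat X U Y Sset))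
    (h : Continuous fun p : (Fin N → Strat X U Y Sset) ×
      (Prim0 X0 W0 Ξ × (Fin N → PrimLoc X W)) => yPath f dstat g f0 p.1 p.2) :
    envLawMixed μ0 μloc f dstat g f0 N γ =
      Measure.map (fun p => yPath f dstat g f0 p.1 p.2)
        ((Measure.pi fun j => (γ j : Measure (Strat X U Y Sset))).prod (jointLaw μ0 μloc N)) :=
  bind_map_eq_map_prod _ _ h.measurable

/-- The environment law is the environment marginal of any DM's history law. -/
theorem envLawMixed_eq_map_histLaw {N : ℕ} (i : Fin N)
    (γ : Fin N → ProbabilityMeasure (Strat X U Y Sset))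
    (h : Continuous fun p : (Fin N → Strat X U Y Sset) ×
      (Prim0 X0 W0 Ξ × (Fin N → PrimLoc X W)) => histPath f dstat g f0 i p.1 p.2) :
    envLawMixed μ0 μloc f dstat g f0 N γ =
      Measure.map Prod.snd (histLaw μ0 μloc f dstat g f0 i γ) := by
  rw [histLaw_eq_map μ0 μloc i γ h, Measure.map_map measurable_snd h.measurable,
    envLawMixed_eq_map μ0 μloc γ (continuous_snd.comp h)]
  rfl

theorem expObjCost_eq_integral_histLaw {N : ℕ} (i : Fin N)
    (γ : Fin N → ProbabilityMeasure (Strat X U Y Sset))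
    (h : Continuous fun p : (Fin N → Strat X U Y Sset) ×
      (Prim0 X0 W0 Ξ × (Fin N → PrimLoc X W)) => histPath f dstat g f0 i p.1 p.2)
    (hC : Continuous (pathCost c β i)) :
    expObjCost μ0 μloc f dstat g f0 c β i γ =
      ∫ p, pathCost c β i p ∂(histLaw μ0 μloc f dstat g f0 i γ) := by
  rw [histLaw_eq_map μ0 μloc i γ h,
    integral_map h.measurable.aemeasurable hC.measurable.aestronglyMeasurable]
  exact (integral_prod _ (integrable_of_continuous_compact _ (hC.comp h))).symm

theorem continuous_subjCost
    (hf : ∀ i t, Continuous fun p : X × U × Y × W => f i t p.1 p.2.1 p.2.2.1 p.2.2.2)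
    (i : ℕ) (hC : Continuous (pathCost c β i)) :
    Continuous fun p : Strat X U Y Sset × (ℕ → Y) => subjCost μloc f c β i p.1 p.2 := by
  refine continuous_integral_of_compact (μloc i)
    (F := fun (p : Strat X U Y Sset × (ℕ → Y)) ωi => pathCost c β i (subjPath f i p.1 p.2 ωi)) ?_
  exact (hC.comp (continuous_subjPath hf i)).comp
    (g := fun q : Strat X U Y Sset × (ℕ → Y) × PrimLoc X W => _)
    (f := fun q : (Strat X U Y Sset × (ℕ → Y)) × PrimLoc X W => (q.1.1, q.1.2, q.2)) (by fun_prop)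

theorem expSubjCost_eq_integral_env
    (hf : ∀ i t, Continuous fun p : X × U × Y × W => f i t p.1 p.2.1 p.2.2.1 p.2.2.2)
    (i : ℕ) (hC : Continuous (pathCost c β i))
    (γi : ProbabilityMeasure (Strat X U Y Sset)) (ζ : Measure (ℕ → Y)) [IsProbabilityMeasure ζ] :
    expSubjCost μloc f c β i γi ζ =
      ∫ Z, ∫ si, subjCost μloc f c β i si Z ∂(γi : Measure (Strat X U Y Sset)) ∂ζ :=
  integral_integral_swap
    (integrable_of_continuous_compact _ (continuous_subjCost μloc hf i hC))

/-- The expected objective cost, written with the deviating DM's strategy and local randomness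
drawn separately from those of the reference profile. -/
theorem expObjCost_eq_integral_resampled {N : ℕ} (i : Fin N)
    (γ γ' : Fin N → ProbabilityMeasure (Strat X U Y Sset)) (hγ : ∀ j, j ≠ i → γ' j = γ j)
    (h : Continuous fun p : (Fin N → Strat X U Y Sset) ×
      (Prim0 X0 W0 Ξ × (Fin N → PrimLoc X W)) => histPath f dstat g f0 i p.1 p.2)
    (hC : Continuous (pathCost c β i)) :
    expObjCost μ0 μloc f dstat g f0 c β i γ' =
      ∫ q, pathCost c β i (histPath f dstat g f0 i (Function.update q.1.2 i q.1.1)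
          (q.2.1.1, Function.update q.2.1.2 i q.2.2))
        ∂((((γ' i : Measure (Strat X U Y Sset))).prod
            (Measure.pi fun j => (γ j : Measure (Strat X U Y Sset)))).prod
          ((jointLaw μ0 μloc N).prod (μloc i))) := by
  have hcont := hC.comp h
  have hs : Continuous fun p : Strat X U Y Sset × (Fin N → Strat X U Y Sset) =>
      Function.update p.2 i p.1 := continuous_snd.update i continuous_fst
  have hl : Continuous fun p : (Prim0 X0 W0 Ξ × (Fin N → PrimLoc X W)) × PrimLoc X W =>
      (p.1.1, Function.update p.1.2 i p.2) :=
    (continuous_fst.comp continuous_fst).prodMk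
      ((continuous_snd.comp continuous_fst).update i continuous_snd)
  have hmapS := map_update_prod_pi (fun j => (γ j : Measure (Strat X U Y Sset)))
    (fun j => (γ' j : Measure (Strat X U Y Sset))) i fun j hj => by rw [hγ j hj]
  have hmapL : Measure.map (fun p : (Prim0 X0 W0 Ξ × (Fin N → PrimLoc X W)) × PrimLoc X W =>
      (p.1.1, Function.update p.1.2 i p.2)) ((jointLaw μ0 μloc N).prod (μloc i)) =
      jointLaw μ0 μloc N := by
    have hL := map_update_prod_pi (fun j : Fin N => μloc j) (fun j : Fin N => μloc j) i
      fun _ _ => rfl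
    have hm : Measurable fun p : PrimLoc X W × (Fin N → PrimLoc X W) =>
        Function.update p.2 i p.1 := (continuous_snd.update i continuous_fst).measurable
    have hswap : MeasurePreserving
        (fun p : (Fin N → PrimLoc X W) × PrimLoc X W => Function.update p.1 i p.2)
        ((Measure.pi fun j : Fin N => μloc j).prod (μloc i))
        (Measure.pi fun j : Fin N => μloc j) :=
      (MeasurePreserving.mk hm hL).comp Measure.measurePreserving_swap
    exact (((MeasurePreserving.id μ0).prod hswap).comp
      (measurePreserving_prodAssoc μ0 (Measure.pi fun j : Fin N => μloc j) (μloc i))).map_eq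
  have hobj : Continuous fun s : Fin N → Strat X U Y Sset =>
      objCost μ0 μloc f dstat g f0 c β i s :=
    continuous_integral_of_compact (jointLaw μ0 μloc N) hcont
  have hres : Continuous fun q : (Strat X U Y Sset × (Fin N → Strat X U Y Sset)) ×
      ((Prim0 X0 W0 Ξ × (Fin N → PrimLoc X W)) × PrimLoc X W) =>
      pathCost c β i (histPath f dstat g f0 i (Function.update q.1.2 i q.1.1)
          (q.2.1.1, Function.update q.2.1.2 i q.2.2)) :=
    hcont.comp ((hs.comp continuous_fst).prodMk (hl.comp continuous_snd))
  rw [integral_prod _ (integrable_of_continuous_compact _ hres), expObjCost, ← hmapS,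
    integral_map hs.measurable.aemeasurable hobj.measurable.aestronglyMeasurable]
  refine integral_congr_ae (ae_of_all _ fun p => ?_)
  have hsec : Continuous fun ω : Prim0 X0 W0 Ξ × (Fin N → PrimLoc X W) =>
      pathCost c β i (histPath f dstat g f0 i (Function.update p.2 i p.1) ω) :=
    hcont.comp (Continuous.prodMk_right _)
  calc objCost μ0 μloc f dstat g f0 c β i (Function.update p.2 i p.1)
      = ∫ ω, pathCost c β i (histPath f dstat g f0 i (Function.update p.2 i p.1) ω)
          ∂(jointLaw μ0 μloc N) := rfl
    _ = _ := by
      conv_lhs => rw [← hmapL]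
      exact integral_map hl.measurable.aemeasurable hsec.measurable.aestronglyMeasurable

theorem expSubjCost_eq_integral_prod {N : ℕ} (i : ℕ)
    (γ : Fin N → ProbabilityMeasure (Strat X U Y Sset))
    (γi : ProbabilityMeasure (Strat X U Y Sset))
    (hf : ∀ i t, Continuous fun p : X × U × Y × W => f i t p.1 p.2.1 p.2.2.1 p.2.2.2)
    (hy : Continuous fun p : (Fin N → Strat X U Y Sset) ×
      (Prim0 X0 W0 Ξ × (Fin N → PrimLoc X W)) => yPath f dstat g f0 p.1 p.2)
    (hC : Continuous (pathCost c β i)) :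
    expSubjCost μloc f c β i γi (envLawMixed μ0 μloc f dstat g f0 N γ) =
      ∫ q, pathCost c β i (subjPath f i q.1.1 (yPath f dstat g f0 q.1.2 q.2.1) q.2.2)
        ∂(((γi : Measure (Strat X U Y Sset)).prod
            (Measure.pi fun j => (γ j : Measure (Strat X U Y Sset)))).prod
          ((jointLaw μ0 μloc N).prod (μloc i))) := by
  have hK := hC.comp (continuous_subjPath (Sset := Sset) hf i)
  have hS := continuous_subjCost (Sset := Sset) μloc hf i hC
  have hq : Continuous fun q : (Strat X U Y Sset × (Fin N → Strat X U Y Sset)) ×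
      ((Prim0 X0 W0 Ξ × (Fin N → PrimLoc X W)) × PrimLoc X W) =>
      pathCost c β i (subjPath f i q.1.1 (yPath f dstat g f0 q.1.2 q.2.1) q.2.2) :=
    hK.comp ((by fun_prop : Continuous fun q : (Strat X U Y Sset × (Fin N → Strat X U Y Sset)) ×
      ((Prim0 X0 W0 Ξ × (Fin N → PrimLoc X W)) × PrimLoc X W) => q.1.1).prodMk
        ((hy.comp (by fun_prop : Continuous fun q :
          (Strat X U Y Sset × (Fin N → Strat X U Y Sset)) ×
          ((Prim0 X0 W0 Ξ × (Fin N → PrimLoc X W)) × PrimLoc X W) => (q.1.2, q.2.1))).prodMk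
          (by fun_prop)))
  rw [integral_prod _ (integrable_of_continuous_compact _ hq),
    integral_prod _ (integrable_of_continuous_compact _ (continuous_integral_of_compact _ hq)),
    expSubjCost]
  refine integral_congr_ae (ae_of_all _ fun si => ?_)
  have hSi : Continuous fun Z => subjCost μloc f c β i si Z := hS.comp (Continuous.prodMk_right si)
  change ∫ Z, subjCost μloc f c β i si Z ∂(envLawMixed μ0 μloc f dstat g f0 N γ) = _
  rw [envLawMixed_eq_map μ0 μloc γ hy,
    integral_map hy.measurable.aemeasurable hSi.measurable.aestronglyMeasurable]
  refine (integral_prod _ (integrable_of_continuous_compact _ (hSi.comp hy))).trans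
    (integral_congr_ae (ae_of_all _ fun s => ?_))
  have hsec := hq.comp (Continuous.prodMk_right (si, s))
  exact (integral_prod _ (integrable_of_continuous_compact _ hsec)).symm

/-- Uniformly over all profiles, in large games a DM's objective cost is close to its subjective
cost against the environment law of a profile differing at most in that DM's own strategy. -/
theorem eventually_abs_expObjCost_sub_expSubjCost_le
    (hf : ∀ i t, Continuous fun p : X × U × Y × W => f i t p.1 p.2.1 p.2.2.1 p.2.2.2)
    (hy : ∀ ε : ℝ, 0 < ε → ∀ᶠ N in atTop, ∀ (i : Fin N) (s s' : Fin N → Strat X U Y Sset)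
      (ω ω' : Prim0 X0 W0 Ξ × (Fin N → PrimLoc X W)),
      (∀ j, j ≠ i → s j = s' j) → ω.1 = ω'.1 → (∀ j, j ≠ i → ω.2 j = ω'.2 j) →
      dist (yPath f dstat g f0 s ω) (yPath f dstat g f0 s' ω') < ε)
    (h : ∀ {N : ℕ} (i : Fin N), Continuous fun p : (Fin N → Strat X U Y Sset) ×
      (Prim0 X0 W0 Ξ × (Fin N → PrimLoc X W)) => histPath f dstat g f0 i p.1 p.2)
    (i : ℕ) (hC : Continuous (pathCost c β i)) {ε : ℝ} (hε : 0 < ε) :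
    ∀ᶠ N in atTop, ∀ (hi : i < N) (γ γ' : Fin N → ProbabilityMeasure (Strat X U Y Sset)),
      (∀ j, j ≠ ⟨i, hi⟩ → γ' j = γ j) →
      |expObjCost μ0 μloc f dstat g f0 c β (⟨i, hi⟩ : Fin N) γ' -
        expSubjCost μloc f c β i (γ' ⟨i, hi⟩) (envLawMixed μ0 μloc f dstat g f0 N γ)| ≤ ε := by
  have hK := hC.comp (continuous_subjPath (Sset := Sset) hf i)
  obtain ⟨δ, hδ, Hδ⟩ := Metric.uniformContinuous_iff.1
    (CompactSpace.uniformContinuous_of_continuous hK) ε hε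
  filter_upwards [hy δ hδ] with N hN hi γ γ' hγ
  have hyc : Continuous fun p : (Fin N → Strat X U Y Sset) ×
      (Prim0 X0 W0 Ξ × (Fin N → PrimLoc X W)) => yPath f dstat g f0 p.1 p.2 :=
    continuous_snd.comp (h ⟨i, hi⟩)
  rw [expObjCost_eq_integral_resampled μ0 μloc ⟨i, hi⟩ γ γ' hγ (h _) hC,
    expSubjCost_eq_integral_prod μ0 μloc i γ (γ' ⟨i, hi⟩) hf hyc hC, ← integral_sub]
  · rw [← Real.norm_eq_abs]
    refine (norm_integral_le_of_norm_le_const (C := ε) (ae_of_all _ fun q => ?_)).trans (by simp)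
    simp only [histPath_eq_subjPath, Function.update_self]
    rw [← dist_eq_norm]
    refine (Hδ (a := (q.1.1, _, q.2.2)) (b := (q.1.1, _, q.2.2)) ?_).le
    refine max_lt ((dist_self _).trans_lt hδ) (max_lt ?_ ((dist_self _).trans_lt hδ))
    exact hN ⟨i, hi⟩ _ _ _ _ (fun j hj => Function.update_of_ne hj _ _) rfl
      (fun j hj => Function.update_of_ne hj _ _)
  · refine integrable_of_continuous_compact _ ((hC.comp (h _)).comp
      (((continuous_snd.comp continuous_fst).update _ (continuous_fst.comp continuous_fst)).prodMk
        ((by fun_prop : Continuous fun q : (Strat X U Y Sset × (Fin N → Strat X U Y Sset)) ×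
      ((Prim0 X0 W0 Ξ × (Fin N → PrimLoc X W)) × PrimLoc X W) => q.2.1.1).prodMk
          (Continuous.update (by fun_prop) _ (by fun_prop)))))
  · exact integrable_of_continuous_compact _ (hK.comp
      ((by fun_prop : Continuous fun q : (Strat X U Y Sset × (Fin N → Strat X U Y Sset)) ×
      ((Prim0 X0 W0 Ξ × (Fin N → PrimLoc X W)) × PrimLoc X W) => q.1.1).prodMk
        ((hyc.comp (by fun_prop : Continuous fun q :
          (Strat X U Y Sset × (Fin N → Strat X U Y Sset)) ×
          ((Prim0 X0 W0 Ξ × (Fin N → PrimLoc X W)) × PrimLoc X W) => (q.1.2, q.2.1))).prodMk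
          (by fun_prop))))

/-- Closeness of integrals on the history space, whose metric is a product of the metrics on
countable products. -/
theorem exists_forall_abs_integral_sub_lt {F : ((ℕ → X) × (ℕ → U)) × (ℕ → Y) → ℝ}
    (hF : Continuous F) {ε : ℝ} (hε : 0 < ε) :
    ∃ δ > 0, ∀ (μ ν : Measure (((ℕ → X) × (ℕ → U)) × (ℕ → Y))) [IsProbabilityMeasure μ]
      [IsProbabilityMeasure ν], levyProkhorovDist μ ν < δ →
      |∫ a, F a ∂μ - ∫ a, F a ∂ν| < ε := by
  have hX : BorelSpace (ℕ → X) := Pi.borelSpace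
  have hU : BorelSpace (ℕ → U) := Pi.borelSpace
  have hY : BorelSpace (ℕ → Y) := Pi.borelSpace
  have hB : BorelSpace (((ℕ → X) × (ℕ → U)) × (ℕ → Y)) := Prod.borelSpace
  exact @exists_forall_levyProkhorovDist_lt _ _ _ _ hB F hF ε hε

/-- Expected objective costs of a given DM are bounded uniformly over all games and profiles. -/
theorem exists_forall_abs_expObjCost_le
    (h : ∀ {N : ℕ} (i : Fin N), Continuous fun p : (Fin N → Strat X U Y Sset) ×
      (Prim0 X0 W0 Ξ × (Fin N → PrimLoc X W)) => histPath f dstat g f0 i p.1 p.2)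
    (i : ℕ) (hC : Continuous (pathCost c β i)) :
    ∃ M : ℝ, 0 ≤ M ∧ ∀ (N : ℕ) (hi : i < N) (γ : Fin N → ProbabilityMeasure (Strat X U Y Sset)),
      |expObjCost μ0 μloc f dstat g f0 c β (⟨i, hi⟩ : Fin N) γ| ≤ M := by
  obtain ⟨M, hM⟩ := (isCompact_range hC).isBounded.exists_norm_le
  refine ⟨max M 0, le_max_right _ _, fun N hi γ => ?_⟩
  have := isProbabilityMeasure_histLaw μ0 μloc (⟨i, hi⟩ : Fin N) γ (h _)
  rw [expObjCost_eq_integral_histLaw μ0 μloc (⟨i, hi⟩ : Fin N) γ (h _) hC, ← Real.norm_eq_abs]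
  exact (norm_integral_le_of_norm_le_const (C := max M 0)
    (ae_of_all _ fun q => (hM _ ⟨q, rfl⟩).trans (le_max_left _ _))).trans (by simp)

/-- Profiles whose history laws are close in the Lévy–Prokhorov metric give a DM close expected
objective costs. -/
theorem exists_forall_abs_expObjCost_sub_lt
    (h : ∀ {N : ℕ} (i : Fin N), Continuous fun p : (Fin N → Strat X U Y Sset) ×
      (Prim0 X0 W0 Ξ × (Fin N → PrimLoc X W)) => histPath f dstat g f0 i p.1 p.2)
    (i : ℕ) (hC : Continuous (pathCost c β i)) {ε : ℝ} (hε : 0 < ε) :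
    ∃ δ > 0, ∀ (N : ℕ) (hi : i < N) (γ γ' : Fin N → ProbabilityMeasure (Strat X U Y Sset)),
      levyProkhorovDist (histLaw μ0 μloc f dstat g f0 (⟨i, hi⟩ : Fin N) γ)
        (histLaw μ0 μloc f dstat g f0 (⟨i, hi⟩ : Fin N) γ') < δ →
      |expObjCost μ0 μloc f dstat g f0 c β (⟨i, hi⟩ : Fin N) γ -
        expObjCost μ0 μloc f dstat g f0 c β (⟨i, hi⟩ : Fin N) γ'| < ε := by
  obtain ⟨δ, hδ, H⟩ := exists_forall_abs_integral_sub_lt hC hε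
  refine ⟨δ, hδ, fun N hi γ γ' hlt => ?_⟩
  have := isProbabilityMeasure_histLaw μ0 μloc (⟨i, hi⟩ : Fin N) γ (h _)
  have := isProbabilityMeasure_histLaw μ0 μloc (⟨i, hi⟩ : Fin N) γ' (h _)
  rw [expObjCost_eq_integral_histLaw μ0 μloc (⟨i, hi⟩ : Fin N) γ (h _) hC,
    expObjCost_eq_integral_histLaw μ0 μloc (⟨i, hi⟩ : Fin N) γ' (h _) hC]
  exact H _ _ hlt

/-- Profiles whose history laws are close in the Lévy–Prokhorov metric give a fixed mixed strategy
close expected subjective costs against the induced environment laws. -/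
theorem exists_forall_abs_expSubjCost_sub_lt
    (hf : ∀ i t, Continuous fun p : X × U × Y × W => f i t p.1 p.2.1 p.2.2.1 p.2.2.2)
    (h : ∀ {N : ℕ} (i : Fin N), Continuous fun p : (Fin N → Strat X U Y Sset) ×
      (Prim0 X0 W0 Ξ × (Fin N → PrimLoc X W)) => histPath f dstat g f0 i p.1 p.2)
    (i : ℕ) (hC : Continuous (pathCost c β i)) (γi : ProbabilityMeasure (Strat X U Y Sset))
    {ε : ℝ} (hε : 0 < ε) :
    ∃ δ > 0, ∀ (N : ℕ) (hi : i < N) (γ γ' : Fin N → ProbabilityMeasure (Strat X U Y Sset)),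
      levyProkhorovDist (histLaw μ0 μloc f dstat g f0 (⟨i, hi⟩ : Fin N) γ)
        (histLaw μ0 μloc f dstat g f0 (⟨i, hi⟩ : Fin N) γ') < δ →
      |expSubjCost μloc f c β i γi (envLawMixed μ0 μloc f dstat g f0 N γ) -
        expSubjCost μloc f c β i γi (envLawMixed μ0 μloc f dstat g f0 N γ')| < ε := by
  have hE : Continuous fun Z : ℕ → Y =>
      ∫ si, subjCost μloc f c β i si Z ∂(γi : Measure (Strat X U Y Sset)) :=
    continuous_integral_of_compact _ ((continuous_subjCost μloc hf i hC).comp continuous_swap)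
  have hE' := hE.comp (continuous_snd (X := (ℕ → X) × (ℕ → U)) (Y := ℕ → Y))
  have key : ∀ (N : ℕ) (hi : i < N) (γ : Fin N → ProbabilityMeasure (Strat X U Y Sset)),
      expSubjCost μloc f c β i γi (envLawMixed μ0 μloc f dstat g f0 N γ) =
        ∫ q, (∫ si, subjCost μloc f c β i si q.2 ∂(γi : Measure (Strat X U Y Sset)))
          ∂(histLaw μ0 μloc f dstat g f0 (⟨i, hi⟩ : Fin N) γ) := by
    intro N hi γ
    have := isProbabilityMeasure_histLaw μ0 μloc (⟨i, hi⟩ : Fin N) γ (h _)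
    rw [envLawMixed_eq_map_histLaw μ0 μloc (⟨i, hi⟩ : Fin N) γ (h _)]
    have := Measure.isProbabilityMeasure_map
      (μ := histLaw μ0 μloc f dstat g f0 (⟨i, hi⟩ : Fin N) γ) measurable_snd.aemeasurable
    rw [expSubjCost_eq_integral_env μloc hf i hC,
      integral_map measurable_snd.aemeasurable hE.measurable.aestronglyMeasurable]
  obtain ⟨δ, hδ, H⟩ := exists_forall_abs_integral_sub_lt hE' hε
  refine ⟨δ, hδ, fun N hi γ γ' hlt => ?_⟩
  have := isProbabilityMeasure_histLaw μ0 μloc (⟨i, hi⟩ : Fin N) γ (h _)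
  have := isProbabilityMeasure_histLaw μ0 μloc (⟨i, hi⟩ : Fin N) γ' (h _)
  rw [key N hi γ, key N hi γ']
  exact H _ _ hlt

end Laws

end SEBEULarge
open SEBEULarge in
theorem limit_of_SEBEU_is_nash_in_infinite_game
    (X U W X0 W0 Ξ Y D : Type)
    [MetricSpace X] [CompactSpace X] [Nonempty X]
    [MetricSpace U] [CompactSpace U] [Nonempty U]
    [MetricSpace W] [CompactSpace W] [Nonempty W]
    [MetricSpace X0] [CompactSpace X0] [Nonempty X0]
    [MetricSpace W0] [CompactSpace W0] [Nonempty W0]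
    [MetricSpace Ξ] [CompactSpace Ξ] [Nonempty Ξ]
    [MetricSpace Y] [CompactSpace Y] [Nonempty Y]
    [MetricSpace D] [CompactSpace D] [Nonempty D]
    [MeasurableSpace X] [BorelSpace X] [MeasurableSpace U] [BorelSpace U]
    [MeasurableSpace W] [BorelSpace W] [MeasurableSpace X0] [BorelSpace X0]
    [MeasurableSpace W0] [BorelSpace W0] [MeasurableSpace Ξ] [BorelSpace Ξ]
    [MeasurableSpace Y] [BorelSpace Y]
    (f : ℕ → ℕ → X → U → Y → W → X)
    (dstat : (N : ℕ) → ℕ → (Fin N → X) → (Fin N → U) → D)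
    (g : ℕ → X0 → D → Ξ → Y) (f0 : ℕ → X0 → D → W0 → X0)
    (c : ℕ → ℕ → X → U → Y → ℝ) (β : ℕ → ℝ)
    -- Assumption 4.1, Condition 1: Assumption 3.1 in all games, strengthened
    (hf : ∀ i t, Continuous fun p : X × U × Y × W => f i t p.1 p.2.1 p.2.2.1 p.2.2.2)
    (hg : ∀ t, Continuous fun p : X0 × D × Ξ => g t p.1 p.2.1 p.2.2)
    (hf0 : ∀ t, Continuous fun p : X0 × D × W0 => f0 t p.1 p.2.1 p.2.2)
    (hc : ∀ i t, Continuous fun p : X × U × Y => c i t p.1 p.2.1 p.2.2)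
    (hcEq : ∀ t, UniformEquicontinuous fun (i : ℕ) (p : X × U × Y) => c i t p.1 p.2.1 p.2.2)
    (hfEq : ∀ t, UniformEquicontinuous fun (i : ℕ) (p : X × U × Y × W) =>
      f i t p.1 p.2.1 p.2.2.1 p.2.2.2)
    (Sset : ∀ t : ℕ, Set C(Hist X U Y t, U))
    (hScpt : ∀ t, IsCompact (Sset t)) (hSne : ∀ t, (Sset t).Nonempty)
    (cbar βbar : ℝ) (hcb : ∀ i t x u y, |c i t x u y| ≤ cbar)
    (hβ0 : ∀ i, 0 ≤ β i) (hβb : ∀ i, β i ≤ βbar) (hβbar : βbar < 1)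
    -- Assumption 4.1, Condition 2: negligible-impact conditions on the aggregates
    (hd1 : ∀ (t : ℕ) (ε : ℝ), 0 < ε → ∃ δ : ℝ, 0 < δ ∧
      ∀ (N : ℕ) (x u x' u'),
        (∀ i : Fin N, dist ((x i, u i) : X × U) (x' i, u' i) < δ) →
        dist (dstat N t x u) (dstat N t x' u') < ε)
    (hd2 : ∀ (t : ℕ) (ε : ℝ), 0 < ε →
      Filter.Tendsto
        (fun N : ℕ => ⨆ (i : Fin N) (x : Fin N → X) (u : Fin N → U)
            (x' : Fin N → X) (u' : Fin N → U)
            (_ : ∀ j : Fin N, j ≠ i → x j = x' j ∧ u j = u' j),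
          dist (dstat N t x u) (dstat N t x' u'))
        Filter.atTop (nhds 0))
    -- Assumption 4.1, Condition 3: the primitive random variables are mutually
    -- independent (built into `jointLaw`, the product of `μ0` and the `μloc i`)
    (μ0 : Measure (Prim0 X0 W0 Ξ)) (μloc : ℕ → Measure (PrimLoc X W))
    [IsProbabilityMeasure μ0] [∀ i, IsProbabilityMeasure (μloc i)] :
    -- `γstar N` is an SEBEU in mixed strategies in `G^N`, for each `N`
    ∀ γstar : (N : ℕ) → (Fin N → ProbabilityMeasure (Strat X U Y Sset)),
    (∀ (N : ℕ) (i : Fin N) (γ' : ProbabilityMeasure (Strat X U Y Sset)),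
      expSubjCost μloc f c β i.val (γstar N i)
          (envLawMixed μ0 μloc f dstat g f0 N (γstar N)) ≤
        expSubjCost μloc f c β i.val γ'
          (envLawMixed μ0 μloc f dstat g f0 N (γstar N))) →
    -- `γinf` is a joint mixed strategy of `G^∞` whose induced history measures are
    -- asymptotically close, in the Lévy–Prokhorov (Prokhorov) metric, to those of
    -- the SEBEU `γstar N`, for every DM `i`
    ∀ γinf : ℕ → ProbabilityMeasure (Strat X U Y Sset),
    (∀ i : ℕ,
      Filter.Tendsto
        (fun N : ℕ =>
          if h : i < N then
            levyProkhorovDist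
              (histLaw μ0 μloc f dstat g f0 (⟨i, h⟩ : Fin N) (γstar N))
              (histLaw μ0 μloc f dstat g f0 (⟨i, h⟩ : Fin N) (fun j => γinf j.val))
          else 0)
        Filter.atTop (nhds 0)) →
    -- conclusion: `γinf` is a Nash equilibrium in `G^∞`
    ∀ (i : ℕ) (γ' : ProbabilityMeasure (Strat X U Y Sset)),
      objCostInf μ0 μloc f dstat g f0 c β i γinf ≤
        objCostInf μ0 μloc f dstat g f0 c β i (Function.update γinf i γ') := by
  intro γstar hSE γinf hLP i γ'
  have : ∀ t, CompactSpace (Sset t) := fun t => isCompact_iff_compactSpace.1 (hScpt t)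
  have hd : ∀ N t, Continuous fun p : (Fin N → X) × (Fin N → U) => dstat N t p.1 p.2 := by
    intro N t
    refine Metric.continuous_iff.2 fun q ε hε => ?_
    obtain ⟨δ, hδ, H⟩ := hd1 t ε hε
    refine ⟨δ, hδ, fun p hp => H N _ _ _ _ fun j => ?_⟩
    exact max_lt (((dist_le_pi_dist _ _ j).trans (le_max_left _ _)).trans_lt hp)
      (((dist_le_pi_dist _ _ j).trans (le_max_right _ _)).trans_lt hp)
  have hC : Continuous (pathCost c β i) := continuous_pathCost hc hcb hβ0 hβb hβbar i
  have hH : ∀ {N : ℕ} (j : Fin N), Continuous fun p : (Fin N → Strat X U Y Sset) ×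
      (Prim0 X0 W0 Ξ × (Fin N → PrimLoc X W)) => histPath f dstat g f0 j p.1 p.2 :=
    fun j => continuous_histPath hf hg hf0 hd j
  have hy := fun (ε : ℝ) (hε : 0 < ε) => eventually_dist_yPath_lt (W := W) (Sset := Sset)
    hg hf0 hfEq hScpt hd1 (fun t => hd2 t 1 one_pos) hε
  obtain ⟨M, hM0, hM⟩ := exists_forall_abs_expObjCost_le (Sset := Sset) μ0 μloc hH i hC
  refine le_of_forall_pos_le_add fun ε hε => ?_
  have hε4 : 0 < ε / 4 := by positivity
  obtain ⟨δ₁, hδ₁, H₁⟩ := exists_forall_abs_expObjCost_sub_lt (Sset := Sset) μ0 μloc hH i hC hε4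
  obtain ⟨δ₂, hδ₂, H₂⟩ := exists_forall_abs_expSubjCost_sub_lt μ0 μloc hf hH i hC γ' hε4
  have happrox := eventually_abs_expObjCost_sub_expSubjCost_le μ0 μloc hf hy hH i hC hε4
  have hbdd : ∀ γ : ℕ → ProbabilityMeasure (Strat X U Y Sset), ∀ N : ℕ,
      |if h : i < N then expObjCost μ0 μloc f dstat g f0 c β (⟨i, h⟩ : Fin N) (fun j => γ j.val)
        else 0| ≤ M := by
    intro γ N
    split_ifs with h
    · exact hM N h _
    · simpa using hM0
  unfold objCostInf
  rw [← limsup_add_const]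
  · refine Filter.limsup_le_limsup ?_ ?_ ?_
    · filter_upwards [happrox, Filter.eventually_gt_atTop i,
        (hLP i).eventually_lt_const (lt_min hδ₁ hδ₂)] with N hN hi hlt
      simp only [hi, dif_pos] at hlt ⊢
      have e₁ := abs_lt.1 (H₁ N hi _ _ (hlt.trans_le (min_le_left _ _)))
      have e₂ := abs_lt.1 (H₂ N hi _ _ (hlt.trans_le (min_le_right _ _)))
      have e₃ := abs_le.1 (hN hi (γstar N) (γstar N) fun _ _ => rfl)
      have e₄ := abs_le.1 (hN hi (fun j => γinf j.val)
        (fun j => Function.update γinf i γ' j.val) fun j hj =>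
          Function.update_of_ne (fun hji => hj (Fin.ext hji)) _ _)
      rw [Function.update_self] at e₄
      have e₅ := hSE N ⟨i, hi⟩ γ'
      linarith [e₁.1, e₂.2, e₃.2, e₄.1]
    · exact Filter.isCoboundedUnder_le_of_le Filter.atTop fun N => (abs_le.1 (hbdd γinf N)).1
    · exact Filter.isBoundedUnder_of ⟨M + ε, fun N => by
        gcongr; exact (abs_le.1 (hbdd (Function.update γinf i γ') N)).2⟩
  · exact Filter.isBoundedUnder_of ⟨M, fun N => (abs_le.1 (hbdd _ N)).2⟩
  · exact Filter.isCoboundedUnder_le_of_le Filter.atTop fun N => (abs_le.1 (hbdd _ N)).1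
end

section
/- Consider a sequence (G^N)_{N∈ℕ} of games under Assumptions 4.1 and 4.2. For every ε > 0 there exists N̂_ε ∈ ℕ such that for all N ≥ N̂_ε, the game G^N possesses an ε-SEBEU in pure strategies: there exists a joint pure strategy s = (s^1,…,s^N) ∈ S such that for every i ∈ [1,N] and every mixed strategy γ̃^i ∈ Γ^1, E^{ζ_s}[J^i(s^i,·)] ≤ E^{(γ̃^i, ζ_s)}[J^i] + ε, where ζ_s is the distribution of the environment process induced by s, treated as an independent exogenous process. -/
/-
STATEMENT 5.  Existence of `ε`-SEBEU in pure strategies in large games, under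
Assumptions 4.1 and 4.2.

Assumption 4.2: all DMs are identical (common dynamics `f`, stage costs `c`, discount
factor `β`, and law `μloc` of the local primitive random variables `ωᶦ = (x₀ᶦ, (w_tᶦ))`),
with common state space `X = ↥Xset ⊂ ℝⁿ` and control space `U = ↥Uset ⊂ ℝᵐ`; the
aggregate statistic is the simple average `d_t^N = (1/N) ∑ᵢ (x_tᶦ, u_tᶦ)`; and the
environment variables are generated by deterministic dynamics `y_t = g_t(x_t⁰, d_t^N)`,
`x_{t+1}⁰ = f_t⁰(x_t⁰, d_t^N)` driven by the inputs `d_t^N` (no environment noise, `Ω⁰` a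
singleton with deterministic initial environment state `x0init`).

Assumption 4.1: Assumption 3.1 (compact metric spaces, continuity, common compact strategy
constraint sets of continuous maps, uniformly bounded stage costs, discount factor below
one) holds in all games `G^N`; the aggregate statistics satisfy the negligible-impact
conditions (`hd1`, `hd2`); the local primitive random variables are mutually independent
and identically distributed (built into `jointLaw`, an i.i.d. product of `μloc`).
Time runs over `ℕ`, subsuming every horizon `T ∈ ℕ ∪ {∞}` of the paper.

Conclusion: for every `ε > 0` there is `N̂_ε` such that every `G^N` with `N ≥ N̂_ε`
possesses an `ε`-SEBEU in pure strategies: a joint pure strategy `s` with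
`E^{ζ_s}[Jᶦ(sᶦ, ·)] ≤ E^{(γ̃ᶦ, ζ_s)}[Jᶦ] + ε` for every DM `i` and every mixed strategy
`γ̃ᶦ`, where `ζ_s` is the environment distribution induced by `s`, treated as an
independent exogenous process.
-/

open MeasureTheory

namespace SEBEU5

/-- Borel σ-algebra on a space of continuous maps. -/
noncomputable instance instMeasurableSpaceContinuousMap (A B : Type)
    [TopologicalSpace A] [TopologicalSpace B] : MeasurableSpace C(A, B) := borel _

/-- Information of a DM at time `t`. -/
abbrev Hist (X U Y : Type) (t : ℕ) : Type :=
  (Fin (t + 1) → X) × (Fin t → U) × (Fin t → Y)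

variable {n m : ℕ} (Xset : Set (Fin n → ℝ)) (Uset : Set (Fin m → ℝ)) (X0 Y : Type)
variable [TopologicalSpace Y]

/-- Common pure strategy space of the identical DMs. -/
abbrev Strat (Sset : ∀ t : ℕ, Set C(Hist (↥Xset) (↥Uset) Y t, ↥Uset)) : Type :=
  ∀ t : ℕ, ↥(Sset t)

/-- DM-local primitive random variables `ωᶦ = (x₀ᶦ, (w_tᶦ))`. -/
abbrev PrimLoc (W : Type) : Type := ↥Xset × (ℕ → W)

/-- Joint history in the game `G^N` at time `t`. -/
abbrev SysHist (N t : ℕ) : Type :=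
  (Fin N → (Fin (t + 1) → ↥Xset) × (Fin t → ↥Uset)) × (Fin t → Y) × X0

variable {Xset Uset X0 Y}
variable {W : Type}
variable {Sset : ∀ t : ℕ, Set C(Hist (↥Xset) (↥Uset) Y t, ↥Uset)}

/-- The simple-average aggregate statistic
`d_t^N = (1/N) ∑_{i∈[1,N]} (x_tᶦ, u_tᶦ) ∈ ℝⁿ × ℝᵐ` (Assumption 4.2). -/
noncomputable def davg {N : ℕ} (x : Fin N → ↥Xset) (u : Fin N → ↥Uset) :
    (Fin n → ℝ) × (Fin m → ℝ) :=
  ((N : ℝ)⁻¹ • ∑ i, (x i : Fin n → ℝ), (N : ℝ)⁻¹ • ∑ i, (u i : Fin m → ℝ))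

/-- Closed-loop joint history in `G^N` under the pure strategy profile `s`, with the
deterministic environment dynamics `y_t = g_t(x_t⁰, d_t^N)`, `x_{t+1}⁰ = f_t⁰(x_t⁰, d_t^N)`
driven by the simple averages (Assumption 4.2). -/
noncomputable def sysHist
    (f : ℕ → ↥Xset → ↥Uset → Y → W → ↥Xset)
    (g : ℕ → X0 → (Fin n → ℝ) × (Fin m → ℝ) → Y)
    (f0 : ℕ → X0 → (Fin n → ℝ) × (Fin m → ℝ) → X0) (x0init : X0)
    {N : ℕ} (s : Fin N → Strat Xset Uset Y Sset) (ω : Fin N → PrimLoc Xset W) :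
    (t : ℕ) → SysHist Xset Uset X0 Y N t
  | 0 => (fun i => (fun _ => (ω i).1, Fin.elim0), Fin.elim0, x0init)
  | t + 1 =>
      let h := sysHist f g f0 x0init s ω t
      let xcur : Fin N → ↥Xset := fun i => (h.1 i).1 (Fin.last t)
      let u : Fin N → ↥Uset := fun i => (s i t).val ⟨(h.1 i).1, (h.1 i).2, h.2.1⟩
      let d := davg xcur u
      let y : Y := g t h.2.2 d
      (fun i => (Fin.snoc (h.1 i).1 (f t (xcur i) (u i) y ((ω i).2 t)),
                 Fin.snoc (h.1 i).2 (u i)),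
       Fin.snoc h.2.1 y,
       f0 t h.2.2 d)

/-- Realized environment path in `G^N` under the profile `s`. -/
noncomputable def yPath
    (f : ℕ → ↥Xset → ↥Uset → Y → W → ↥Xset)
    (g : ℕ → X0 → (Fin n → ℝ) × (Fin m → ℝ) → Y)
    (f0 : ℕ → X0 → (Fin n → ℝ) × (Fin m → ℝ) → X0) (x0init : X0)
    {N : ℕ} (s : Fin N → Strat Xset Uset Y Sset) (ω : Fin N → PrimLoc Xset W) : ℕ → Y :=
  fun t => (sysHist f g f0 x0init s ω (t + 1)).2.1 (Fin.last t)

/-- A DM's state–control history under strategy `si` against a fixed deterministic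
environment sequence `Z`. -/
noncomputable def subjHist (f : ℕ → ↥Xset → ↥Uset → Y → W → ↥Xset)
    (si : Strat Xset Uset Y Sset) (Z : ℕ → Y) (ωi : PrimLoc Xset W) :
    (t : ℕ) → (Fin (t + 1) → ↥Xset) × (Fin t → ↥Uset)
  | 0 => (fun _ => ωi.1, Fin.elim0)
  | t + 1 =>
      let h := subjHist f si Z ωi t
      let u : ↥Uset := (si t).val ⟨h.1, h.2, fun k : Fin t => Z k⟩
      (Fin.snoc h.1 (f t (h.1 (Fin.last t)) u (Z t) (ωi.2 t)), Fin.snoc h.2 u)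

section Meas

variable [MeasurableSpace W] [MeasurableSpace Y]
variable (μloc : Measure (PrimLoc Xset W)) [IsProbabilityMeasure μloc]

/-- Joint law of the local primitive random variables in `G^N`: mutually independent and
identically distributed across the (identical) DMs. -/
noncomputable def jointLaw (N : ℕ) : Measure (Fin N → PrimLoc Xset W) :=
  Measure.pi fun _ : Fin N => μloc

/-- Subjective cost `J(sᶦ, Z)` of a DM (the same function for all the identical DMs and in
all games). -/
noncomputable def subjCost
    (f : ℕ → ↥Xset → ↥Uset → Y → W → ↥Xset)
    (c : ℕ → ↥Xset → ↥Uset → Y → ℝ) (β : ℝ)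
    (si : Strat Xset Uset Y Sset) (Z : ℕ → Y) : ℝ :=
  ∫ ωi, (∑' t : ℕ, β ^ t *
      c t ((subjHist f si Z ωi t).1 (Fin.last t))
          ((subjHist f si Z ωi (t + 1)).2 (Fin.last t)) (Z t)) ∂μloc

end Meas

end SEBEU5

section Scarf

open Finset

variable {T I : Type*}

/-- `σ` is dominant with respect to the orders ranked by `r i`, `i ∈ C`: no point lies strictly
above all the minima of `σ`. -/
def ScarfDominant (r : I → T → ℕ) (σ : Finset T) (C : Finset I) : Prop :=
  ∀ y, ∃ i ∈ C, ∀ x ∈ σ, r i y ≤ r i x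

/-- `P` arises from `Q` by adding one point or deleting one index. -/
def ScarfAbove [DecidableEq T] [DecidableEq I] (Q P : Finset T × Finset I) : Prop :=
  (∃ x, x ∉ Q.1 ∧ P = (insert x Q.1, Q.2)) ∨ ∃ k ∈ Q.2, P = (Q.1, Q.2.erase k)

variable {r : I → T → ℕ}

theorem ScarfDominant.mono {σ σ' : Finset T} {C C' : Finset I} (h : ScarfDominant r σ C)
    (hσ : σ' ⊆ σ) (hC : C ⊆ C') : ScarfDominant r σ' C' := fun y => by
  obtain ⟨i, hi, hy⟩ := h y
  exact ⟨i, hC hi, fun x hx => hy x (hσ hx)⟩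

theorem exists_scarf_argmin (r : I → T → ℕ) {σ : Finset T} (hσ : σ.Nonempty) :
    ∃ mn : I → T, ∀ i, mn i ∈ σ ∧ ∀ x ∈ σ, r i (mn i) ≤ r i x := by
  have h : ∀ i, ∃ a ∈ σ, ∀ x ∈ σ, r i a ≤ r i x := fun i => exists_min_image σ (r i) hσ
  choose mn h1 h2 using h
  exact ⟨mn, fun i => ⟨h1 i, h2 i⟩⟩

theorem ScarfDominant.exists_argmin_eq (hr : ∀ i, Function.Injective (r i)) {σ : Finset T}
    {C : Finset I} (h : ScarfDominant r σ C) {mn : I → T}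
    (hmn : ∀ i, mn i ∈ σ ∧ ∀ x ∈ σ, r i (mn i) ≤ r i x) {x : T} (hx : x ∈ σ) :
    ∃ i ∈ C, mn i = x := by
  obtain ⟨i, hi, hy⟩ := h x
  exact ⟨i, hi, hr i (le_antisymm ((hmn i).2 x hx) (hy _ (hmn i).1))⟩

/-- A map onto a set with one element less than its domain identifies exactly one pair. -/
theorem exists_unique_collision [DecidableEq T] [DecidableEq I] {σ : Finset T} {C : Finset I}
    (hcard : C.card = σ.card + 1) {φ : I → T} (hφ : ∀ i, φ i ∈ σ)
    (hsurj : ∀ x ∈ σ, ∃ i ∈ C, φ i = x) :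
    ∃ i ∈ C, ∃ j ∈ C, i ≠ j ∧ φ i = φ j ∧
      ∀ k ∈ C, (∃ l ∈ C, l ≠ k ∧ φ l = φ k) → k = i ∨ k = j := by
  obtain ⟨i, hi, j, hj, hij, he⟩ :=
    exists_ne_map_eq_of_card_lt_of_maps_to (s := C) (t := σ) (by omega) (fun i _ => hφ i)
  refine ⟨i, hi, j, hj, hij, he, ?_⟩
  have himg : (C.erase i).image φ = σ := by
    ext x
    simp only [mem_image, mem_erase]
    constructor
    · rintro ⟨k, _, rfl⟩
      exact hφ k
    · intro hx
      obtain ⟨k, hk, rfl⟩ := hsurj x hx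
      by_cases hki : k = i
      · exact ⟨j, ⟨hij.symm, hj⟩, by rw [hki, he]⟩
      · exact ⟨k, ⟨hki, hk⟩, rfl⟩
  have hinj : Set.InjOn φ (C.erase i : Finset I) := by
    rw [← card_image_iff, himg, card_erase_of_mem hi]
    omega
  rintro k hk ⟨l, hl, hlk, hφlk⟩
  by_contra! hcon
  have hk' : k ∈ C.erase i := mem_erase.2 ⟨hcon.1, hk⟩
  by_cases hli : l = i
  · refine hcon.2 (hinj (by exact_mod_cast hk') (by exact_mod_cast mem_erase.2 ⟨hij.symm, hj⟩) ?_)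
    rw [← hφlk, hli, he]
  · exact hlk (hinj (by exact_mod_cast mem_erase.2 ⟨hli, hl⟩) (by exact_mod_cast hk') hφlk)

/-- `P` is obtained from `(σ, C)` by releasing the index `k`. -/
def ScarfPivot [DecidableEq T] [DecidableEq I] (r : I → T → ℕ) (σ : Finset T) (C : Finset I)
    (mn : I → T) (k : I) (P : Finset T × Finset I) : Prop :=
  P = (σ, C.erase k) ∨
    ∃ x, P = (insert x σ, C) ∧ x ∉ σ ∧ ∀ l ∈ C, l ≠ k → r l (mn l) < r l x

section Pivot

variable [DecidableEq T] [DecidableEq I] {σ : Finset T} {C : Finset I} {mn : I → T}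

theorem scarfPivot_unique (hr : ∀ i, Function.Injective (r i))
    (hmn : ∀ i, mn i ∈ σ ∧ ∀ x ∈ σ, r i (mn i) ≤ r i x) {k : I}
    {P P' : Finset T × Finset I} (hP : ScarfDominant r P.1 P.2) (hP' : ScarfDominant r P'.1 P'.2)
    (h : ScarfPivot r σ C mn k P) (h' : ScarfPivot r σ C mn k P') : P = P' := by
  have mixed : ∀ x, ScarfDominant r σ (C.erase k) →
      (∀ l ∈ C, l ≠ k → r l (mn l) < r l x) → False := by
    intro x hd hx
    obtain ⟨l, hl, hy⟩ := hd x
    rw [mem_erase] at hl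
    exact absurd (hy _ (hmn l).1) (not_le.2 (hx l hl.2 hl.1))
  have cmp : ∀ x x', ScarfDominant r (insert x σ) C →
      (∀ l ∈ C, l ≠ k → r l (mn l) < r l x') → r k x' ≤ r k x := by
    intro x x' hd hx'
    obtain ⟨l, hl, hy⟩ := hd x'
    by_cases hlk : l = k
    · subst hlk
      exact hy x (mem_insert_self _ _)
    · exact absurd (hy _ (mem_insert_of_mem (hmn l).1)) (not_le.2 (hx' l hl hlk))
  rcases h with rfl | ⟨x, rfl, hxσ, hx⟩ <;> rcases h' with rfl | ⟨x', rfl, hxσ', hx'⟩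
  · rfl
  · exact (mixed x' hP hx').elim
  · exact (mixed x hP' hx).elim
  · rw [hr k (le_antisymm (cmp _ _ hP' hx) (cmp _ _ hP hx'))]

theorem exists_scarfPivot [Finite T] (hr : ∀ i, Function.Injective (r i))
    (hmn : ∀ i, mn i ∈ σ ∧ ∀ x ∈ σ, r i (mn i) ≤ r i x) {k k' : I} (hk : k ∈ C) (hk' : k' ∈ C)
    (hne : k' ≠ k) (he : mn k' = mn k) (hd : ScarfDominant r σ C) :
    ∃ P, ScarfDominant r P.1 P.2 ∧ ScarfPivot r σ C mn k P := by
  by_cases hM : ∃ x, ∀ l ∈ C, l ≠ k → r l (mn l) < r l x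
  · obtain ⟨x, hx, hmax⟩ := Set.exists_max_image
      {x | ∀ l ∈ C, l ≠ k → r l (mn l) < r l x} (r k) (Set.toFinite _) hM
    simp only [Set.mem_ofPred_eq] at hx hmax
    have hxk : ∀ y, y ∈ σ → r k x ≤ r k y := by
      intro y hy
      obtain ⟨l, hl, hlx⟩ := hd x
      by_cases hlk : l = k
      · exact hlk ▸ hlx y hy
      · exact absurd (hlx _ (hmn l).1) (not_le.2 (hx l hl hlk))
    have hxσ : x ∉ σ := by
      intro hxσ
      have hxm : x = mn k := hr k (le_antisymm (hxk _ (hmn k).1) ((hmn k).2 x hxσ))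
      have := hx k' hk' hne
      rw [hxm, he] at this
      exact lt_irrefl _ this
    refine ⟨(insert x σ, C), ?_, Or.inr ⟨x, rfl, hxσ, hx⟩⟩
    intro y
    by_cases hy : ∀ l ∈ C, l ≠ k → r l (mn l) < r l y
    · refine ⟨k, hk, fun z hz => ?_⟩
      rcases mem_insert.1 hz with rfl | hz
      · exact hmax y hy
      · exact (hmax y hy).trans (hxk z hz)
    · push Not at hy
      obtain ⟨l, hl, hlk, hly⟩ := hy
      refine ⟨l, hl, fun z hz => ?_⟩
      rcases mem_insert.1 hz with rfl | hz
      · exact hly.trans (hx l hl hlk).le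
      · exact hly.trans ((hmn l).2 z hz)
  · push Not at hM
    refine ⟨(σ, C.erase k), ?_, Or.inl rfl⟩
    intro y
    obtain ⟨l, hl, hlk, hy⟩ := hM y
    exact ⟨l, mem_erase.2 ⟨hlk, hl⟩, fun x hx => hy.trans ((hmn l).2 x hx)⟩

theorem scarfPivot_ne (hmn : ∀ i, mn i ∈ σ ∧ ∀ x ∈ σ, r i (mn i) ≤ r i x) {i j : I}
    (hi : i ∈ C) (hij : i ≠ j) (hd : ScarfDominant r σ C) {P P' : Finset T × Finset I}
    (h : ScarfPivot r σ C mn i P) (h' : ScarfPivot r σ C mn j P') : P ≠ P' := by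
  rintro rfl
  rcases h with rfl | ⟨x, rfl, hxσ, hx⟩ <;> rcases h' with h' | ⟨x', h', hxσ', hx'⟩ <;>
    rw [Prod.mk.injEq] at h'
  · have : i ∈ C.erase j := mem_erase.2 ⟨hij, hi⟩
    rw [← h'.2] at this
    simp at this
  · exact hxσ' (h'.1 ▸ mem_insert_self _ _)
  · exact hxσ (h'.1 ▸ mem_insert_self _ _)
  · have hxx : x ∈ insert x' σ := h'.1 ▸ mem_insert_self _ _
    obtain rfl : x = x' := (mem_insert.1 hxx).resolve_right hxσ
    obtain ⟨l, hl, hlx⟩ := hd x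
    have hlx := hlx _ (hmn l).1
    by_cases hli : l = i
    · exact absurd hlx (not_le.2 (hx' l hl (hli ▸ hij)))
    · exact absurd hlx (not_le.2 (hx l hl hli))

theorem scarfPivot_of_above (hr : ∀ i, Function.Injective (r i))
    (hmn : ∀ i, mn i ∈ σ ∧ ∀ x ∈ σ, r i (mn i) ≤ r i x) (hcard : C.card = σ.card + 1)
    {P : Finset T × Finset I} (hP : ScarfDominant r P.1 P.2) (h : ScarfAbove (σ, C) P) :
    ∃ k ∈ C, (∃ l ∈ C, l ≠ k ∧ mn l = mn k) ∧ ScarfPivot r σ C mn k P := by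
  rcases h with ⟨x, hxσ, rfl⟩ | ⟨k, hk, rfl⟩
  · dsimp only at hxσ hP
    obtain ⟨mn', hmn'⟩ := exists_scarf_argmin r (insert_nonempty x σ)
    have hsurj : ∀ z ∈ insert x σ, ∃ i ∈ C, mn' i = z := fun z hz => hP.exists_argmin_eq hr hmn' hz
    have hinj : Set.InjOn mn' C := by
      rw [← card_image_iff]
      have : C.image mn' = insert x σ := by
        ext z
        rw [mem_image]
        exact ⟨fun ⟨k, _, hk⟩ => hk ▸ (hmn' k).1, hsurj z⟩
      rw [this, card_insert_of_notMem hxσ, hcard]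
    obtain ⟨k, hk, hkx⟩ := hsurj x (mem_insert_self _ _)
    have hold : ∀ l ∈ C, l ≠ k → mn' l = mn l := by
      intro l hl hlk
      have hmem : mn' l ∈ σ := by
        refine (mem_insert.1 (hmn' l).1).resolve_left fun hlx => hlk ?_
        exact hinj (by exact_mod_cast hl) (by exact_mod_cast hk) (hlx.trans hkx.symm)
      exact hr l (le_antisymm ((hmn' l).2 _ (mem_insert_of_mem (hmn l).1)) ((hmn l).2 _ hmem))
    refine ⟨k, hk, ?_, Or.inr ⟨x, rfl, hxσ, fun l hl hlk => ?_⟩⟩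
    · obtain ⟨l, hl, hlz⟩ := hsurj (mn k) (mem_insert_of_mem (hmn k).1)
      have hlk : l ≠ k := by
        rintro rfl
        rw [hkx] at hlz
        exact hxσ (hlz ▸ (hmn l).1)
      exact ⟨l, hl, hlk, by rw [← hold l hl hlk, hlz]⟩
    · rw [← hold l hl hlk]
      refine lt_of_le_of_ne ((hmn' l).2 x (mem_insert_self _ _)) fun he => ?_
      have := hr l he
      rw [hold l hl hlk] at this
      exact hxσ (this ▸ (hmn l).1)
  · obtain ⟨l, hl, hlk⟩ := hP.exists_argmin_eq hr hmn (hmn k).1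
    rw [mem_erase] at hl
    exact ⟨k, hk, ⟨l, hl.2, hl.1, hlk⟩, Or.inl rfl⟩

end Pivot

section Parity

open scoped Classical

variable [Fintype T] [Fintype I]

/-- A nonempty door lies below exactly two rooms. -/
theorem card_rooms_above_door (hr : ∀ i, Function.Injective (r i)) {σ : Finset T} {C : Finset I}
    (hσ : σ.Nonempty) (hd : ScarfDominant r σ C) (hcard : C.card = σ.card + 1) :
    #{P : Finset T × Finset I | ScarfDominant r P.1 P.2 ∧ ScarfAbove (σ, C) P} = 2 := by
  obtain ⟨mn, hmn⟩ := exists_scarf_argmin r hσ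
  obtain ⟨i, hi, j, hj, hij, he, hcol⟩ := exists_unique_collision hcard (fun i => (hmn i).1)
    (fun x hx => hd.exists_argmin_eq hr hmn hx)
  obtain ⟨P, hPd, hP⟩ := exists_scarfPivot hr hmn hi hj hij.symm he.symm hd
  obtain ⟨P', hPd', hP'⟩ := exists_scarfPivot hr hmn hj hi hij he hd
  have above : ∀ k ∈ C, ∀ Q, ScarfPivot r σ C mn k Q → ScarfAbove (σ, C) Q := by
    rintro k hk Q (rfl | ⟨x, rfl, hx, _⟩)
    · exact Or.inr ⟨k, hk, rfl⟩
    · exact Or.inl ⟨x, hx, rfl⟩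
  rw [card_eq_two]
  refine ⟨P, P', scarfPivot_ne hmn hi hij hd hP hP', ?_⟩
  ext Q
  simp only [mem_filter, mem_univ, true_and, mem_insert, mem_singleton]
  constructor
  · rintro ⟨hQd, hQ⟩
    obtain ⟨k, hk, hkcol, hQk⟩ := scarfPivot_of_above hr hmn hcard hQd hQ
    rcases hcol k hk hkcol with rfl | rfl
    · exact Or.inl (scarfPivot_unique hr hmn hQd hPd hQk hP)
    · exact Or.inr (scarfPivot_unique hr hmn hQd hPd' hQk hP')
  · rintro (rfl | rfl)
    · exact ⟨hPd, above i hi _ hP⟩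
    · exact ⟨hPd', above j hj _ hP'⟩

/-- An empty door lies below exactly one room. -/
theorem card_rooms_above_empty_door [Nonempty T] (hr : ∀ i, Function.Injective (r i)) (i : I) :
    #{P : Finset T × Finset I | ScarfDominant r P.1 P.2 ∧ ScarfAbove (∅, {i}) P} = 1 := by
  obtain ⟨x, -, hx⟩ := exists_max_image (univ : Finset T) (r i) univ_nonempty
  rw [card_eq_one]
  refine ⟨({x}, {i}), ?_⟩
  ext Q
  simp only [mem_filter, mem_univ, true_and, mem_singleton]
  constructor
  · rintro ⟨hQd, ⟨z, -, rfl⟩ | ⟨k, hk, rfl⟩⟩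
    · obtain ⟨l, hl, hlx⟩ := hQd x
      obtain rfl : l = i := mem_singleton.1 hl
      have : z = x := hr l (le_antisymm (hx z (mem_univ _)) (hlx z (mem_insert_self _ _)))
      simp [this]
    · obtain ⟨l, hl, -⟩ := hQd x
      simp_all
  · rintro rfl
    refine ⟨fun y => ⟨i, mem_singleton_self i, fun z hz => ?_⟩, Or.inl ⟨x, by simp⟩⟩
    rw [mem_singleton.1 hz]
    exact hx y (mem_univ _)

/-- A room whose colors differ from its index set has an even number of almost colorful doors. -/
theorem even_card_doors_below_room {c : T → I} {i₀ : I} {σ : Finset T} {C : Finset I}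
    (hcard : σ.card = C.card) (hc : σ.image c ≠ C) :
    Even #{Q : Finset T × Finset I |
      (i₀ ∈ Q.2 ∧ Q.1.image c = Q.2.erase i₀) ∧ ScarfAbove Q (σ, C)} := by
  have hchar : ∀ Q : Finset T × Finset I, ScarfAbove Q (σ, C) ↔
      (∃ x ∈ σ, Q = (σ.erase x, C)) ∨ ∃ k, k ∉ C ∧ Q = (σ, insert k C) := by
    rintro ⟨τ, D⟩
    constructor
    · rintro (⟨x, hx, h⟩ | ⟨k, hk, h⟩) <;> rw [Prod.mk.injEq] at h <;> dsimp only at h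
      · obtain ⟨rfl, rfl⟩ := h
        exact Or.inl ⟨x, mem_insert_self _ _, by rw [erase_insert hx]⟩
      · obtain ⟨rfl, rfl⟩ := h
        exact Or.inr ⟨k, by simp, by rw [insert_erase hk]⟩
    · rintro (⟨x, hx, h⟩ | ⟨k, hk, h⟩) <;> rw [Prod.mk.injEq] at h <;> obtain ⟨rfl, rfl⟩ := h
      · exact Or.inl ⟨x, by simp, by simp [insert_erase hx]⟩
      · exact Or.inr ⟨k, by simp, by simp [erase_insert hk]⟩
  by_cases hi₀ : i₀ ∈ C
  swap
  · rw [filter_eq_empty_iff.2]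
    · simp
    rintro Q - ⟨⟨hQ, hQc⟩, hab⟩
    rcases (hchar Q).1 hab with ⟨x, hx, rfl⟩ | ⟨k, hk, rfl⟩
    · exact hi₀ hQ
    · obtain rfl : i₀ = k := (mem_insert.1 hQ).resolve_right hi₀
      exact hc (by simpa [erase_insert hi₀] using hQc)
  have hCpos : 0 < C.card := card_pos.2 ⟨i₀, hi₀⟩
  by_cases hA : ∃ k, k ∉ C ∧ σ.image c = (insert k C).erase i₀
  · obtain ⟨k, hk, hkc⟩ := hA
    have hki : k ≠ i₀ := fun h => hk (h ▸ hi₀)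
    have hinj : Set.InjOn c σ := by
      rw [← card_image_iff, hkc, card_erase_of_mem (mem_insert_of_mem hi₀),
        card_insert_of_notMem hk, hcard]
      rfl
    have hkim : k ∈ σ.image c := by
      rw [hkc]
      exact mem_erase.2 ⟨hki, mem_insert_self _ _⟩
    obtain ⟨x, hx, hxk⟩ := mem_image.1 hkim
    have himgx : ∀ z ∈ σ, (σ.erase z).image c = ((insert k C).erase i₀).erase (c z) := by
      intro z hz
      rw [← hkc]
      ext l
      simp only [mem_image, mem_erase]
      constructor
      · rintro ⟨a, ⟨haz, ha⟩, rfl⟩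
        exact ⟨fun h => haz (hinj ha hz h), a, ha, rfl⟩
      · rintro ⟨hl, a, ha, rfl⟩
        exact ⟨a, ⟨fun h => hl (h ▸ rfl), ha⟩, rfl⟩
    rw [show (filter _ _ : Finset (Finset T × Finset I)) = {(σ, insert k C), (σ.erase x, C)} from ?_,
      card_pair]
    · exact even_two
    · intro h
      rw [Prod.mk.injEq] at h
      exact hk (h.2 ▸ mem_insert_self _ _)
    ext Q
    simp only [mem_filter, mem_univ, true_and, mem_insert, mem_singleton]
    constructor
    · rintro ⟨⟨hQ, hQc⟩, hab⟩
      rcases (hchar Q).1 hab with ⟨z, hz, rfl⟩ | ⟨l, hl, rfl⟩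
      · right
        dsimp only at hQc
        rw [himgx z hz] at hQc
        have : k ∉ C.erase i₀ := fun h => hk (mem_of_mem_erase h)
        rw [← hQc] at this
        have hcz : k = c z := by
          by_contra hne
          exact this (mem_erase.2 ⟨hne, mem_erase.2 ⟨hki, mem_insert_self _ _⟩⟩)
        rw [hinj hz hx (hcz.symm.trans hxk.symm)]
      · left
        dsimp only at hQc
        have : k ∈ (insert l C).erase i₀ := by rwa [← hQc]
        rw [(mem_insert.1 (mem_of_mem_erase this)).resolve_right hk]
    · rintro (rfl | rfl)
      · exact ⟨⟨mem_insert_of_mem hi₀, hkc⟩, (hchar _).2 (Or.inr ⟨k, hk, rfl⟩)⟩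
      · refine ⟨⟨hi₀, ?_⟩, (hchar _).2 (Or.inl ⟨x, hx, rfl⟩)⟩
        dsimp only
        rw [himgx x hx, hxk, erase_right_comm, erase_insert hk]
  have hfilter : ∀ Q : Finset T × Finset I,
      ((i₀ ∈ Q.2 ∧ Q.1.image c = Q.2.erase i₀) ∧ ScarfAbove Q (σ, C)) ↔
        ∃ x ∈ σ, (σ.erase x).image c = C.erase i₀ ∧ Q = (σ.erase x, C) := by
    intro Q
    rw [hchar]
    constructor
    · rintro ⟨⟨hQ, hQc⟩, ⟨x, hx, rfl⟩ | ⟨k, hk, rfl⟩⟩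
      · exact ⟨x, hx, hQc, rfl⟩
      · exact (hA ⟨k, hk, hQc⟩).elim
    · rintro ⟨x, hx, hQc, rfl⟩
      exact ⟨⟨hi₀, hQc⟩, Or.inl ⟨x, hx, rfl⟩⟩
  simp only [hfilter]
  by_cases hB : ∃ x ∈ σ, (σ.erase x).image c = C.erase i₀
  swap
  · rw [filter_eq_empty_iff.2]
    · simp
    rintro Q - ⟨x, hx, hxc, -⟩
    exact hB ⟨x, hx, hxc⟩
  obtain ⟨x, hx, hxc⟩ := hB
  have hσc : σ.image c = insert (c x) (C.erase i₀) := by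
    rw [← hxc, ← image_insert, insert_erase hx]
  have hcxi : c x ≠ i₀ := by
    intro h
    rw [h, insert_erase hi₀] at hσc
    exact hc hσc
  have hcx : c x ∈ C.erase i₀ := by
    refine mem_erase.2 ⟨hcxi, ?_⟩
    by_contra h
    exact hA ⟨c x, h, by rw [hσc, erase_insert_of_ne hcxi]⟩
  have hinj : Set.InjOn c (σ.erase x : Finset T) := by
    rw [← card_image_iff, hxc, card_erase_of_mem hi₀, card_erase_of_mem hx, hcard]
  obtain ⟨x', hx', hcx'⟩ := mem_image.1 (hxc.symm ▸ hcx : c x ∈ (σ.erase x).image c)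
  have hx'σ := mem_of_mem_erase hx'
  have hne : x' ≠ x := (mem_erase.1 hx').1
  rw [show (filter _ _ : Finset (Finset T × Finset I)) = {(σ.erase x, C), (σ.erase x', C)} from ?_,
    card_pair]
  · exact even_two
  · intro h
    rw [Prod.mk.injEq] at h
    rw [h.1] at hx'
    simp at hx'
  ext Q
  simp only [mem_filter, mem_univ, true_and, mem_insert, mem_singleton]
  constructor
  · rintro ⟨z, hz, hzc, rfl⟩
    by_contra! hcon
    have hzx : z ≠ x := by
      rintro rfl
      exact hcon.1 rfl
    have hzx' : z ≠ x' := by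
      rintro rfl
      exact hcon.2 rfl
    have hcz : c z ∈ (σ.erase z).image c := by
      rw [hzc, ← hxc]
      exact mem_image_of_mem c (mem_erase.2 ⟨hzx, hz⟩)
    obtain ⟨a, ha, haz⟩ := mem_image.1 hcz
    rw [mem_erase] at ha
    have hzmem : z ∈ σ.erase x := mem_erase.2 ⟨hzx, hz⟩
    by_cases hax : a = x
    · exact hzx' (hinj hzmem hx' (by rw [hcx', ← haz, hax]))
    · exact ha.1 (hinj (mem_erase.2 ⟨hax, ha.2⟩) hzmem haz)
  · rintro (rfl | rfl)
    · exact ⟨x, hx, hxc, rfl⟩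
    · refine ⟨x', hx'σ, ?_, rfl⟩
      rw [← hxc]
      ext l
      simp only [mem_image, mem_erase]
      constructor
      · rintro ⟨a, ⟨hax', ha⟩, rfl⟩
        by_cases hax : a = x
        · exact ⟨x', ⟨hne, hx'σ⟩, by rw [hcx', hax]⟩
        · exact ⟨a, ⟨hax, ha⟩, rfl⟩
      · rintro ⟨a, ⟨hax, ha⟩, rfl⟩
        by_cases hax' : a = x'
        · exact ⟨x, ⟨hne.symm, hx⟩, by rw [hax', hcx']⟩
        · exact ⟨a, ⟨hax', ha⟩, rfl⟩

/-- **Scarf's lemma**: for every coloring there is a dominant pair whose colors are exactly its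
indices. -/
theorem exists_colorful_dominant [Nonempty T] [Nonempty I] (hr : ∀ i, Function.Injective (r i))
    (c : T → I) : ∃ (σ : Finset T) (C : Finset I), ScarfDominant r σ C ∧ σ.image c = C := by
  by_contra! hcon
  obtain ⟨i₀⟩ := ‹Nonempty I›
  let D : Finset (Finset T × Finset I) :=
    {Q | ScarfDominant r Q.1 Q.2 ∧ i₀ ∈ Q.2 ∧ Q.1.image c = Q.2.erase i₀ ∧
      Q.2.card = Q.1.card + 1}
  let R : Finset (Finset T × Finset I) :=
    {P | ScarfDominant r P.1 P.2 ∧ P.1.card = P.2.card}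
  have hcardAbove : ∀ Q P : Finset T × Finset I, ScarfAbove Q P →
      (Q.2.card = Q.1.card + 1 ↔ P.1.card = P.2.card) := by
    rintro ⟨τ, E⟩ P (⟨x, hx, rfl⟩ | ⟨k, hk, rfl⟩)
    · dsimp only at hx ⊢
      rw [card_insert_of_notMem hx]
      omega
    · dsimp only at hk ⊢
      have : 0 < E.card := card_pos.2 ⟨k, hk⟩
      rw [card_erase_of_mem hk]
      omega
  have hdomAbove : ∀ Q P : Finset T × Finset I, ScarfAbove Q P → ScarfDominant r P.1 P.2 →
      ScarfDominant r Q.1 Q.2 := by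
    rintro ⟨τ, E⟩ P (⟨x, hx, rfl⟩ | ⟨k, hk, rfl⟩) hd
    · exact hd.mono (subset_insert _ _) Subset.rfl
    · exact hd.mono Subset.rfl (erase_subset _ _)
  have hcount := sum_card_bipartiteAbove_eq_sum_card_bipartiteBelow
    (s := D) (t := R) (ScarfAbove (T := T) (I := I))
  have heven : Even (∑ P ∈ R, #(D.bipartiteBelow ScarfAbove P)) := by
    refine even_sum _ fun P hP => ?_
    simp only [R, mem_filter, mem_univ, true_and] at hP
    have hset : D.bipartiteBelow ScarfAbove P = ({Q : Finset T × Finset I |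
        (i₀ ∈ Q.2 ∧ Q.1.image c = Q.2.erase i₀) ∧ ScarfAbove Q (P.1, P.2)} : Finset _) := by
      ext Q
      simp only [bipartiteBelow, D, mem_filter, mem_univ, true_and]
      constructor
      · rintro ⟨⟨-, h1, h2, -⟩, h⟩
        exact ⟨⟨h1, h2⟩, h⟩
      · rintro ⟨⟨h1, h2⟩, h⟩
        exact ⟨⟨hdomAbove _ _ h hP.1, h1, h2, (hcardAbove _ _ h).2 hP.2⟩, h⟩
    rw [hset]
    exact even_card_doors_below_room hP.2 (hcon P.1 P.2 hP.1)
  have habove : ∀ Q ∈ D, #(R.bipartiteAbove ScarfAbove Q) =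
      #{P : Finset T × Finset I | ScarfDominant r P.1 P.2 ∧ ScarfAbove Q P} := by
    intro Q hQ
    simp only [D, mem_filter, mem_univ, true_and] at hQ
    congr 1
    ext P
    simp only [bipartiteAbove, R, mem_filter, mem_univ, true_and]
    exact ⟨fun h => ⟨h.1.1, h.2⟩, fun h => ⟨⟨h.1, (hcardAbove _ _ h.2).1 hQ.2.2.2⟩, h.2⟩⟩
  have hmem : ((∅, {i₀}) : Finset T × Finset I) ∈ D := by
    simp only [D, mem_filter, mem_univ, true_and]
    exact ⟨fun y => ⟨i₀, by simp⟩, by simp⟩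
  have hodd : ¬ Even (∑ Q ∈ D, #(R.bipartiteAbove ScarfAbove Q)) := by
    rw [← add_sum_erase D _ hmem, habove _ hmem, card_rooms_above_empty_door hr, add_comm,
      Nat.even_add_one, not_not]
    refine even_sum _ fun Q hQ => ?_
    obtain ⟨hne, hQD⟩ := mem_erase.1 hQ
    rw [habove Q hQD]
    simp only [D, mem_filter, mem_univ, true_and] at hQD
    obtain ⟨hd, hi, -, hcard⟩ := hQD
    have hσ : Q.1.Nonempty := by
      rw [nonempty_iff_ne_empty]
      intro h0
      rw [h0, card_empty] at hcard
      obtain ⟨a, ha⟩ := card_eq_one.1 hcard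
      rw [ha, mem_singleton] at hi
      exact hne (Prod.ext h0 (by rw [ha, hi]))
    rw [card_rooms_above_door hr hσ hd hcard]
    exact even_two
  exact hodd (hcount ▸ heven)

end Parity
end Scarf

section Equilibrium

open Finset Filter Topology

variable {I : Type*} [Fintype I] [Nonempty I]

/-- Every coloring of the lattice simplex has a cluster containing all the colors of its
non-negligible coordinates. -/
theorem exists_lattice_cluster (M : ℕ) (c : (I → ℕ) → I) :
    ∃ x₀ : I → ℕ, ∑ i, x₀ i = M ∧ ∀ j, Fintype.card I ≤ x₀ j →
      ∃ x : I → ℕ, ∑ i, x i = M ∧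
        (∀ i, x i ≤ x₀ i + Fintype.card I ∧ x₀ i ≤ x i + Fintype.card I) ∧ c x = j := by
  classical
  let T := {x : I → Fin (M + 1) // ∑ i, (x i : ℕ) = M}
  let val : T → I → ℕ := fun x i => (x.1 i : ℕ)
  have hval : ∀ x : T, ∑ i, val x i = M := fun x => x.2
  have lift : ∀ y : I → ℕ, ∑ i, y i = M → ∃ x : T, val x = y := by
    intro y hy
    have hle : ∀ i, y i < M + 1 := fun i =>
      Nat.lt_succ_of_le (hy ▸ single_le_sum (f := y) (fun _ _ => Nat.zero_le _) (mem_univ i))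
    exact ⟨⟨fun i => ⟨y i, hle i⟩, hy⟩, rfl⟩
  have hT : Nonempty T := by
    obtain ⟨i₀⟩ := ‹Nonempty I›
    obtain ⟨x, -⟩ := lift (Pi.single i₀ M) (by simp)
    exact ⟨x⟩
  let L := Fintype.card T
  let enc : T ≃ Fin L := Fintype.equivFin T
  let r : I → T → ℕ := fun i x => val x i * L + enc x
  have hr_le : ∀ i x y, r i x ≤ r i y → val x i ≤ val y i := by
    intro i x y h
    by_contra! hlt
    have h1 : (val y i + 1) * L ≤ val x i * L := Nat.mul_le_mul_right _ hlt
    have h2 := (enc y).2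
    simp only [r] at h
    rw [add_mul] at h1
    omega
  have hr : ∀ i, Function.Injective (r i) := by
    intro i x y h
    have hv : val x i = val y i := le_antisymm (hr_le i x y h.le) (hr_le i y x h.ge)
    simp only [r, hv] at h
    exact enc.injective (Fin.ext (by omega))
  obtain ⟨σ, C, hd, hC⟩ := exists_colorful_dominant hr (fun x => c (val x))
  have hCne : C.Nonempty := by
    obtain ⟨i, hi, -⟩ := hd (Classical.arbitrary T)
    exact ⟨i, hi⟩
  have hσ : σ.Nonempty := by
    rw [← hC] at hCne
    exact image_nonempty.1 hCne
  obtain ⟨mn, hmn⟩ := exists_scarf_argmin (fun (i : I) (x : T) => val x i) hσ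
  let m : I → ℕ := fun i => val (mn i) i
  have hm : ∀ i, ∀ x ∈ σ, m i ≤ val x i := fun i x hx => (hmn i).2 x hx
  have hsum : M < ∑ i ∈ C, (m i + 1) := by
    by_contra! hle
    obtain ⟨i₁, hi₁⟩ := hCne
    obtain ⟨y, hy⟩ := lift (fun i => (if i ∈ C then m i + 1 else 0) +
      if i = i₁ then M - ∑ i ∈ C, (m i + 1) else 0) (by
        rw [sum_add_distrib, sum_ite_mem, univ_inter, sum_ite_eq' univ i₁ fun _ => _]
        simp only [mem_univ, if_true]
        omega)
    obtain ⟨i, hi, hiy⟩ := hd y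
    have h1 := hr_le i _ _ (hiy _ (hmn i).1)
    rw [hy] at h1
    simp only [hi, if_true] at h1
    change _ ≤ m i at h1
    omega
  rw [sum_add_distrib, sum_const, smul_eq_mul, mul_one] at hsum
  have hCcard : C.card ≤ Fintype.card I := card_le_univ C
  have hsplit : ∀ x ∈ σ, ∑ i ∈ C, (val x i - m i) + ∑ i ∈ Cᶜ, val x i < Fintype.card I := by
    intro x hx
    have h1 : ∑ i ∈ C, val x i + ∑ i ∈ Cᶜ, val x i = M := by
      rw [sum_add_sum_compl]
      exact hval x
    have h2 : ∑ i ∈ C, (val x i - m i) + ∑ i ∈ C, m i = ∑ i ∈ C, val x i := by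
      rw [← sum_add_distrib]
      exact sum_congr rfl fun i _ => Nat.sub_add_cancel (hm i x hx)
    omega
  have hin : ∀ x ∈ σ, ∀ i ∈ C, val x i < m i + Fintype.card I := by
    intro x hx i hi
    have h1 := hsplit x hx
    have h2 := single_le_sum (f := fun i => val x i - m i) (fun _ _ => Nat.zero_le _) hi
    omega
  have hout : ∀ x ∈ σ, ∀ i ∉ C, val x i < Fintype.card I := by
    intro x hx i hi
    have h1 := hsplit x hx
    have h2 := single_le_sum (f := fun i => val x i) (fun _ _ => Nat.zero_le _) (mem_compl.2 hi)
    omega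
  obtain ⟨x₀, hx₀⟩ := hσ
  refine ⟨val x₀, hval x₀, fun j hj => ?_⟩
  have hjC : j ∈ C := by
    by_contra h
    exact absurd (hout x₀ hx₀ j h) (not_lt.2 hj)
  rw [← hC] at hjC
  obtain ⟨x, hx, hxj⟩ := mem_image.1 hjC
  refine ⟨val x, hval x, fun i => ?_, hxj⟩
  by_cases hi : i ∈ C
  · have h1 := hin x hx i hi
    have h2 := hin x₀ hx₀ i hi
    have h3 := hm i x hx
    have h4 := hm i x₀ hx₀
    omega
  · have h1 := hout x hx i hi
    have h2 := hout x₀ hx₀ i hi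
    omega

/-- A population game with continuous costs on the simplex has an equilibrium. -/
theorem exists_population_equilibrium (J : I → (I → ℝ) → ℝ)
    (hJ : ∀ k, ContinuousOn (J k) (stdSimplex ℝ I)) :
    ∃ v ∈ stdSimplex ℝ I, ∀ j, 0 < v j → ∀ k, J j v ≤ J k v := by
  let K : ℝ := Fintype.card I
  let scale : ℕ → (I → ℕ) → I → ℝ := fun M x i => (x i : ℝ) / (M + 1 : ℕ)
  have hscale : ∀ M x, ∑ i, x i = M + 1 → scale M x ∈ stdSimplex ℝ I := by
    intro M x hx
    refine ⟨fun i => by positivity, ?_⟩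
    simp only [scale]
    rw [← sum_div, ← Nat.cast_sum, hx, div_self]
    positivity
  have hargmin : ∀ p : I → ℝ, ∃ j, ∀ k, J j p ≤ J k p := fun p => by
    obtain ⟨j, -, hj⟩ := exists_min_image (univ : Finset I) (fun j => J j p) univ_nonempty
    exact ⟨j, fun k => hj k (mem_univ k)⟩
  choose am ham using hargmin
  choose X hXsum hX using fun M => exists_lattice_cluster (I := I) (M + 1) (fun x => am (scale M x))
  obtain ⟨v, hv, φ, hφ, hlim⟩ := (isCompact_stdSimplex ℝ I).tendsto_subseq
    (fun M => hscale M (X M) (hXsum M))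
  refine ⟨v, hv, fun j hj k => ?_⟩
  have hclose : ∀ M, ∃ q ∈ stdSimplex ℝ I, (∀ i, |q i - scale M (X M) i| ≤ K / (M + 1 : ℕ)) ∧
      (K / (M + 1 : ℕ) ≤ scale M (X M) j → J j q ≤ J k q) := by
    intro M
    have hpos : (0 : ℝ) < (M + 1 : ℕ) := by positivity
    by_cases h : Fintype.card I ≤ X M j
    · obtain ⟨x, hxs, hxc, hxj⟩ := hX M j h
      refine ⟨scale M x, hscale M x hxs, fun i => ?_, fun _ => ?_⟩
      · simp only [scale]
        rw [← sub_div, abs_div, abs_of_pos hpos]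
        refine div_le_div_of_nonneg_right ?_ hpos.le
        have h1 : (x i : ℝ) ≤ X M i + K := by simp only [K]; exact_mod_cast (hxc i).1
        have h2 : (X M i : ℝ) ≤ x i + K := by simp only [K]; exact_mod_cast (hxc i).2
        rw [abs_le]
        constructor <;> linarith
      · rw [← hxj]
        exact ham _ k
    · refine ⟨scale M (X M), hscale M _ (hXsum M), fun i => ?_, fun h' => ?_⟩
      · simp only [sub_self, abs_zero]
        positivity
      · refine absurd ?_ h
        have : (Fintype.card I : ℝ) ≤ X M j := (div_le_div_iff_of_pos_right hpos).1 h'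
        exact_mod_cast this
  choose q hqs hqc hqJ using hclose
  have hzero : Tendsto (fun M : ℕ => K / (φ M + 1 : ℕ)) atTop (𝓝 0) :=
    ((tendsto_const_div_atTop_nhds_zero_nat K).comp (tendsto_add_atTop_nat 1)).comp
      hφ.tendsto_atTop
  have hq : Tendsto (fun M => q (φ M)) atTop (𝓝 v) := by
    rw [tendsto_pi_nhds]
    intro i
    have h1 : Tendsto (fun M => scale (φ M) (X (φ M)) i) atTop (𝓝 (v i)) :=
      (tendsto_pi_nhds.1 hlim) i
    have h2 : Tendsto (fun M => q (φ M) i - scale (φ M) (X (φ M)) i) atTop (𝓝 0) :=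
      squeeze_zero_norm (fun M => hqc (φ M) i) hzero
    simpa using h2.add h1
  have hqw : Tendsto (fun M => q (φ M)) atTop (𝓝[stdSimplex ℝ I] v) :=
    tendsto_nhdsWithin_iff.2 ⟨hq, Eventually.of_forall fun M => hqs _⟩
  refine le_of_tendsto_of_tendsto ((hJ j v hv).tendsto.comp hqw) ((hJ k v hv).tendsto.comp hqw) ?_
  have hev := hzero.eventually_lt ((tendsto_pi_nhds.1 hlim) j) hj
  filter_upwards [hev] with M hM
  exact hqJ (φ M) hM.le

end Equilibrium

section Empirical

open MeasureTheory ProbabilityTheory Filter Topology Finset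

/-- Integrals of continuous functions depend jointly continuously on the measure and on
parameters of the integrand. -/
theorem continuous_integral_prod {E P : Type*} [TopologicalSpace E] [CompactSpace E]
    [MeasurableSpace E] [OpensMeasurableSpace E] [TopologicalSpace P] {φ : P × E → ℝ}
    (hφ : Continuous φ) :
    Continuous fun q : ProbabilityMeasure E × P => ∫ e, φ (q.2, e) ∂(q.1 : Measure E) := by
  let Φ : C(P, C(E, ℝ)) := ContinuousMap.curry ⟨φ, hφ⟩
  have hint : ∀ (h : C(E, ℝ)) (ν : ProbabilityMeasure E), Integrable h (ν : Measure E) :=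
    fun h ν => (BoundedContinuousFunction.mkOfCompact h).integrable _
  rw [continuous_iff_continuousAt]
  rintro ⟨ν₀, p₀⟩
  have h1 : Tendsto (fun q : ProbabilityMeasure E × P => ∫ e, Φ p₀ e ∂(q.1 : Measure E))
      (𝓝 (ν₀, p₀)) (𝓝 (∫ e, Φ p₀ e ∂(ν₀ : Measure E))) :=
    (ProbabilityMeasure.tendsto_iff_forall_integral_tendsto.1 (continuous_fst.tendsto (ν₀, p₀)))
      (BoundedContinuousFunction.mkOfCompact (Φ p₀))
  have h2 : Tendsto (fun q : ProbabilityMeasure E × P => ‖Φ q.2 - Φ p₀‖) (𝓝 (ν₀, p₀)) (𝓝 0) := by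
    have : Continuous fun q : ProbabilityMeasure E × P => ‖Φ q.2 - Φ p₀‖ := by fun_prop
    simpa using this.tendsto (ν₀, p₀)
  have h3 : Tendsto (fun q : ProbabilityMeasure E × P => ∫ e, (Φ q.2 - Φ p₀) e ∂(q.1 : Measure E))
      (𝓝 (ν₀, p₀)) (𝓝 0) := by
    refine squeeze_zero_norm (fun q => ?_) h2
    refine (norm_integral_le_of_norm_le_const
      (Eventually.of_forall fun e => (Φ q.2 - Φ p₀).norm_coe_le_norm e)).trans ?_
    simp
  have h4 := h3.add h1
  rw [zero_add] at h4
  refine h4.congr fun q => ?_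
  rw [← integral_add (hint _ _) (hint _ _)]
  simp [Φ]

variable {E : Type*} [MeasurableSpace E]

/-- The empirical measure of a finite nonempty family of points. -/
noncomputable def empiricalMeasure {ι : Type*} [Fintype ι] [Nonempty ι] (x : ι → E) :
    ProbabilityMeasure E :=
  ⟨(Fintype.card ι : ENNReal)⁻¹ • ∑ i, Measure.dirac (x i), ⟨by
    simp [ENNReal.inv_mul_cancel]⟩⟩

theorem integral_empiricalMeasure {ι : Type*} [Fintype ι] [Nonempty ι] (x : ι → E) {h : E → ℝ}
    (hh : StronglyMeasurable h) :
    ∫ e, h e ∂(empiricalMeasure x : Measure E) = (Fintype.card ι : ℝ)⁻¹ * ∑ i, h (x i) := by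
  rw [empiricalMeasure, ProbabilityMeasure.coe_mk, integral_smul_measure,
    integral_finsetSum_measure fun i _ => integrable_dirac' hh (by simp)]
  simp [integral_dirac' _ _ hh]

variable {S Ω I : Type*} [MeasurableSpace S] [MeasurableSpace Ω] [Fintype I]

/-- The mixture, with weights `v`, of the strategies `σ k`, independent of the noise law `μ`. -/
noncomputable def mixtureProd (σ : I → S) (μ : Measure Ω) [IsProbabilityMeasure μ]
    (v : stdSimplex ℝ I) : ProbabilityMeasure (S × Ω) :=
  ⟨∑ k, ENNReal.ofReal (v.1 k) • (Measure.dirac (σ k)).prod μ, ⟨by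
    simp only [Measure.coe_finsetSum, Finset.sum_apply, Measure.smul_apply, measure_univ,
      smul_eq_mul, mul_one]
    rw [← ENNReal.ofReal_sum_of_nonneg fun k _ => v.2.1 k, v.2.2, ENNReal.ofReal_one]⟩⟩

theorem integral_mixtureProd (σ : I → S) (μ : Measure Ω) [IsProbabilityMeasure μ]
    (v : stdSimplex ℝ I) {h : S × Ω → ℝ} (hh : StronglyMeasurable h) {B : ℝ}
    (hB : ∀ e, |h e| ≤ B) :
    ∫ e, h e ∂(mixtureProd σ μ v : Measure (S × Ω)) = ∑ k, v.1 k * ∫ ω, h (σ k, ω) ∂μ := by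
  have hint : ∀ (ρ : Measure (S × Ω)) [IsFiniteMeasure ρ], Integrable h ρ := fun ρ _ =>
    Integrable.of_bound hh.aestronglyMeasurable B (Eventually.of_forall hB)
  rw [mixtureProd, ProbabilityMeasure.coe_mk, integral_finsetSum_measure
    fun k _ => (hint _).smul_measure (by simp)]
  refine Finset.sum_congr rfl fun k _ => ?_
  rw [integral_smul_measure, integral_prod _ (hint _), integral_dirac' _ _ ?_,
    ENNReal.toReal_ofReal (v.2.1 k), smul_eq_mul]
  exact hh.integral_prod_right'

/-- Pure profiles approximating a mixed strategy, using only strategies in its support. -/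
theorem exists_profile_approximating (v : stdSimplex ℝ I) :
    ∃ a : ∀ N : ℕ, Fin (N + 1) → I, (∀ N i, 0 < v.1 (a N i)) ∧ ∀ H : I → ℝ,
      Tendsto (fun N : ℕ => ((N + 1 : ℕ) : ℝ)⁻¹ * ∑ i, H (a N i)) atTop
        (𝓝 (∑ k, v.1 k * H k)) := by
  classical
  obtain ⟨v, hv0, hv1⟩ := v
  obtain ⟨k₀, hk₀⟩ : ∃ k, 0 < v k := by
    by_contra! hcon
    have : ∑ k, v k ≤ 0 := Finset.sum_nonpos fun k _ => hcon k
    linarith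
  let fl : ℕ → I → ℕ := fun N k => ⌊((N + 1 : ℕ) : ℝ) * v k⌋₊
  have hfl : ∀ N k, (fl N k : ℝ) ≤ ((N + 1 : ℕ) : ℝ) * v k := fun N k =>
    Nat.floor_le (mul_nonneg (by positivity) (hv0 k))
  have hfl' : ∀ N k, ((N + 1 : ℕ) : ℝ) * v k < fl N k + 1 := fun N k => Nat.lt_floor_add_one _
  have hflsum : ∀ N, ∑ k, fl N k ≤ N + 1 := by
    intro N
    have : (∑ k, (fl N k : ℝ)) ≤ ((N + 1 : ℕ) : ℝ) := by
      calc (∑ k, (fl N k : ℝ)) ≤ ∑ k, ((N + 1 : ℕ) : ℝ) * v k := Finset.sum_le_sum fun k _ => hfl N k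
        _ = ((N + 1 : ℕ) : ℝ) := by rw [← Finset.mul_sum, hv1, mul_one]
    exact_mod_cast this
  let rest : ℕ → ℕ := fun N => N + 1 - ∑ k, fl N k
  have hrest : ∀ N, (rest N : ℝ) ≤ Fintype.card I := by
    intro N
    have h1 : (rest N : ℝ) = ((N + 1 : ℕ) : ℝ) - ∑ k, (fl N k : ℝ) := by
      simp only [rest]
      rw [Nat.cast_sub (hflsum N), Nat.cast_sum]
    have h2 : ((N + 1 : ℕ) : ℝ) ≤ ∑ k, ((fl N k : ℝ) + 1) := by
      calc ((N + 1 : ℕ) : ℝ) = ∑ k, ((N + 1 : ℕ) : ℝ) * v k := by rw [← Finset.mul_sum, hv1, mul_one]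
        _ ≤ _ := Finset.sum_le_sum fun k _ => (hfl' N k).le
    rw [Finset.sum_add_distrib] at h2
    simp at h2
    rw [h1]
    push_cast
    linarith
  let cnt : ℕ → I → ℕ := fun N k => fl N k + if k = k₀ then rest N else 0
  have hcnt : ∀ N, ∑ k, cnt N k = N + 1 := by
    intro N
    have := hflsum N
    simp only [cnt, Finset.sum_add_distrib, Finset.sum_ite_eq', Finset.mem_univ, if_true, rest]
    omega
  have e : ∀ N, Fin (N + 1) ≃ Σ k, Fin (cnt N k) := fun N =>
    Fintype.equivOfCardEq (by simp [hcnt N])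
  refine ⟨fun N i => (e N i).1, fun N i => ?_, fun H => ?_⟩
  · by_contra! hle
    have hz : v (e N i).1 = 0 := le_antisymm hle (hv0 _)
    have hne : (e N i).1 ≠ k₀ := fun h => by
      rw [h] at hz
      exact hk₀.ne' hz
    have : cnt N (e N i).1 = 0 := by simp [cnt, fl, hz, hne]
    exact (this ▸ (e N i).2).elim0
  · have hsum : ∀ N, ((N + 1 : ℕ) : ℝ)⁻¹ * ∑ i, H (e N i).1 =
        ∑ k, ((cnt N k : ℝ) / (N + 1 : ℕ)) * H k := by
      intro N
      rw [(e N).sum_comp fun p => H p.1, Fintype.sum_sigma, Finset.mul_sum]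
      refine Finset.sum_congr rfl fun k _ => ?_
      simp
      ring
    simp only [hsum]
    refine tendsto_finsetSum _ fun k _ => Tendsto.mul_const _ ?_
    have hz : Tendsto (fun N : ℕ => ((Fintype.card I : ℝ) + 1) / (N + 1 : ℕ)) atTop (𝓝 0) :=
      (tendsto_const_div_atTop_nhds_zero_nat _).comp (tendsto_add_atTop_nat 1)
    have hdiff : Tendsto (fun N : ℕ => (cnt N k : ℝ) / (N + 1 : ℕ) - v k) atTop (𝓝 0) := by
      refine squeeze_zero_norm (fun N => ?_) hz
      have hpos : (0 : ℝ) < (N + 1 : ℕ) := by positivity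
      have hdiv : (cnt N k : ℝ) / (N + 1 : ℕ) - v k =
          ((cnt N k : ℝ) - (N + 1 : ℕ) * v k) / (N + 1 : ℕ) := by
        field_simp
      rw [hdiv, norm_div, Real.norm_eq_abs, Real.norm_eq_abs, abs_of_pos hpos]
      refine div_le_div_of_nonneg_right ?_ hpos.le
      have h1 := hfl N k
      have h2 := hfl' N k
      have h3 := hrest N
      have h4 : (fl N k : ℝ) ≤ cnt N k := Nat.cast_le.2 (Nat.le_add_right _ _)
      have h5 : (cnt N k : ℝ) ≤ fl N k + rest N := by
        simp only [cnt]
        split_ifs <;> simp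
      rw [abs_le]
      constructor <;> linarith
    simpa using hdiff.add_const (v k)

/-- Chebyshev's inequality for averages of independent bounded variables. -/
theorem measure_average_deviation_le {N : ℕ} (μ : Measure Ω) [IsProbabilityMeasure μ]
    {h : Fin (N + 1) → Ω → ℝ} (hh : ∀ i, Measurable (h i)) {B : ℝ} (hB : ∀ i ω, |h i ω| ≤ B)
    {δ : ℝ} (hδ : 0 < δ) :
    (Measure.pi fun _ : Fin (N + 1) => μ) {ω | δ ≤ |((N + 1 : ℕ) : ℝ)⁻¹ * ∑ i, h i (ω i) -
      ((N + 1 : ℕ) : ℝ)⁻¹ * ∑ i, ∫ x, h i x ∂μ|} ≤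
      ENNReal.ofReal ((B ^ 2 / δ ^ 2) / (N + 1 : ℕ)) := by
  set ρ := Measure.pi fun _ : Fin (N + 1) => μ
  let Z : Fin (N + 1) → (Fin (N + 1) → Ω) → ℝ := fun i ω => h i (ω i)
  have hZm : ∀ i, Measurable (Z i) := fun i => (hh i).comp (measurable_pi_apply i)
  have hZ2 : ∀ i, MemLp (Z i) 2 ρ := fun i =>
    MemLp.of_bound (hZm i).aestronglyMeasurable B (Eventually.of_forall fun ω => hB i (ω i))
  have hsum2 : MemLp (∑ i, Z i) 2 ρ := memLp_finsetSum' _ fun i _ => hZ2 i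
  have hindep : iIndepFun Z ρ := iIndepFun_pi fun i => (hh i).aemeasurable
  have hvar : Var[∑ i, Z i; ρ] ≤ ((N + 1 : ℕ) : ℝ) * B ^ 2 := by
    rw [IndepFun.variance_sum (fun i _ => hZ2 i) fun i _ j _ hij => hindep.indepFun hij]
    calc ∑ i, Var[Z i; ρ] ≤ ∑ _i : Fin (N + 1), B ^ 2 := by
          refine Finset.sum_le_sum fun i _ => ?_
          have := variance_le_sq_of_bounded (μ := ρ) (a := -B) (b := B) (X := Z i)
            (Eventually.of_forall fun ω => abs_le.1 (hB i (ω i))) (hZm i).aemeasurable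
          exact this.trans_eq (by ring)
      _ = _ := by simp
  have hmean : ∫ ω, (∑ i, Z i) ω ∂ρ = ∑ i, ∫ x, h i x ∂μ := by
    simp only [Finset.sum_apply]
    rw [integral_finsetSum _ fun i _ => (hZ2 i).integrable (by norm_num)]
    exact Finset.sum_congr rfl fun i _ => integral_comp_eval (hh i).aestronglyMeasurable
  have hpos : (0 : ℝ) < (N + 1 : ℕ) := by positivity
  have hcheb := meas_ge_le_variance_div_sq hsum2 (c := (N + 1 : ℕ) * δ) (by positivity)
  rw [hmean] at hcheb
  refine le_trans (measure_mono fun ω hω => ?_) (hcheb.trans (ENNReal.ofReal_le_ofReal ?_))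
  · simp only [Set.mem_ofPred_eq] at hω ⊢
    rw [← mul_sub, abs_mul, abs_of_pos (inv_pos.2 hpos), ← div_eq_inv_mul, le_div_iff₀ hpos] at hω
    rw [mul_comm, Finset.sum_apply]
    exact hω
  · calc Var[∑ i, Z i; ρ] / ((N + 1 : ℕ) * δ) ^ 2
        ≤ ((N + 1 : ℕ) : ℝ) * B ^ 2 / ((N + 1 : ℕ) * δ) ^ 2 := by gcongr
      _ = _ := by field_simp

section LawOfLargeNumbers

variable [TopologicalSpace S] [BorelSpace S]
  [TopologicalSpace Ω] [SecondCountableTopology Ω] [BorelSpace Ω]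

theorem continuous_mixtureProd (σ : I → S) (μ : Measure Ω) [IsProbabilityMeasure μ] :
    Continuous (mixtureProd σ μ) := by
  rw [continuous_iff_continuousAt]
  intro v
  refine ProbabilityMeasure.tendsto_iff_forall_integral_tendsto.2 fun h => ?_
  have hh := h.continuous.stronglyMeasurable
  simp only [integral_mixtureProd σ μ _ hh h.norm_coe_le_norm]
  exact Continuous.tendsto (f := fun v : stdSimplex ℝ I => ∑ k, v.1 k * ∫ ω, h (σ k, ω) ∂μ)
    (continuous_finsetSum _ fun k _ =>
      ((continuous_apply k).comp continuous_subtype_val).mul continuous_const) v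

theorem continuous_empiricalMeasure_prod {ι : Type*} [Fintype ι] [Nonempty ι] (s : ι → S) :
    Continuous fun ω : ι → Ω => empiricalMeasure fun i => (s i, ω i) := by
  rw [continuous_iff_continuousAt]
  intro ω
  refine ProbabilityMeasure.tendsto_iff_forall_integral_tendsto.2 fun h => ?_
  simp only [integral_empiricalMeasure _ h.continuous.stronglyMeasurable]
  exact Continuous.tendsto
    (f := fun ω : ι → Ω => (Fintype.card ι : ℝ)⁻¹ * ∑ i, h (s i, ω i)) (by fun_prop) ω

/-- Along profiles whose frequencies converge, continuous functionals of the joint empirical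
measure of strategies and independent noises converge in mean. -/
theorem tendsto_integral_comp_empiricalMeasure (σ : I → S) (μ : Measure Ω)
    [IsProbabilityMeasure μ] (v : stdSimplex ℝ I) {a : ∀ N : ℕ, Fin (N + 1) → I}
    (ha : ∀ H : I → ℝ, Tendsto (fun N : ℕ => ((N + 1 : ℕ) : ℝ)⁻¹ * ∑ i, H (a N i)) atTop
      (𝓝 (∑ k, v.1 k * H k)))
    {F : ProbabilityMeasure (S × Ω) → ℝ} (hF : Continuous F) {B : ℝ} (hFB : ∀ ν, |F ν| ≤ B) :
    Tendsto (fun N : ℕ => ∫ ω, F (empiricalMeasure fun i => (σ (a N i), ω i))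
      ∂(Measure.pi fun _ : Fin (N + 1) => μ)) atTop (𝓝 (F (mixtureProd σ μ v))) := by
  let ρ : ∀ N : ℕ, Measure (Fin (N + 1) → Ω) := fun N => Measure.pi fun _ => μ
  let emp : ∀ N : ℕ, (Fin (N + 1) → Ω) → ProbabilityMeasure (S × Ω) := fun N ω =>
    empiricalMeasure fun i => (σ (a N i), ω i)
  let L : Filter (ProbabilityMeasure (S × Ω)) :=
    { sets := {U | Tendsto (fun N => ρ N {ω | emp N ω ∉ U}) atTop (𝓝 0)}
      univ_sets := by simp
      sets_of_superset := fun {U V} hU hUV =>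
        tendsto_of_tendsto_of_tendsto_of_le_of_le tendsto_const_nhds hU (fun _ => zero_le)
          fun N => measure_mono fun ω hω hωU => hω (hUV hωU)
      inter_sets := fun {U V} hU hV => by
        have hUV := Tendsto.add hU hV
        rw [add_zero] at hUV
        refine tendsto_of_tendsto_of_tendsto_of_le_of_le tendsto_const_nhds hUV
          (fun _ => zero_le) fun N => ?_
        refine (measure_mono fun ω hω => ?_).trans (measure_union_le _ _)
        by_contra hcon
        simp only [Set.mem_union, Set.mem_ofPred_eq, not_or, not_not] at hcon
        exact hω hcon }
  have hmem : ∀ U, U ∈ L ↔ Tendsto (fun N => ρ N {ω | emp N ω ∉ U}) atTop (𝓝 0) :=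
    fun U => Iff.rfl
  have hL : Tendsto id L (𝓝 (mixtureProd σ μ v)) := by
    refine ProbabilityMeasure.tendsto_iff_forall_integral_tendsto.2 fun h => ?_
    have hh := h.continuous.stronglyMeasurable
    rw [Metric.tendsto_nhds]
    intro δ hδ
    rw [Filter.Eventually, hmem, integral_mixtureProd σ μ v hh h.norm_coe_le_norm]
    have hmean := ha fun k => ∫ ω, h (σ k, ω) ∂μ
    have hzero : Tendsto (fun N : ℕ => ENNReal.ofReal ((‖h‖ ^ 2 / (δ / 2) ^ 2) / (N + 1 : ℕ)))
        atTop (𝓝 0) := by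
      rw [← ENNReal.ofReal_zero]
      exact ENNReal.tendsto_ofReal
        ((tendsto_const_div_atTop_nhds_zero_nat _).comp (tendsto_add_atTop_nat 1))
    refine tendsto_of_tendsto_of_tendsto_of_le_of_le' tendsto_const_nhds hzero
      (Eventually.of_forall fun _ => zero_le) ?_
    filter_upwards [(Metric.tendsto_nhds.1 hmean) (δ / 2) (half_pos hδ)] with N hN
    refine le_trans (measure_mono fun ω hω => ?_) (measure_average_deviation_le μ
      (h := fun i ω => h (σ (a N i), ω)) (fun i => by fun_prop)
      (fun i ω => h.norm_coe_le_norm _) (half_pos hδ))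
    simp only [Set.mem_ofPred_eq, id, emp, not_lt, integral_empiricalMeasure _ hh,
      Fintype.card_fin] at hω ⊢
    rw [Real.dist_eq] at hω hN
    have := abs_sub_le (((N + 1 : ℕ) : ℝ)⁻¹ * ∑ i, h (σ (a N i), ω i))
      (((N + 1 : ℕ) : ℝ)⁻¹ * ∑ i, ∫ x, h (σ (a N i), x) ∂μ) (∑ k, v.1 k * ∫ ω, h (σ k, ω) ∂μ)
    linarith
  have hFL := (hF.tendsto (mixtureProd σ μ v)).comp hL
  rw [Metric.tendsto_nhds]
  intro ε hε
  have hsmall := (hmem _).1 ((Metric.tendsto_nhds.1 hFL) (ε / 2) (half_pos hε))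
  have hreal := (ENNReal.tendsto_toReal ENNReal.zero_ne_top).comp hsmall
  have hreal' := hreal.const_mul (2 * B)
  rw [ENNReal.toReal_zero, mul_zero] at hreal'
  filter_upwards [hreal'.eventually_lt_const (half_pos hε)] with N hN
  set A : Set (Fin (N + 1) → Ω) := {ω | ε / 2 ≤ |F (emp N ω) - F (mixtureProd σ μ v)|} with hA
  have hAN : (2 * B) * (ρ N).real A < ε / 2 := by
    have hAeq : A = {ω | emp N ω ∉
        {x | dist ((F ∘ id) x) (F (mixtureProd σ μ v)) < ε / 2}} := by
      ext ω
      simp [hA, Real.dist_eq]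
    rw [hAeq]
    exact hN
  have hcont : Continuous fun ω => F (emp N ω) := hF.comp (continuous_empiricalMeasure_prod _)
  have hAmeas : MeasurableSet A :=
    measurableSet_le measurable_const (hcont.sub continuous_const).abs.measurable
  have hint : Integrable (fun ω => F (emp N ω)) (ρ N) :=
    Integrable.of_bound hcont.aestronglyMeasurable B (Eventually.of_forall fun ω => hFB _)
  have hB0 : 0 ≤ B := (abs_nonneg _).trans (hFB (mixtureProd σ μ v))
  rw [Real.dist_eq]
  calc |∫ ω, F (emp N ω) ∂(ρ N) - F (mixtureProd σ μ v)|
      = |∫ ω, (F (emp N ω) - F (mixtureProd σ μ v)) ∂(ρ N)| := by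
        rw [integral_sub hint (integrable_const _)]
        simp
    _ ≤ ∫ ω, |F (emp N ω) - F (mixtureProd σ μ v)| ∂(ρ N) := abs_integral_le_integral_abs
    _ ≤ ∫ ω, (ε / 2 + A.indicator (fun _ => 2 * B) ω) ∂(ρ N) := by
        refine integral_mono (hint.sub (integrable_const _)).abs
          ((integrable_const _).add ((integrable_const _).indicator hAmeas)) fun ω => ?_
        by_cases hω : ω ∈ A
        · simp only [Set.indicator_of_mem hω]
          have h1 := abs_le.1 (hFB (emp N ω))
          have h2 := abs_le.1 (hFB (mixtureProd σ μ v))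
          rw [abs_le]
          constructor <;> linarith
        · simp only [Set.indicator_of_notMem hω, add_zero]
          exact (not_le.1 hω).le
    _ = ε / 2 + (2 * B) * (ρ N).real A := by
        rw [integral_add (integrable_const _) ((integrable_const _).indicator hAmeas),
          integral_indicator_const _ hAmeas]
        simp [mul_comm]
    _ < ε := by linarith

end LawOfLargeNumbers

end Empirical

namespace SEBEU5

section MeanField

open Filter Topology

variable {n m : ℕ} {Xset : Set (Fin n → ℝ)} {Uset : Set (Fin m → ℝ)} {X0 W Y : Type}

instance instBorelSpaceContinuousMap (A B : Type) [TopologicalSpace A] [TopologicalSpace B] :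
    BorelSpace C(A, B) := ⟨rfl⟩

section Histories

variable [TopologicalSpace Y] {Sset : ∀ t : ℕ, Set C(Hist (↥Xset) (↥Uset) Y t, ↥Uset)}
  {f : ℕ → ↥Xset → ↥Uset → Y → W → ↥Xset}

theorem subjHist_succ_control (si : Strat Xset Uset Y Sset) (Z : ℕ → Y) (ωi : PrimLoc Xset W)
    (t : ℕ) :
    (subjHist f si Z ωi (t + 1)).2 (Fin.last t) =
      (si t).val ⟨(subjHist f si Z ωi t).1, (subjHist f si Z ωi t).2, fun k : Fin t => Z k⟩ := by
  simp [subjHist]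

/-- Histories up to time `t` only depend on the environment before time `t`. -/
theorem subjHist_congr (si : Strat Xset Uset Y Sset) {Z Z' : ℕ → Y} (ωi : PrimLoc Xset W)
    {t : ℕ} (h : ∀ k < t, Z k = Z' k) : subjHist f si Z ωi t = subjHist f si Z' ωi t := by
  induction t with
  | zero => rfl
  | succ t ih =>
    have hpast : (fun k : Fin t => Z k) = fun k : Fin t => Z' k :=
      funext fun k => h k (k.2.trans (Nat.lt_succ_self t))
    simp only [subjHist]
    rw [ih fun k hk => h k (hk.trans (Nat.lt_succ_self t)), hpast, h t (Nat.lt_succ_self t)]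

variable [TopologicalSpace W] [CompactSpace ↥Xset] [CompactSpace ↥Uset] [CompactSpace Y]

theorem continuous_subjHist
    (hf : ∀ t, Continuous fun p : ↥Xset × ↥Uset × Y × W => f t p.1 p.2.1 p.2.2.1 p.2.2.2) (t : ℕ) :
    Continuous fun p : Strat Xset Uset Y Sset × (ℕ → Y) × PrimLoc Xset W =>
      subjHist f p.1 p.2.1 p.2.2 t := by
  induction t with
  | zero =>
    simp only [subjHist]
    fun_prop
  | succ t ih =>
    have hu : Continuous fun p : Strat Xset Uset Y Sset × (ℕ → Y) × PrimLoc Xset W =>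
        (p.1 t).val ⟨(subjHist f p.1 p.2.1 p.2.2 t).1, (subjHist f p.1 p.2.1 p.2.2 t).2,
          fun k : Fin t => p.2.1 k⟩ := by
      refine ContinuousEval.continuous_eval.comp (Continuous.prodMk (by fun_prop) ?_)
      exact ih.fst.prodMk (ih.snd.prodMk (by fun_prop))
    simp only [subjHist]
    refine Continuous.prodMk (Continuous.finSnoc ih.fst ?_) (Continuous.finSnoc ih.snd hu)
    exact (hf t).comp (((continuous_apply (Fin.last t)).comp ih.fst).prodMk
      (hu.prodMk (Continuous.prodMk (by fun_prop) (by fun_prop))))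

end Histories

section Environment

variable [TopologicalSpace Y] [MeasurableSpace W]
  {Sset : ∀ t : ℕ, Set C(Hist (↥Xset) (↥Uset) Y t, ↥Uset)}

/-- Mean state and control at time `t` of a population with joint law `ν` of strategies and local
noises, against the environment sequence `Z`. -/
noncomputable def meanStat (f : ℕ → ↥Xset → ↥Uset → Y → W → ↥Xset)
    (ν : ProbabilityMeasure (Strat Xset Uset Y Sset × PrimLoc Xset W)) (Z : ℕ → Y) (t : ℕ) :
    (Fin n → ℝ) × (Fin m → ℝ) :=
  (fun j => ∫ e : Strat Xset Uset Y Sset × PrimLoc Xset W,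
      ((subjHist f e.1 Z e.2 t).1 (Fin.last t)).1 j
      ∂(ν : Measure (Strat Xset Uset Y Sset × PrimLoc Xset W)),
    fun j => ∫ e : Strat Xset Uset Y Sset × PrimLoc Xset W,
      ((subjHist f e.1 Z e.2 (t + 1)).2 (Fin.last t)).1 j
      ∂(ν : Measure (Strat Xset Uset Y Sset × PrimLoc Xset W)))

/-- Environment sequence before time `t` (padded by `y₀`) and environment state at time `t`
generated by a population with law `ν`. -/
noncomputable def mfEnv (f : ℕ → ↥Xset → ↥Uset → Y → W → ↥Xset)
    (g : ℕ → X0 → (Fin n → ℝ) × (Fin m → ℝ) → Y)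
    (f0 : ℕ → X0 → (Fin n → ℝ) × (Fin m → ℝ) → X0) (x0init : X0) (y₀ : Y)
    (ν : ProbabilityMeasure (Strat Xset Uset Y Sset × PrimLoc Xset W)) : ℕ → (ℕ → Y) × X0
  | 0 => (fun _ => y₀, x0init)
  | t + 1 =>
      let p := mfEnv f g f0 x0init y₀ ν t
      let d := meanStat f ν p.1 t
      (Function.update p.1 t (g t p.2 d), f0 t p.2 d)

/-- Environment path generated by a population with law `ν`. -/
noncomputable def mfPath (f : ℕ → ↥Xset → ↥Uset → Y → W → ↥Xset)
    (g : ℕ → X0 → (Fin n → ℝ) × (Fin m → ℝ) → Y)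
    (f0 : ℕ → X0 → (Fin n → ℝ) × (Fin m → ℝ) → X0) (x0init : X0) (y₀ : Y)
    (ν : ProbabilityMeasure (Strat Xset Uset Y Sset × PrimLoc Xset W)) : ℕ → Y :=
  fun t => (mfEnv f g f0 x0init y₀ ν (t + 1)).1 t

end Environment

section Continuity

variable [MetricSpace W] [MetricSpace Y] [CompactSpace Y]
  [CompactSpace ↥Xset] [CompactSpace ↥Uset]
  {Sset : ∀ t : ℕ, Set C(Hist (↥Xset) (↥Uset) Y t, ↥Uset)}
  {f : ℕ → ↥Xset → ↥Uset → Y → W → ↥Xset}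

theorem continuous_state
    (hf : ∀ t, Continuous fun p : ↥Xset × ↥Uset × Y × W => f t p.1 p.2.1 p.2.2.1 p.2.2.2) (t : ℕ) :
    Continuous fun p : Strat Xset Uset Y Sset × (ℕ → Y) × PrimLoc Xset W =>
      (subjHist f p.1 p.2.1 p.2.2 t).1 (Fin.last t) :=
  (continuous_apply (Fin.last t)).comp (continuous_subjHist hf t).fst

theorem continuous_control
    (hf : ∀ t, Continuous fun p : ↥Xset × ↥Uset × Y × W => f t p.1 p.2.1 p.2.2.1 p.2.2.2) (t : ℕ) :
    Continuous fun p : Strat Xset Uset Y Sset × (ℕ → Y) × PrimLoc Xset W =>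
      (subjHist f p.1 p.2.1 p.2.2 (t + 1)).2 (Fin.last t) :=
  (continuous_apply (Fin.last t)).comp (continuous_subjHist hf (t + 1)).snd

variable [CompactSpace W] [MeasurableSpace W] [BorelSpace W]

instance instOpensMeasurableSpaceStratPrimLoc :
    OpensMeasurableSpace (Strat Xset Uset Y Sset × PrimLoc Xset W) :=
  inferInstance

theorem continuous_meanStat [∀ t, CompactSpace ↥(Sset t)]
    (hf : ∀ t, Continuous fun p : ↥Xset × ↥Uset × Y × W => f t p.1 p.2.1 p.2.2.1 p.2.2.2) (t : ℕ) :
    Continuous fun q : ProbabilityMeasure (Strat Xset Uset Y Sset × PrimLoc Xset W) × (ℕ → Y) =>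
      meanStat f q.1 q.2 t := by
  have hswap : Continuous fun r : (ℕ → Y) × (Strat Xset Uset Y Sset × PrimLoc Xset W) =>
      (r.2.1, r.1, r.2.2) := by fun_prop
  refine (continuous_pi fun j => ?_).prodMk (continuous_pi fun j => ?_)
  · exact continuous_integral_prod ((continuous_apply j).comp
      (continuous_subtype_val.comp ((continuous_state hf t).comp hswap)))
  · exact continuous_integral_prod ((continuous_apply j).comp
      (continuous_subtype_val.comp ((continuous_control hf t).comp hswap)))

variable {g : ℕ → X0 → (Fin n → ℝ) × (Fin m → ℝ) → Y}
  {f0 : ℕ → X0 → (Fin n → ℝ) × (Fin m → ℝ) → X0}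

theorem continuous_mfEnv [TopologicalSpace X0] [∀ t, CompactSpace ↥(Sset t)]
    (hf : ∀ t, Continuous fun p : ↥Xset × ↥Uset × Y × W => f t p.1 p.2.1 p.2.2.1 p.2.2.2)
    (hg : ∀ t, Continuous fun p : X0 × ((Fin n → ℝ) × (Fin m → ℝ)) => g t p.1 p.2)
    (hf0 : ∀ t, Continuous fun p : X0 × ((Fin n → ℝ) × (Fin m → ℝ)) => f0 t p.1 p.2)
    (x0init : X0) (y₀ : Y) (t : ℕ) :
    Continuous fun ν : ProbabilityMeasure (Strat Xset Uset Y Sset × PrimLoc Xset W) =>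
      mfEnv f g f0 x0init y₀ ν t := by
  induction t with
  | zero => exact continuous_const
  | succ t ih =>
    have hd := ih.snd.prodMk ((continuous_meanStat hf t).comp (continuous_id.prodMk ih.fst))
    exact (ih.fst.update t ((hg t).comp hd)).prodMk ((hf0 t).comp hd)

theorem continuous_mfPath [TopologicalSpace X0] [∀ t, CompactSpace ↥(Sset t)]
    (hf : ∀ t, Continuous fun p : ↥Xset × ↥Uset × Y × W => f t p.1 p.2.1 p.2.2.1 p.2.2.2)
    (hg : ∀ t, Continuous fun p : X0 × ((Fin n → ℝ) × (Fin m → ℝ)) => g t p.1 p.2)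
    (hf0 : ∀ t, Continuous fun p : X0 × ((Fin n → ℝ) × (Fin m → ℝ)) => f0 t p.1 p.2)
    (x0init : X0) (y₀ : Y) :
    Continuous fun ν : ProbabilityMeasure (Strat Xset Uset Y Sset × PrimLoc Xset W) =>
      mfPath f g f0 x0init y₀ ν :=
  continuous_pi fun t =>
    (continuous_apply t).comp (continuous_mfEnv hf hg hf0 x0init y₀ (t + 1)).fst

/-- Against an empirical measure, the mean state and control are the simple averages. -/
theorem meanStat_empiricalMeasure
    (hf : ∀ t, Continuous fun p : ↥Xset × ↥Uset × Y × W => f t p.1 p.2.1 p.2.2.1 p.2.2.2)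
    {N : ℕ} (s : Fin (N + 1) → Strat Xset Uset Y Sset) (ω : Fin (N + 1) → PrimLoc Xset W)
    (Z : ℕ → Y) (t : ℕ) :
    meanStat f (empiricalMeasure fun i => (s i, ω i)) Z t =
      davg (fun i => (subjHist f (s i) Z (ω i) t).1 (Fin.last t))
        (fun i => (subjHist f (s i) Z (ω i) (t + 1)).2 (Fin.last t)) := by
  have hswap : Continuous fun e : Strat Xset Uset Y Sset × PrimLoc Xset W =>
      (e.1, Z, e.2) := by fun_prop
  refine Prod.ext (funext fun j => ?_) (funext fun j => ?_)
  · refine (integral_empiricalMeasure _ (Continuous.stronglyMeasurable ((continuous_apply j).comp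
      (continuous_subtype_val.comp ((continuous_state hf t).comp hswap))))).trans ?_
    simp [davg]
  · refine (integral_empiricalMeasure _ (Continuous.stronglyMeasurable ((continuous_apply j).comp
      (continuous_subtype_val.comp ((continuous_control hf t).comp hswap))))).trans ?_
    simp [davg]

theorem sysHist_eq_mfEnv
    (hf : ∀ t, Continuous fun p : ↥Xset × ↥Uset × Y × W => f t p.1 p.2.1 p.2.2.1 p.2.2.2)
    (x0init : X0) (y₀ : Y) {N : ℕ} (s : Fin (N + 1) → Strat Xset Uset Y Sset)
    (ω : Fin (N + 1) → PrimLoc Xset W) (t : ℕ) :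
    sysHist f g f0 x0init s ω t =
      (fun i => subjHist f (s i) (mfEnv f g f0 x0init y₀ (empiricalMeasure fun i => (s i, ω i)) t).1
          (ω i) t,
        fun k : Fin t => (mfEnv f g f0 x0init y₀ (empiricalMeasure fun i => (s i, ω i)) t).1 k,
        (mfEnv f g f0 x0init y₀ (empiricalMeasure fun i => (s i, ω i)) t).2) := by
  induction t with
  | zero => exact Prod.ext rfl (Prod.ext (funext fun k => k.elim0) rfl)
  | succ t ih =>
    set ν := empiricalMeasure fun i => (s i, ω i) with hν
    set p := mfEnv f g f0 x0init y₀ ν t with hp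
    have hd := meanStat_empiricalMeasure hf s ω p.1 t
    simp only [subjHist_succ_control] at hd
    have hpast : ∀ (y : Y), ∀ k < t, Function.update p.1 t y k = p.1 k := fun y k hk =>
      Function.update_of_ne hk.ne _ _
    have hpast' : ∀ (y : Y), (fun k : Fin t => Function.update p.1 t y k) = fun k : Fin t => p.1 k :=
      fun y => funext fun k => hpast y k k.2
    simp only [sysHist, ih, mfEnv, ← hp, ← hd, ← hν, subjHist]
    refine Prod.ext (funext fun i => ?_) (Prod.ext (funext fun k => ?_) rfl)
    · simp only [subjHist_congr (s i) (ω i) (hpast _), hpast', Function.update_self]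
    · refine Fin.lastCases ?_ (fun k => ?_) k
      · simp
      · simp [hpast _ _ k.2]

/-- The environment path of the finite game is generated by the empirical measure. -/
theorem yPath_eq_mfPath
    (hf : ∀ t, Continuous fun p : ↥Xset × ↥Uset × Y × W => f t p.1 p.2.1 p.2.2.1 p.2.2.2)
    (x0init : X0) (y₀ : Y) {N : ℕ} (s : Fin (N + 1) → Strat Xset Uset Y Sset)
    (ω : Fin (N + 1) → PrimLoc Xset W) :
    yPath f g f0 x0init s ω =
      mfPath f g f0 x0init y₀ (empiricalMeasure fun i => (s i, ω i)) :=
  funext fun t => by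
    rw [yPath, sysHist_eq_mfEnv hf x0init y₀]
    rfl

end Continuity

section Cost

theorem norm_discounted_cost_le {c : ℕ → ↥Xset → ↥Uset → Y → ℝ} {β cbar : ℝ}
    (hcb : ∀ t x u y, |c t x u y| ≤ cbar) (hβ0 : 0 ≤ β)
    (t : ℕ) (x : ↥Xset) (u : ↥Uset) (y : Y) : ‖β ^ t * c t x u y‖ ≤ β ^ t * cbar := by
  rw [norm_mul, Real.norm_of_nonneg (pow_nonneg hβ0 t)]
  exact mul_le_mul_of_nonneg_left (hcb t x u y) (pow_nonneg hβ0 t)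

variable [MetricSpace Y] {Sset : ∀ t : ℕ, Set C(Hist (↥Xset) (↥Uset) Y t, ↥Uset)}
  {f : ℕ → ↥Xset → ↥Uset → Y → W → ↥Xset} {c : ℕ → ↥Xset → ↥Uset → Y → ℝ} {β cbar : ℝ}
  [MeasurableSpace W] (μloc : Measure (PrimLoc Xset W)) [IsProbabilityMeasure μloc]

theorem abs_subjCost_le (hcb : ∀ t x u y, |c t x u y| ≤ cbar) (hβ0 : 0 ≤ β) (hβ1 : β < 1)
    (si : Strat Xset Uset Y Sset) (Z : ℕ → Y) :
    |subjCost μloc f c β si Z| ≤ (1 - β)⁻¹ * cbar := by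
  have hbound : ∀ ωi : PrimLoc Xset W, ‖∑' t : ℕ, β ^ t *
      c t ((subjHist f si Z ωi t).1 (Fin.last t))
        ((subjHist f si Z ωi (t + 1)).2 (Fin.last t)) (Z t)‖ ≤ (1 - β)⁻¹ * cbar := fun ωi =>
    tsum_of_norm_bounded ((hasSum_geometric_of_lt_one hβ0 hβ1).mul_right cbar)
      fun t => norm_discounted_cost_le hcb hβ0 _ _ _ _
  refine (norm_integral_le_of_norm_le_const (μ := μloc) (Eventually.of_forall hbound)).trans_eq ?_
  rw [probReal_univ, mul_one]

variable [CompactSpace Y] [MetricSpace W] [CompactSpace W] [BorelSpace W] [CompactSpace ↥Xset]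
  [CompactSpace ↥Uset]

theorem continuous_subjCost
    (hf : ∀ t, Continuous fun p : ↥Xset × ↥Uset × Y × W => f t p.1 p.2.1 p.2.2.1 p.2.2.2)
    (hc : ∀ t, Continuous fun p : ↥Xset × ↥Uset × Y => c t p.1 p.2.1 p.2.2)
    (hcb : ∀ t x u y, |c t x u y| ≤ cbar) (hβ0 : 0 ≤ β) (hβ1 : β < 1) :
    Continuous fun p : Strat Xset Uset Y Sset × (ℕ → Y) => subjCost μloc f c β p.1 p.2 := by
  have hterm : Continuous fun p : Strat Xset Uset Y Sset × (ℕ → Y) × PrimLoc Xset W =>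
      ∑' t : ℕ, β ^ t * c t ((subjHist f p.1 p.2.1 p.2.2 t).1 (Fin.last t))
        ((subjHist f p.1 p.2.1 p.2.2 (t + 1)).2 (Fin.last t)) (p.2.1 t) := by
    refine continuous_tsum (fun t => continuous_const.mul ((hc t).comp
      ((continuous_state hf t).prodMk ((continuous_control hf t).prodMk (by fun_prop)))))
      ((summable_geometric_of_lt_one hβ0 hβ1).mul_right cbar)
      fun t p => norm_discounted_cost_le hcb hβ0 _ _ _ _
  have hswap : Continuous fun r : (Strat Xset Uset Y Sset × (ℕ → Y)) × PrimLoc Xset W =>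
      (r.1.1, r.1.2, r.2) := by fun_prop
  let ν : ProbabilityMeasure (PrimLoc Xset W) := ⟨μloc, inferInstance⟩
  exact (continuous_integral_prod (hterm.comp hswap)).comp
    ((continuous_const (y := ν)).prodMk continuous_id)

end Cost

end MeanField

end SEBEU5

/-- A compact family of continuous functions on a compact space has a finite uniform net. -/
theorem exists_finite_uniform_net {S T : Type*} [TopologicalSpace S] [CompactSpace S]
    [TopologicalSpace T] [CompactSpace T] {J : S → T → ℝ}
    (hJ : Continuous fun p : S × T => J p.1 p.2) {δ : ℝ} (hδ : 0 < δ) :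
    ∃ F : Finset S, ∀ s, ∃ k ∈ F, ∀ z, |J k z - J s z| ≤ δ := by
  let Φ : C(S, C(T, ℝ)) := ContinuousMap.curry ⟨_, hJ⟩
  obtain ⟨F, -, hF⟩ := isCompact_univ.elim_nhds_subcover
    (fun s => Φ ⁻¹' Metric.ball (Φ s) δ)
    fun s _ => Φ.continuous.continuousAt.preimage_mem_nhds (Metric.ball_mem_nhds _ hδ)
  refine ⟨F, fun s => ?_⟩
  obtain ⟨k, hk, hsk⟩ := Set.mem_iUnion₂.1 (hF (Set.mem_univ s))
  refine ⟨k, hk, fun z => ?_⟩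
  have h1 : dist (Φ s z) (Φ k z) ≤ dist (Φ s) (Φ k) := ContinuousMap.dist_apply_le_dist z
  rw [abs_sub_comm]
  exact h1.trans (Metric.mem_ball.1 hsk).le

open SEBEU5 in
/-- under Assumptions 4.1 and 4.2, for every `ε > 0` the game `G^N` possesses
an `ε`-SEBEU in pure strategies once `N` is sufficiently large. -/
theorem exists_eps_SEBEU_pure_in_large_games
    {n m : ℕ} (Xset : Set (Fin n → ℝ)) (Uset : Set (Fin m → ℝ))
    (X0 W Y : Type)
    [CompactSpace ↥Xset] [Nonempty ↥Xset]
    [CompactSpace ↥Uset] [Nonempty ↥Uset]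
    [MetricSpace X0] [CompactSpace X0] [Nonempty X0]
    [MetricSpace W] [CompactSpace W] [Nonempty W]
    [MetricSpace Y] [CompactSpace Y] [Nonempty Y]
    [MeasurableSpace W] [BorelSpace W] [MeasurableSpace Y] [BorelSpace Y]
    (f : ℕ → ↥Xset → ↥Uset → Y → W → ↥Xset)
    (g : ℕ → X0 → (Fin n → ℝ) × (Fin m → ℝ) → Y)
    (f0 : ℕ → X0 → (Fin n → ℝ) × (Fin m → ℝ) → X0)
    (x0init : X0)
    (c : ℕ → ↥Xset → ↥Uset → Y → ℝ) (β : ℝ)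
    -- Assumption 4.1, Condition 1 (Assumption 3.1, identical DMs)
    (hf : ∀ t, Continuous fun p : ↥Xset × ↥Uset × Y × W => f t p.1 p.2.1 p.2.2.1 p.2.2.2)
    (hg : ∀ t, Continuous fun p : X0 × ((Fin n → ℝ) × (Fin m → ℝ)) => g t p.1 p.2)
    (hf0 : ∀ t, Continuous fun p : X0 × ((Fin n → ℝ) × (Fin m → ℝ)) => f0 t p.1 p.2)
    (hc : ∀ t, Continuous fun p : ↥Xset × ↥Uset × Y => c t p.1 p.2.1 p.2.2)
    (Sset : ∀ t : ℕ, Set C(Hist (↥Xset) (↥Uset) Y t, ↥Uset))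
    (hScpt : ∀ t, IsCompact (Sset t)) (hSne : ∀ t, (Sset t).Nonempty)
    (cbar : ℝ) (hcb : ∀ t x u y, |c t x u y| ≤ cbar)
    (hβ0 : 0 ≤ β) (hβ1 : β < 1)
    -- Assumption 4.1, Condition 2 for the simple averages (automatically satisfied)
    (hd1 : ∀ (ε : ℝ), 0 < ε → ∃ δ : ℝ, 0 < δ ∧
      ∀ (N : ℕ) (x u x' u'),
        (∀ i : Fin N, dist ((x i, u i) : ↥Xset × ↥Uset) (x' i, u' i) < δ) →
        dist (davg x u) (davg x' u') < ε)
    (hd2 : ∀ (ε : ℝ), 0 < ε → ∃ N0 : ℕ, ∀ N : ℕ, N0 ≤ N →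
      ∀ (i : Fin N) (x x' : Fin N → ↥Xset) (u u' : Fin N → ↥Uset),
        (∀ j : Fin N, j ≠ i → x j = x' j ∧ u j = u' j) →
        dist (davg x u) (davg x' u') < ε)
    -- Assumption 4.1, Condition 3 and Assumption 4.2 (i.i.d. local randomness)
    (μloc : Measure (PrimLoc Xset W)) [IsProbabilityMeasure μloc] :
    ∀ ε : ℝ, 0 < ε → ∃ Nhat : ℕ, ∀ N : ℕ, Nhat ≤ N →
      ∃ s : Fin N → Strat Xset Uset Y Sset,
        ∀ (i : Fin N) (γtil : ProbabilityMeasure (Strat Xset Uset Y Sset)),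
          (∫ Z, subjCost μloc f c β (s i) Z
              ∂(Measure.map (yPath f g f0 x0init s) (jointLaw μloc N))) ≤
            (∫ si, ∫ Z, subjCost μloc f c β si Z
                ∂(Measure.map (yPath f g f0 x0init s) (jointLaw μloc N))
              ∂(γtil : Measure (Strat Xset Uset Y Sset))) + ε := by
  have : ∀ t, CompactSpace ↥(Sset t) := fun t => isCompact_iff_compactSpace.1 (hScpt t)
  have : ∀ t, Nonempty ↥(Sset t) := fun t => (hSne t).to_subtype
  intro ε hε
  obtain ⟨y₀⟩ := ‹Nonempty Y›
  have hJ := continuous_subjCost (Sset := Sset) μloc hf hc hcb hβ0 hβ1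
  have hJB := abs_subjCost_le (Sset := Sset) (f := f) μloc hcb hβ0 hβ1
  have hpath := continuous_mfPath (Sset := Sset) hf hg hf0 x0init y₀
  -- a finite set of strategies that is enough up to `ε / 4`
  obtain ⟨F, hF⟩ := exists_finite_uniform_net hJ (show 0 < ε / 4 by positivity)
  have : Nonempty F := by
    obtain ⟨k, hk, -⟩ := hF (Classical.arbitrary _)
    exact ⟨⟨k, hk⟩⟩
  let σ : F → Strat Xset Uset Y Sset := Subtype.val
  -- the cost of each of these strategies, as a function of the law of the population
  let G : F → ProbabilityMeasure (Strat Xset Uset Y Sset × PrimLoc Xset W) → ℝ :=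
    fun k ν => subjCost μloc f c β (σ k) (mfPath f g f0 x0init y₀ ν)
  have hG : ∀ k, Continuous (G k) := fun k => hJ.comp (continuous_const.prodMk hpath)
  obtain ⟨v, hv⟩ : ∃ v : stdSimplex ℝ F, ∀ j, 0 < v.1 j →
      ∀ k, G j (mixtureProd σ μloc v) ≤ G k (mixtureProd σ μloc v) := by
    classical
    let J : F → (F → ℝ) → ℝ := fun k w =>
      if hw : w ∈ stdSimplex ℝ F then G k (mixtureProd σ μloc ⟨w, hw⟩) else 0
    have hJeq : ∀ k (w : stdSimplex ℝ F), J k w.1 = G k (mixtureProd σ μloc w) := fun k w =>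
      dif_pos w.2
    obtain ⟨w, hw, hmin⟩ := exists_population_equilibrium J fun k =>
      continuousOn_iff_continuous_domRestrict.2
        (((hG k).comp (continuous_mixtureProd σ μloc)).congr fun w => (hJeq k w).symm)
    refine ⟨⟨w, hw⟩, fun j hj k => ?_⟩
    rw [← hJeq, ← hJeq]
    exact hmin j hj k
  obtain ⟨a, hapos, ha⟩ := exists_profile_approximating v
  have hlim : ∀ᶠ N : ℕ in Filter.atTop, ∀ k : F,
      |(∫ ω, G k (empiricalMeasure fun i => (σ (a N i), ω i)) ∂jointLaw μloc (N + 1)) -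
        G k (mixtureProd σ μloc v)| < ε / 4 := by
    refine Filter.eventually_all.2 fun k => ?_
    exact (Metric.tendsto_nhds.1 (tendsto_integral_comp_empiricalMeasure σ μloc v ha (hG k)
      fun ν => hJB _ _)) _ (by positivity)
  obtain ⟨N₀, hN₀⟩ := Filter.eventually_atTop.1 hlim
  refine ⟨N₀ + 1, fun N hN => ?_⟩
  obtain ⟨N, rfl⟩ : ∃ N', N = N' + 1 := ⟨N - 1, by omega⟩
  specialize hN₀ N (by omega)
  let s : Fin (N + 1) → Strat Xset Uset Y Sset := fun i => σ (a N i)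
  refine ⟨s, fun i γtil => ?_⟩
  have hyPath : yPath f g f0 x0init s = fun ω =>
      mfPath f g f0 x0init y₀ (empiricalMeasure fun i => (s i, ω i)) :=
    funext (yPath_eq_mfPath hf x0init y₀ s)
  have hyc : Continuous (yPath f g f0 x0init s) := by
    rw [hyPath]
    exact hpath.comp (continuous_empiricalMeasure_prod s)
  have : IsProbabilityMeasure (jointLaw μloc (N + 1)) := by
    rw [jointLaw]
    infer_instance
  set ζ := Measure.map (yPath f g f0 x0init s) (jointLaw μloc (N + 1)) with hζ
  have : IsProbabilityMeasure ζ := Measure.isProbabilityMeasure_map hyc.measurable.aemeasurable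
  have hJs : ∀ si : Strat Xset Uset Y Sset, Continuous (subjCost μloc f c β si) := fun si =>
    hJ.comp (continuous_const.prodMk continuous_id)
  have hint : ∀ si : Strat Xset Uset Y Sset, Integrable (subjCost μloc f c β si) ζ := fun si =>
    Integrable.of_bound (hJs si).stronglyMeasurable.aestronglyMeasurable _
      (Filter.Eventually.of_forall (hJB si))
  have hdev : ∀ k : F, |(∫ Z, subjCost μloc f c β (σ k) Z ∂ζ) - G k (mixtureProd σ μloc v)| <
      ε / 4 := by
    intro k
    rw [hζ, integral_map hyc.measurable.aemeasurable
      (hJs _).stronglyMeasurable.aestronglyMeasurable, hyPath]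
    exact hN₀ k
  have hbest : ∀ si : Strat Xset Uset Y Sset,
      (∫ Z, subjCost μloc f c β (s i) Z ∂ζ) - ε ≤ ∫ Z, subjCost μloc f c β si Z ∂ζ := by
    intro si
    obtain ⟨k, hk, hnet⟩ := hF si
    have hle : ∫ Z, subjCost μloc f c β k Z ∂ζ ≤ (∫ Z, subjCost μloc f c β si Z ∂ζ) + ε / 4 := by
      calc ∫ Z, subjCost μloc f c β k Z ∂ζ
          ≤ ∫ Z, (subjCost μloc f c β si Z + ε / 4) ∂ζ :=
            integral_mono (hint k) ((hint si).add (integrable_const _)) fun Z => by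
              have := (abs_le.1 (hnet Z)).2
              simp only
              linarith
        _ = (∫ Z, subjCost μloc f c β si Z ∂ζ) + ε / 4 := by
            rw [integral_add (hint si) (integrable_const _)]
            simp
    have hi := abs_lt.1 (hdev (a N i))
    have hk' := abs_lt.1 (hdev ⟨k, hk⟩)
    have hopt := hv (a N i) (hapos N i) ⟨k, hk⟩
    change (∫ Z, subjCost μloc f c β (σ (a N i)) Z ∂ζ) - ε ≤ _
    change _ < (∫ Z, subjCost μloc f c β k Z ∂ζ) - _ ∧ _ at hk'
    linarith [hi.2, hk'.1]
  let ζP : ProbabilityMeasure (ℕ → Y) := ⟨ζ, inferInstance⟩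
  have hcont : Continuous fun si : Strat Xset Uset Y Sset => ∫ Z, subjCost μloc f c β si Z ∂ζ :=
    (continuous_integral_prod hJ).comp
      ((continuous_const (y := ζP)).prodMk continuous_id)
  have hcontint : Integrable (fun si : Strat Xset Uset Y Sset => ∫ Z, subjCost μloc f c β si Z ∂ζ)
      (γtil : Measure (Strat Xset Uset Y Sset)) :=
    (BoundedContinuousFunction.mkOfCompact ⟨_, hcont⟩).integrable _
  have hmix := integral_mono (integrable_const _) hcontint hbest
  rw [integral_const, probReal_univ, one_smul] at hmix
  linarith
end

section
/- In the single-stage consumption game with N ≥ 1 consumers, a pure strategy profile u = (u^1,…,u^N) ∈ {0,1,2}^N is a (pure-strategy) Nash equilibrium if and only if either u^1 = u^2 = … = u^N = 1, or the average consumption equals 1 − 1/N, i.e., Σ_{j=1}^N u^j = N − 1. Here the Nash condition is: for every i ∈ [1,N] and every v ∈ {0,1,2}, u^i·y(u) − u^i ≤ v·y(v, u^{−i}) − v, where y(v, u^{−i}) := (v + Σ_{j≠i} u^j)/N. -/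
/-- With `S` the total consumption and `D = N - S`, a deviation from `a` to `v` does not pay
iff `(v - a) * (v - D)` is nonnegative. -/
lemma deviation_iff {n : ℝ} (hn : 0 < n) (a v S : ℝ) :
    a * (S / n) - a ≤ v * ((v + (S - a)) / n) - v ↔ 0 ≤ (v - a) * (v - (n - S)) := by
  have key : v * ((v + (S - a)) / n) - v - (a * (S / n) - a) = (v - a) * (v - (n - S)) / n := by
    field_simp
    ring
  rw [← sub_nonneg, key, le_div_iff₀ hn, zero_mul]

/-- A finite sum of reals, each equal to `0`, `1` or `2`, is an integer. -/
lemma exists_int_eq_sum {ι : Type*} [Fintype ι] (u : ι → ℝ)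
    (hu : ∀ i, u i = 0 ∨ u i = 1 ∨ u i = 2) : ∃ s : ℤ, ∑ j, u j = s := by
  have hz : ∀ i, ∃ z : ℤ, u i = z := fun i => by
    rcases hu i with h | h | h
    · exact ⟨0, by simp [h]⟩
    · exact ⟨1, by simp [h]⟩
    · exact ⟨2, by simp [h]⟩
  choose z hz using hz
  exact ⟨∑ j, z j, by simp [hz]⟩

/-- Single-stage consumption game with `N ≥ 1` consumers, levels in `{0,1,2}`,
price `y(u) = (∑ j, u j)/N`, net cost `u i * y - u i`.  A pure strategy profile is a Nash
equilibrium (each consumer accounts for the effect of its own consumption on the price) iff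
either all consumption levels equal one, or the total consumption equals `N - 1`. -/
theorem nash_iff_all_one_or_sum_N_sub_one (N : ℕ) (hN : 1 ≤ N) (u : Fin N → ℝ)
    (hu : ∀ i, u i = 0 ∨ u i = 1 ∨ u i = 2) :
    (∀ i : Fin N, ∀ v : ℝ, (v = 0 ∨ v = 1 ∨ v = 2) →
        u i * ((∑ j, u j) / N) - u i ≤
          v * ((v + ∑ j ∈ Finset.univ.erase i, u j) / N) - v)
      ↔ ((∀ i, u i = 1) ∨ (∑ j, u j) = (N : ℝ) - 1) := by
  have hn : (0 : ℝ) < N := by exact_mod_cast hN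
  have herase : ∀ i, ∑ j ∈ Finset.univ.erase i, u j = ∑ j, u j - u i := fun i =>
    Finset.sum_erase_eq_sub (Finset.mem_univ i)
  have hone : ∑ _j : Fin N, (1 : ℝ) = N := by simp
  simp only [herase, deviation_iff hn]
  constructor
  · intro h
    rcases lt_trichotomy (∑ j, u j) ((N : ℝ) - 1) with hlt | heq | hgt
    · have hle : ∀ i, 1 ≤ u i := fun i => by
        rcases hu i with h0 | h1 | h2
        · have := h i 1 (by simp)
          rw [h0] at this
          linarith
        · exact h1.ge
        · linarith
      have hsum := Finset.sum_le_sum fun i (_ : i ∈ Finset.univ) => hle i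
      linarith
    · exact Or.inr heq
    · left
      have hle : ∀ i, u i ≤ 1 := fun i => by
        rcases hu i with h0 | h1 | h2
        · linarith
        · exact h1.le
        · have := h i 1 (by simp)
          rw [h2] at this
          linarith
      have hsum := Finset.sum_le_sum fun i (_ : i ∈ Finset.univ) => hle i
      have hge : (N : ℝ) ≤ ∑ j, u j := by
        obtain ⟨s, hs⟩ := exists_int_eq_sum u hu
        rw [hs] at hgt ⊢
        have : (N : ℤ) - 1 < s := by exact_mod_cast hgt
        exact_mod_cast Int.sub_one_lt_iff.mp this
      have heq : ∑ j, u j = ∑ _j : Fin N, (1 : ℝ) := by linarith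
      intro i
      exact (Finset.sum_eq_sum_iff_of_le fun i _ => hle i).mp heq i (Finset.mem_univ i)
  · rintro (h | h) i v hv
    · have hS : ∑ j, u j = N := by simp [h]
      rw [hS, h i]
      rcases hv with rfl | rfl | rfl <;> norm_num
    · rw [h]
      rcases hv with rfl | rfl | rfl <;> rcases hu i with h0 | h0 | h0 <;> rw [h0] <;> norm_num
end

section
/- In the single-stage consumption game with N ≥ 1 consumers, a pure strategy profile u = (u^1,…,u^N) ∈ {0,1,2}^N is a pure-strategy subjective equilibrium in the sense of Kalai–Lehrer if and only if the average consumption is not higher than one, i.e., (1/N)Σ_{j=1}^N u^j ≤ 1. Precisely: there exist, for each consumer i and each action v ∈ {0,1,2}, subjective conditional beliefs ζ_v^i (probability mass functions on the finite price set Y_N = {k/N : 0 ≤ k ≤ 2N}) such that (a) ζ_{u^i}^i is the point mass at the true price y(u) = (1/N)Σ_j u^j (consistency conditioned on the action actually played), and (b) for every i and every v ∈ {0,1,2}, u^i·y(u) − u^i ≤ v·E^{ζ_v^i}[y] − v (optimality against the subjective conditional beliefs) — if and only if y(u) ≤ 1. -/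
/-- The total of a profile with levels in `{0,1,2}` is a natural number at most `2N`. -/
theorem exists_fin_eq_sum_consumption {N : ℕ} (u : Fin N → ℝ)
    (hu : ∀ i, u i = 0 ∨ u i = 1 ∨ u i = 2) :
    ∃ m : Fin (2 * N + 1), ((m : ℕ) : ℝ) = ∑ j, u j := by
  have hlevel : ∀ i, ∃ n : ℕ, n ≤ 2 ∧ (n : ℝ) = u i := by
    intro i
    rcases hu i with h | h | h
    · exact ⟨0, by norm_num, by simp [h]⟩
    · exact ⟨1, by norm_num, by simp [h]⟩
    · exact ⟨2, le_rfl, by simp [h]⟩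
  choose n hn hnu using hlevel
  have hsum : ∑ j, n j ≤ 2 * N := by
    calc ∑ j, n j ≤ ∑ _j : Fin N, 2 := Finset.sum_le_sum fun j _ => hn j
      _ = 2 * N := by simp [mul_comm]
  exact ⟨⟨∑ j, n j, Nat.lt_succ_of_le hsum⟩, by simp [hnu]⟩

/-- Single-stage consumption game with `N ≥ 1` consumers, levels in `{0,1,2}`,
price `y(u) = (∑ j, u j)/N` taking values in `Y_N = {k/N : 0 ≤ k ≤ 2N}`, net cost
`u i * y - u i`.  A pure strategy profile is a Kalai–Lehrer subjective equilibrium — i.e.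
there exist subjective conditional beliefs `ζ i v` (probability mass functions on `Y_N`,
indexed by consumer `i` and action `v ∈ {0,1,2}`) such that
(a) the belief conditioned on the action actually played is the point mass at the true
price, and (b) each consumer's action is optimal in expected cost against its own
conditional beliefs — iff the average consumption is not higher than one. -/
theorem kalai_lehrer_iff_average_le_one (N : ℕ) (hN : 1 ≤ N) (u : Fin N → ℝ)
    (hu : ∀ i, u i = 0 ∨ u i = 1 ∨ u i = 2) :
    (∃ ζ : Fin N → ℝ → (Fin (2 * N + 1) → ℝ),
      (∀ i : Fin N, ∀ v : ℝ, (v = 0 ∨ v = 1 ∨ v = 2) →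
          (∀ k, 0 ≤ ζ i v k) ∧ (∑ k, ζ i v k) = 1) ∧
      (∀ i : Fin N, ∀ k : Fin (2 * N + 1),
          ζ i (u i) k = if (k : ℝ) / N = (∑ j, u j) / N then 1 else 0) ∧
      (∀ i : Fin N, ∀ v : ℝ, (v = 0 ∨ v = 1 ∨ v = 2) →
          u i * ((∑ j, u j) / N) - u i ≤
            v * (∑ k, ζ i v k * ((k : ℝ) / N)) - v))
      ↔ (∑ j, u j) / N ≤ 1 := by
  have hN0 : (N : ℝ) ≠ 0 := by exact_mod_cast (by omega : N ≠ 0)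
  have hu0 : ∀ i, 0 ≤ u i := fun i => by rcases hu i with h | h | h <;> norm_num [h]
  constructor
  · rintro ⟨ζ, -, -, hopt⟩
    by_contra! hlt
    have hzero : ∀ i, u i = 0 := fun i => by
      have h := hopt i 0 (Or.inl rfl)
      nlinarith [hu0 i]
    norm_num [hzero] at hlt
  · intro hle
    obtain ⟨m, hm⟩ := exists_fin_eq_sum_consumption u hu
    refine ⟨fun i v => Pi.single (if v = u i then m else Fin.last (2 * N)) 1, ?_, ?_, ?_⟩
    · intro i v _
      refine ⟨fun k => ?_, by simp⟩
      simp only [Pi.single_apply]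
      split_ifs <;> norm_num
    · intro i k
      simp only [if_true, Pi.single_apply, ← hm, div_left_inj' hN0, Nat.cast_inj, Fin.ext_iff]
    · intro i v hv
      simp only [Pi.single_apply, ite_mul, one_mul, zero_mul, Finset.sum_ite_eq',
        Finset.mem_univ, if_true]
      split_ifs with h
      · rw [hm, h]
      · have hv0 : 0 ≤ v := by rcases hv with h | h | h <;> norm_num [h]
        have hlast : (((Fin.last (2 * N) : Fin (2 * N + 1)) : ℕ) : ℝ) / N = 2 := by
          simp [hN0]
        rw [hlast]
        nlinarith [mul_nonneg (hu0 i) (sub_nonneg.2 hle)]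
end

section
/- In the single-stage consumption game with N ≥ 1 consumers, every pure-strategy SEBEU is a (1/N)-Nash equilibrium: if u = (u^1,…,u^N) ∈ {0,1,2}^N satisfies (1/N)Σ_{j=1}^N u^j = 1, then for every i ∈ [1,N] and every deviation v ∈ {0,1,2}, u^i·y(u) − u^i ≤ v·y(v, u^{−i}) − v + 1/N, where y(u) = (1/N)Σ_j u^j = 1 and y(v, u^{−i}) = (v + Σ_{j≠i}u^j)/N; equivalently, 0 ≤ v·((v + Σ_{j≠i}u^j)/N − 1) + 1/N. That is, a consumer who accounts for the effect of its own consumption on the price can reduce its cost by at most 1/N by unilaterally deviating from an SEBEU. -/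
/-- Single-stage consumption game with `N ≥ 1` consumers, levels in `{0,1,2}`,
price `y(u) = (∑ j, u j)/N`, net cost `u i * y - u i`.  Every pure-strategy SEBEU
(a profile with average consumption equal to one) is a `(1/N)`-Nash equilibrium:
a consumer who accounts for the effect of its own consumption on the price gains at most
`1/N` by unilaterally deviating. -/
theorem sebeu_is_one_over_N_nash (N : ℕ) (hN : 1 ≤ N) (u : Fin N → ℝ)
    (hu : ∀ i, u i = 0 ∨ u i = 1 ∨ u i = 2)
    (havg : (∑ j, u j) / N = 1) :
    ∀ i : Fin N, ∀ v : ℝ, (v = 0 ∨ v = 1 ∨ v = 2) →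
      u i * ((∑ j, u j) / N) - u i ≤
        v * ((v + ∑ j ∈ Finset.univ.erase i, u j) / N) - v + 1 / N := by
  intro i v hv
  have hNpos : (0 : ℝ) < N := by exact_mod_cast hN
  have hsum : ∑ j, u j = N := by rwa [div_eq_one_iff_eq hNpos.ne'] at havg
  have herase : ∑ j ∈ Finset.univ.erase i, u j = N - u i := by
    rw [← hsum, ← Finset.add_sum_erase _ u (Finset.mem_univ i)]
    ring
  have hgain : v * ((v + (N - u i)) / N) - v + 1 / N = (v * (v - u i) + 1) / N := by
    field_simp
    ring
  rw [havg, herase, hgain, mul_one, sub_self]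
  apply div_nonneg _ hNpos.le
  rcases hu i with h | h | h <;> rcases hv with rfl | rfl | rfl <;> rw [h] <;> norm_num
end

section
/- For the two-stage scalar LQ example, the determinant condition holds: with q > 0, r > 0, a, b ∈ ℝ and the derived quantities m_2 = q, f_1 = −bqa/(r + qb²), m_1 = q + rqa²/(r + qb²), g_{1,1} = −1/(r + qb²), g_{0,0} = −1/(r + m_1 b²), g_{0,1} = −b f_1/(r + m_1 b²), one has (1 − g_{0,0})(1 − f_1 b g_{0,1} − g_{1,1}) − f_1 b g_{0,0} g_{0,1} > 0. (Consequently the 2×2 linear system [[1 − g_{0,0}, −g_{0,1}],[−f_1 b g_{0,0}, 1 − f_1 b g_{0,1} − g_{1,1}]]·(E[y_0], E[y_1])ᵀ = 0 forces E[y_0] = E[y_1] = 0.) -/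
/-- Two-stage scalar LQ example: with `q > 0`, `r > 0`, `a b : ℝ` and the
derived quantities `m₂ = q`, `f₁ = -bqa/(r+qb²)`, `m₁ = q + rqa²/(r+qb²)`,
`g₁₁ = -1/(r+qb²)`, `g₀₀ = -1/(r+m₁b²)`, `g₀₁ = -b f₁/(r+m₁b²)`, the determinant condition
`(1 - g₀₀)(1 - f₁ b g₀₁ - g₁₁) - f₁ b g₀₀ g₀₁ > 0` holds; consequently the 2×2 linear
system `[[1-g₀₀, -g₀₁],[-f₁bg₀₀, 1-f₁bg₀₁-g₁₁]]·(E[y₀],E[y₁])ᵀ = 0` forces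
`E[y₀] = E[y₁] = 0`. -/
theorem two_stage_lq_determinant_pos (q r a b : ℝ) (hq : 0 < q) (hr : 0 < r) :
    let f1 : ℝ := -(b * q * a) / (r + q * b ^ 2)
    let m1 : ℝ := q + r * q * a ^ 2 / (r + q * b ^ 2)
    let g11 : ℝ := -1 / (r + q * b ^ 2)
    let g00 : ℝ := -1 / (r + m1 * b ^ 2)
    let g01 : ℝ := -(b * f1) / (r + m1 * b ^ 2)
    ((1 - g00) * (1 - f1 * b * g01 - g11) - f1 * b * g00 * g01 > 0) ∧
      (∀ y0 y1 : ℝ,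
        (1 - g00) * y0 + (-g01) * y1 = 0 →
        (-(f1 * b * g00)) * y0 + (1 - f1 * b * g01 - g11) * y1 = 0 →
        y0 = 0 ∧ y1 = 0) := by
  intro f1 m1 g11 g00 g01
  have hd1 : 0 < r + q * b ^ 2 := by positivity
  have hm1 : 0 < m1 := by positivity
  have hd0 : 0 < r + m1 * b ^ 2 := by positivity
  have hg11 : g11 < 0 := div_neg_of_neg_of_pos (by norm_num) hd1
  have hg00 : g00 < 0 := div_neg_of_neg_of_pos (by norm_num) hd0
  have hcross : f1 * b * g01 ≤ 0 := by
    have h : f1 * b * g01 = -((f1 * b) ^ 2 / (r + m1 * b ^ 2)) := by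
      simp only [g01]
      ring
    rw [h]
    exact neg_nonpos.mpr (by positivity)
  have hdet : 0 < (1 - g00) * (1 - f1 * b * g01 - g11) - f1 * b * g00 * g01 := by
    have h : 0 < (1 - g00) * (1 - g11) := mul_pos (by linarith) (by linarith)
    linarith
  clear_value f1 g11 g00 g01
  refine ⟨hdet, fun y0 y1 h0 h1 => ⟨?_, ?_⟩⟩
  · refine (mul_eq_zero.mp ?_).resolve_left hdet.ne'
    linear_combination (1 - f1 * b * g01 - g11) * h0 + g01 * h1
  · refine (mul_eq_zero.mp ?_).resolve_left hdet.ne'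
    linear_combination (f1 * b * g00) * h0 + (1 - g00) * h1
end

section
/- For the two-stage scalar LQ example, the coefficients of DM i's exact optimal (Nash best) response to the SEBEU strategies of the other DMs converge to the SEBEU coefficients: lim_{N→∞}(f̃_0^N, f̃_1^N, k̃_1^N, ñ_1^N) = (f_0, f_1, 0, 0), where, with c^{−i}_N := (N−1)σ_x/N² (= cov[x̄_0^{−i}]), c_ξ := cov[ξ_0] > 0, k_1^N := (−1/(1 + r + qb²)) f_1(a + bf_0)(σ_x/N)f_0/((σ_x/N)f_0² + c_ξ), and ρ_N := f_0 c^{−i}_N/(f_0² c^{−i}_N + c_ξ): f̃_1^N := −qba/(r + qb² + 2/N); k̃_1^N := −f_1(a + bf_0)ρ_N/(r + qb² + 2/N) − k_1^N ((N−1)/N)/(r + qb² + 2/N); ñ_1^N := (1/N) f_1(a + bf_0)ρ_N/(r + qb² + 2/N); and f̃_0^N := −n_N/d_N with n_N = qba + (r + 2/N) f̃_1^N a (f̃_1^N b + k̃_1^N/N + ñ_1^N) + 2 f̃_1^N a ((N−1)/N) k_1^N/N + q(a + b f̃_1^N) a b (a + b f̃_1^N + k̃_1^N/N + ñ_1^N)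 and d_N = r + 2/N + qb² + (r + 2/N)(f̃_1^N b + k̃_1^N/N + ñ_1^N)² + 2(f̃_1^N b + k̃_1^N/N + ñ_1^N)((N−1)/N)k_1^N/N + qb²(a + b f̃_1^N + k̃_1^N/N + ñ_1^N)². Here f_1 = −bqa/(r + qb²) and f_0 = −b m_1 a/(r + m_1 b²) with m_1 = q + rqa²/(r + qb²). (Consequently, for any ε > 0 the SEBEU is an ε-Nash equilibrium for all sufficiently large N.) -/
open Filter Topology

/-- The one-step Riccati identity: the closed-loop cost with the optimal gain equals the
open-loop form `q + r q a² / (r + q b²)` of the Riccati update. -/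
lemma riccati_closed_loop (q r a b : ℝ) (h : r + q * b ^ 2 ≠ 0) :
    q + r * (-(b * q * a) / (r + q * b ^ 2)) ^ 2 +
        q * (a + b * (-(b * q * a) / (r + q * b ^ 2))) ^ 2 =
      q + r * q * a ^ 2 / (r + q * b ^ 2) := by
  field_simp
  ring

/-- Two-stage scalar LQ example: the coefficients
`(f̃₀ᴺ, f̃₁ᴺ, k̃₁ᴺ, ñ₁ᴺ)` of DM `i`'s exact optimal (Nash best) response to the SEBEU
strategies of the other DMs converge to the SEBEU coefficients `(f₀, f₁, 0, 0)` as
`N → ∞`.  (Consequently, for any `ε > 0` the SEBEU is an `ε`-Nash equilibrium for all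
sufficiently large `N`.) -/
theorem best_response_coeffs_tendsto_sebeu_coeffs (q r a b σx cξ : ℝ)
    (hq : 0 < q) (hr : 0 < r) (hσ : 0 ≤ σx) (hc : 0 < cξ) :
    let f1 : ℝ := -(b * q * a) / (r + q * b ^ 2)
    let m1 : ℝ := q + r * q * a ^ 2 / (r + q * b ^ 2)
    let f0 : ℝ := -(b * m1 * a) / (r + m1 * b ^ 2)
    -- cov[x̄₀^{-i}] = (N-1)σx/N²
    let cNi : ℕ → ℝ := fun N => ((N : ℝ) - 1) * σx / (N : ℝ) ^ 2
    -- SEBEU feedforward gain k₁ᴺ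
    let k1 : ℕ → ℝ := fun N =>
      (-1 / (1 + r + q * b ^ 2)) *
        (f1 * (a + b * f0) * (σx / N) * f0 / ((σx / N) * f0 ^ 2 + cξ))
    let ρ : ℕ → ℝ := fun N => f0 * cNi N / (f0 ^ 2 * cNi N + cξ)
    let f1t : ℕ → ℝ := fun N => -(q * b * a) / (r + q * b ^ 2 + 2 / N)
    let k1t : ℕ → ℝ := fun N =>
      -(f1 * (a + b * f0) * ρ N) / (r + q * b ^ 2 + 2 / N) -
        k1 N * (((N : ℝ) - 1) / N) / (r + q * b ^ 2 + 2 / N)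
    let n1t : ℕ → ℝ := fun N =>
      (1 / (N : ℝ)) * (f1 * (a + b * f0) * ρ N) / (r + q * b ^ 2 + 2 / N)
    let nN : ℕ → ℝ := fun N =>
      q * b * a +
        (r + 2 / N) * f1t N * a * (f1t N * b + k1t N / N + n1t N) +
        2 * f1t N * a * (((N : ℝ) - 1) / N) * k1 N / N +
        q * (a + b * f1t N) * a * b * (a + b * f1t N + k1t N / N + n1t N)
    let dN : ℕ → ℝ := fun N =>
      r + 2 / N + q * b ^ 2 +
        (r + 2 / N) * (f1t N * b + k1t N / N + n1t N) ^ 2 +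
        2 * (f1t N * b + k1t N / N + n1t N) * (((N : ℝ) - 1) / N) * k1 N / N +
        q * b ^ 2 * (a + b * f1t N + k1t N / N + n1t N) ^ 2
    let f0t : ℕ → ℝ := fun N => -nN N / dN N
    Filter.Tendsto (fun N : ℕ => (f0t N, f1t N, k1t N, n1t N))
      Filter.atTop (nhds (f0, f1, 0, 0)) := by
  intro f1 m1 f0 cNi k1 ρ f1t k1t n1t nN dN f0t
  have hD : 0 < r + q * b ^ 2 := by positivity
  have hm1 : 0 < m1 := by positivity
  have hd : 0 < r + m1 * b ^ 2 := by positivity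
  have hric : q + r * f1 ^ 2 + q * (a + b * f1) ^ 2 = m1 :=
    riccati_closed_loop q r a b hD.ne'
  have div_nat_zero (c : ℝ) : Tendsto (fun N : ℕ => c / (N : ℝ)) atTop (𝓝 0) :=
    tendsto_const_div_atTop_nhds_zero_nat c
  have hfrac : Tendsto (fun N : ℕ => ((N : ℝ) - 1) / N) atTop (𝓝 1) := by
    have h : Tendsto (fun N : ℕ => 1 - 1 / (N : ℝ)) atTop (𝓝 (1 - 0)) :=
      tendsto_const_nhds.sub (div_nat_zero 1)
    rw [sub_zero] at h
    refine h.congr' ?_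
    filter_upwards [eventually_ne_atTop 0] with N hN
    have : (N : ℝ) ≠ 0 := Nat.cast_ne_zero.mpr hN
    field_simp
  have hcNi : Tendsto cNi atTop (𝓝 0) := by
    have h := hfrac.mul (div_nat_zero σx)
    rw [mul_zero] at h
    refine h.congr fun N => ?_
    simp only [cNi]
    rw [div_mul_div_comm, sq]
  have hden : Tendsto (fun N : ℕ => r + q * b ^ 2 + 2 / (N : ℝ)) atTop
      (𝓝 (r + q * b ^ 2)) := by
    simpa using (div_nat_zero 2).const_add (r + q * b ^ 2)
  have hr2 : Tendsto (fun N : ℕ => r + 2 / (N : ℝ)) atTop (𝓝 r) := by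
    simpa using (div_nat_zero 2).const_add r
  have hk1 : Tendsto k1 atTop (𝓝 0) := by
    have h := ((((div_nat_zero σx).const_mul (f1 * (a + b * f0))).mul_const f0).div
      (((div_nat_zero σx).mul_const (f0 ^ 2)).add_const cξ)
      (by simpa using hc.ne')).const_mul (-1 / (1 + r + q * b ^ 2))
    simpa using h
  have hρ : Tendsto ρ atTop (𝓝 0) := by
    have h := (hcNi.const_mul f0).div ((hcNi.const_mul (f0 ^ 2)).add_const cξ)
      (by simpa using hc.ne')
    rwa [mul_zero, zero_div] at h
  have hf1t : Tendsto f1t atTop (𝓝 f1) := by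
    have h : Tendsto f1t atTop (𝓝 (-(q * b * a) / (r + q * b ^ 2))) :=
      tendsto_const_nhds.div hden hD.ne'
    rwa [mul_comm q b] at h
  have hgain := hρ.const_mul (f1 * (a + b * f0))
  have hk1t : Tendsto k1t atTop (𝓝 0) := by
    have h := (hgain.neg.div hden hD.ne').sub ((hk1.mul hfrac).div hden hD.ne')
    simpa using h
  have hn1t : Tendsto n1t atTop (𝓝 0) := by
    have h := ((div_nat_zero 1).mul hgain).div hden hD.ne'
    rwa [mul_zero, mul_zero, zero_div] at h
  have div_nat {u : ℕ → ℝ} (hu : Tendsto u atTop (𝓝 0)) :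
      Tendsto (fun N : ℕ => u N / N) atTop (𝓝 0) :=
    hu.div_atTop tendsto_natCast_atTop_atTop
  have hu1 : Tendsto (fun N : ℕ => f1t N * b + k1t N / N + n1t N) atTop (𝓝 (f1 * b)) := by
    simpa using ((hf1t.mul_const b).add (div_nat hk1t)).add hn1t
  have hcl : Tendsto (fun N => a + b * f1t N) atTop (𝓝 (a + b * f1)) :=
    (hf1t.const_mul b).const_add a
  have hx2 : Tendsto (fun N : ℕ => a + b * f1t N + k1t N / N + n1t N) atTop
      (𝓝 (a + b * f1)) := by
    simpa using (hcl.add (div_nat hk1t)).add hn1t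
  have hnN : Tendsto nN atTop (𝓝 (b * m1 * a)) := by
    have hcross : Tendsto (fun N : ℕ => 2 * f1t N * a * (((N : ℝ) - 1) / N) * k1 N / N)
        atTop (𝓝 0) :=
      div_nat (by simpa using (((hf1t.const_mul 2).mul_const a).mul hfrac).mul hk1)
    have h := (((((hr2.mul hf1t).mul_const a).mul hu1).const_add (q * b * a)).add hcross).add
      ((((hcl.const_mul q).mul_const a).mul_const b).mul hx2)
    convert h using 2
    rw [← hric]
    ring
  have hdN : Tendsto dN atTop (𝓝 (r + m1 * b ^ 2)) := by
    have hcross : Tendsto (fun N : ℕ => 2 * (f1t N * b + k1t N / N + n1t N) *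
        (((N : ℝ) - 1) / N) * k1 N / N) atTop (𝓝 0) :=
      div_nat (by simpa using ((hu1.const_mul 2).mul hfrac).mul hk1)
    have h := (((hr2.add_const (q * b ^ 2)).add (hr2.mul (hu1.pow 2))).add hcross).add
      ((hx2.pow 2).const_mul (q * b ^ 2))
    convert h using 2
    rw [← hric]
    ring
  have hf0t : Tendsto f0t atTop (𝓝 f0) := hnN.neg.div hdN hd.ne'
  exact hf0t.prodMk_nhds (hf1t.prodMk_nhds (hk1t.prodMk_nhds hn1t))
end
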